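/- arXiv:2301.13222 — 3 statements merged into one kernel-verified Lean document; each statement's English description precedes it below -/
import Mathlib

section
/- Let Q be a positive definite classical quadratic form over ℤ in r variables. If Q represents each of the integers 1, 2, 3, 5, 6, 7, 10, 14, and 15, then Q is universal, i.e., Q represents every positive integer. -/
/-- The integral ternary form `a x² + b y² + c z² + r yz + s xz + t xy` is positive definite,
has half-discriminant `d`, and represents `n`. -/
structure TernaryRep (d n a b c r s t : ℤ) : Prop where
  pos : 0 < a
  minor_pos : 0 < 4 * a * b - t ^ 2
  disc : 4 * a * b * c + r * s * t - a * r ^ 2 - b * s ^ 2 - c * t ^ 2 = d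
  rep : ∃ x y z : ℤ,
    a * x ^ 2 + b * y ^ 2 + c * z ^ 2 + r * y * z + s * x * z + t * x * y = n

namespace TernaryRep

variable {d n a b c r s t : ℤ}

theorem pos_b (h : TernaryRep d n a b c r s t) : 0 < b := by
  have h1 := h.pos
  have h2 := h.minor_pos
  by_contra hb
  nlinarith [sq_nonneg t, mul_nonneg h1.le (not_lt.mp hb |> neg_nonneg.mpr)]

theorem minor_eq (h : TernaryRep d n a b c r s t) :
    (4 * a * b - t ^ 2) * (4 * a * c - s ^ 2) - (2 * a * r - s * t) ^ 2 = 4 * a * d := by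
  rw [← h.disc]; ring

theorem minor_pos' (h : TernaryRep d n a b c r s t) (hd : 0 < d) : 0 < 4 * a * c - s ^ 2 := by
  have h1 := h.minor_eq
  have h2 : 0 < (4 * a * b - t ^ 2) * (4 * a * c - s ^ 2) := by
    nlinarith [sq_nonneg (2 * a * r - s * t), mul_pos h.pos hd]
  exact (pos_iff_pos_of_mul_pos h2).mp h.minor_pos

theorem swap_xy (h : TernaryRep d n a b c r s t) : TernaryRep d n b a c s r t where
  pos := h.pos_b
  minor_pos := by linarith [h.minor_pos]
  disc := by rw [← h.disc]; ring
  rep := by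
    obtain ⟨x, y, z, e⟩ := h.rep
    exact ⟨y, x, z, by rw [← e]; ring⟩

theorem swap_yz (h : TernaryRep d n a b c r s t) (hd : 0 < d) : TernaryRep d n a c b r t s where
  pos := h.pos
  minor_pos := h.minor_pos' hd
  disc := by rw [← h.disc]; ring
  rep := by
    obtain ⟨x, y, z, e⟩ := h.rep
    exact ⟨x, z, y, by rw [← e]; ring⟩

theorem shift_xy (h : TernaryRep d n a b c r s t) (k : ℤ) :
    TernaryRep d n a (b + a * k ^ 2 + t * k) c (r + s * k) s (t + 2 * a * k) where
  pos := h.pos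
  minor_pos := by nlinarith [h.minor_pos]
  disc := by rw [← h.disc]; ring
  rep := by
    obtain ⟨x, y, z, e⟩ := h.rep
    exact ⟨x - k * y, y, z, by rw [← e]; ring⟩

theorem shift_xz (h : TernaryRep d n a b c r s t) (k : ℤ) :
    TernaryRep d n a b (c + a * k ^ 2 + s * k) (r + t * k) (s + 2 * a * k) t where
  pos := h.pos
  minor_pos := h.minor_pos
  disc := by rw [← h.disc]; ring
  rep := by
    obtain ⟨x, y, z, e⟩ := h.rep
    exact ⟨x - k * z, y, z, by rw [← e]; ring⟩

theorem shift_yz (h : TernaryRep d n a b c r s t) (k : ℤ) :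
    TernaryRep d n a b (c + b * k ^ 2 + r * k) (r + 2 * b * k) (s + t * k) t where
  pos := h.pos
  minor_pos := h.minor_pos
  disc := by rw [← h.disc]; ring
  rep := by
    obtain ⟨x, y, z, e⟩ := h.rep
    exact ⟨x, y - k * z, z, by rw [← e]; ring⟩

theorem neg_x (h : TernaryRep d n a b c r s t) : TernaryRep d n a b c r (-s) (-t) where
  pos := h.pos
  minor_pos := by linarith [h.minor_pos]
  disc := by rw [← h.disc]; ring
  rep := by
    obtain ⟨x, y, z, e⟩ := h.rep
    exact ⟨-x, y, z, by rw [← e]; ring⟩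

theorem neg_z (h : TernaryRep d n a b c r s t) : TernaryRep d n a b c (-r) (-s) t where
  pos := h.pos
  minor_pos := h.minor_pos
  disc := by rw [← h.disc]; ring
  rep := by
    obtain ⟨x, y, z, e⟩ := h.rep
    exact ⟨x, y, -z, by rw [← e]; ring⟩

theorem exists_abs_add_le (u : ℤ) {m : ℤ} (hm : 0 < m) : ∃ k : ℤ, |u + 2 * m * k| ≤ m := by
  refine ⟨-((u + m) / (2 * m)), ?_⟩
  have h1 := Int.emod_add_mul_ediv (u + m) (2 * m)
  have h2 := Int.emod_nonneg (u + m) (show 2 * m ≠ 0 by omega)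
  have h3 := Int.emod_lt_of_pos (u + m) (show 0 < 2 * m by omega)
  have h4 : u + 2 * m * -((u + m) / (2 * m)) = (u + m) % (2 * m) - m := by linarith
  rw [h4, abs_le]
  constructor <;> linarith

theorem exists_reduced (h : TernaryRep d n a b c r s t) (hd : 0 < d) :
    ∃ a b c r s t : ℤ, TernaryRep d n a b c r s t ∧ |t| ≤ a ∧ |s| ≤ a ∧ a ≤ b ∧
      |2 * (2 * a * r - s * t)| ≤ 4 * a * b - t ^ 2 ∧
      4 * a * b - t ^ 2 ≤ 4 * a * c - s ^ 2 := by
  classical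
  have hex : ∃ k : ℕ, ∃ a b c r s t : ℤ, TernaryRep d n a b c r s t ∧ a = k :=
    ⟨a.toNat, a, b, c, r, s, t, h, by have := h.pos; omega⟩
  set a₀ := Nat.find hex with ha₀
  have hmin : ∀ a b c r s t : ℤ, TernaryRep d n a b c r s t → (a₀ : ℤ) ≤ a := by
    intro a b c r s t h
    have h1 := Nat.find_min' hex ⟨a, b, c, r, s, t, h, (Int.toNat_of_nonneg h.pos.le).symm⟩
    have := h.pos
    omega
  have hex' : ∃ k : ℕ, ∃ b c r s t : ℤ, TernaryRep d n a₀ b c r s t ∧ 4 * a₀ * b - t ^ 2 = k := by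
    obtain ⟨a, b, c, r, s, t, h, e⟩ := Nat.find_spec hex
    refine ⟨(4 * a * b - t ^ 2).toNat, b, c, r, s, t, ?_, ?_⟩
    · rw [ha₀, ← e]; exact h
    · rw [ha₀, ← e]; exact (Int.toNat_of_nonneg h.minor_pos.le).symm
  set A₀ := Nat.find hex' with hA₀
  have hmin' : ∀ b c r s t : ℤ, TernaryRep d n a₀ b c r s t →
      (A₀ : ℤ) ≤ 4 * a₀ * b - t ^ 2 := by
    intro b c r s t h
    have h1 := Nat.find_min' hex' ⟨b, c, r, s, t, h, (Int.toNat_of_nonneg h.minor_pos.le).symm⟩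
    have := h.minor_pos
    omega
  obtain ⟨b, c, r, s, t, h, e⟩ := Nat.find_spec hex'
  rw [← hA₀] at e
  obtain ⟨k, hk⟩ := exists_abs_add_le (2 * (2 * a₀ * r - s * t)) h.minor_pos
  have h := h.shift_yz k
  obtain ⟨k', hk'⟩ := exists_abs_add_le t h.pos
  have h := h.shift_xy k'
  obtain ⟨k'', hk''⟩ := exists_abs_add_le (s + t * k) h.pos
  have h := h.shift_xz k''
  refine ⟨_, _, _, _, _, _, h, hk', hk'', hmin _ _ _ _ _ _ h.swap_xy, ?_, ?_⟩
  · refine le_trans (le_of_eq ?_) (le_trans hk (le_of_eq ?_))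
    · congr 1; ring
    · ring
  · refine le_trans (le_of_eq ?_) (hmin' _ _ _ _ _ (h.swap_yz hd))
    rw [← e]; ring

theorem exists_one_one (h : TernaryRep d n a b c r s t) (hd : 0 < d) (hd' : d ≤ 7) :
    ∃ c r s t : ℤ, TernaryRep d n 1 1 c r s t ∧ 0 ≤ t ∧ t ≤ 1 ∧ 0 ≤ s ∧ s ≤ 1 ∧
      |2 * (2 * r - s * t)| ≤ 4 - t ^ 2 := by
  obtain ⟨a, b, c, r, s, t, h, ht, hs, hab, hB, hAC⟩ := h.exists_reduced hd
  have ha := h.pos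
  have hA := h.minor_pos
  have hm := h.minor_eq
  rw [abs_le] at ht hs
  have ht2 : t ^ 2 ≤ a ^ 2 := by nlinarith
  have hA3 : 3 * a ^ 2 ≤ 4 * a * b - t ^ 2 := by nlinarith
  have hB2 : 4 * (2 * a * r - s * t) ^ 2 ≤ (4 * a * b - t ^ 2) ^ 2 := by
    have := sq_le_sq' (by linarith [abs_le.mp hB]) (abs_le.mp hB).2
    linarith
  have hA2 : 3 * (4 * a * b - t ^ 2) ^ 2 ≤ 16 * a * d := by nlinarith
  have ha1 : a = 1 := by
    have h1 : 9 * a ^ 4 ≤ (4 * a * b - t ^ 2) ^ 2 := by nlinarith [sq_nonneg a]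
    have h2 : 27 * a ^ 4 ≤ 16 * a * 7 := by nlinarith
    have h3 : 27 * a ^ 3 ≤ 112 := by nlinarith
    by_contra hne
    have : 2 ≤ a := by omega
    nlinarith [pow_le_pow_left₀ (by norm_num : (0:ℤ) ≤ 2) this 3]
  subst ha1
  have hA6 : 4 * 1 * b - t ^ 2 ≤ 6 := by nlinarith
  have hb : b = 1 := by nlinarith
  subst hb
  have hB' : |2 * (2 * r - s * t)| ≤ 4 - t ^ 2 := by simpa using hB
  clear hB hAC hA3 hB2 hA2 hA6 hm
  wlog ht0 : 0 ≤ t generalizing s t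
  · exact this (-s) (-t) (by constructor <;> linarith) (by constructor <;> linarith)
      (by simpa using ht2) h.neg_x (by simpa using hA) (by simpa using hB') (by linarith)
  rcases le_total 0 s with hs0 | hs0
  · exact ⟨c, r, s, t, h, ht0, ht.2, hs0, hs.2, hB'⟩
  · refine ⟨c, -r, -s, t, h.neg_z, ht0, ht.2, by linarith, by linarith, ?_⟩
    rw [← abs_neg]
    convert hB' using 2
    ring

theorem three_squares (h : TernaryRep 4 n a b c r s t) : ∃ x y z : ℤ, n = x ^ 2 + y ^ 2 + z ^ 2 := by
  obtain ⟨c, r, s, t, h, ht, ht', hs, hs', hr⟩ := h.exists_one_one (by norm_num) (by norm_num)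
  obtain ⟨x, y, z, e⟩ := h.rep
  have hd := h.disc
  rw [abs_le] at hr
  clear h
  have hr1 : -1 ≤ r := by nlinarith
  have hr2 : r ≤ 1 := by nlinarith
  interval_cases t <;> interval_cases s <;> interval_cases r <;> try omega
  obtain rfl : c = 1 := by omega
  exact ⟨x, y, z, by rw [← e]; ring⟩

theorem eisenstein (h : TernaryRep 3 n a b c r s t) :
    ∃ x y z : ℤ, n = x ^ 2 + (y ^ 2 + y * z + z ^ 2) := by
  obtain ⟨c, r, s, t, h, ht, ht', hs, hs', hr⟩ := h.exists_one_one (by norm_num) (by norm_num)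
  obtain ⟨x, y, z, e⟩ := h.rep
  have hd := h.disc
  rw [abs_le] at hr
  clear h
  have hr1 : -1 ≤ r := by nlinarith
  have hr2 : r ≤ 1 := by nlinarith
  interval_cases t <;> interval_cases s <;> interval_cases r <;> try omega
  all_goals obtain rfl : c = 1 := by omega
  · exact ⟨x, y, -z, by rw [← e]; ring⟩
  · exact ⟨x, y, z, by rw [← e]; ring⟩
  · exact ⟨y, x, z, by rw [← e]; ring⟩
  · exact ⟨z, x, y, by rw [← e]; ring⟩

theorem five (h : TernaryRep 5 n a b c r s t) :
    ∃ x y z : ℤ, n = x ^ 2 + y ^ 2 + 2 * z ^ 2 + x * y + x * z := by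
  obtain ⟨c, r, s, t, h, ht, ht', hs, hs', hr⟩ := h.exists_one_one (by norm_num) (by norm_num)
  obtain ⟨x, y, z, e⟩ := h.rep
  have hd := h.disc
  rw [abs_le] at hr
  clear h
  have hr1 : -1 ≤ r := by nlinarith
  have hr2 : r ≤ 1 := by nlinarith
  interval_cases t <;> interval_cases s <;> interval_cases r <;> try omega
  all_goals obtain rfl : c = 2 := by omega
  · exact ⟨x, y, z, by rw [← e]; ring⟩
  · exact ⟨-(x + y), x, -z, by rw [← e]; ring⟩

theorem seven (h : TernaryRep 7 n a b c r s t) :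
    ∃ x y z : ℤ, n = x ^ 2 + (y ^ 2 + y * z + 2 * z ^ 2) := by
  obtain ⟨c, r, s, t, h, ht, ht', hs, hs', hr⟩ := h.exists_one_one (by norm_num) (by norm_num)
  obtain ⟨x, y, z, e⟩ := h.rep
  have hd := h.disc
  rw [abs_le] at hr
  clear h
  have hr1 : -1 ≤ r := by nlinarith
  have hr2 : r ≤ 1 := by nlinarith
  interval_cases t <;> interval_cases s <;> interval_cases r <;> try omega
  all_goals obtain rfl : c = 2 := by omega
  · exact ⟨x, y, -z, by rw [← e]; ring⟩
  · exact ⟨x, y, z, by rw [← e]; ring⟩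
  · exact ⟨y, x, z, by rw [← e]; ring⟩

end TernaryRep

section

open NumberTheorySymbols ZMod

theorem exists_prime_linear {A B : ℤ} (hB : 0 < B) (h : IsCoprime A B) :
    ∃ (p : ℕ) (k : ℕ), p.Prime ∧ 2 < p ∧ (p : ℤ) = A + B * k := by
  obtain ⟨p, hp, hpp, hmod⟩ := Nat.forall_exists_prime_gt_and_zmodEq (A.natAbs + 2)
    (q := B.toNat) (a := A) (by omega) (by rwa [Int.toNat_of_nonneg hB.le])
  rw [Int.toNat_of_nonneg hB.le] at hmod
  obtain ⟨k, hk⟩ := hmod.symm.dvd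
  have hk0 : 0 ≤ k := by
    by_contra hk0
    have : B * k < 0 := mul_neg_of_pos_of_neg hB (by omega)
    omega
  refine ⟨p, k.toNat, hpp, by omega, ?_⟩
  rw [Int.toNat_of_nonneg hk0]
  omega

theorem exists_dvd_add_sq {q δ : ℕ} (hq : q.Prime) (h : J(-(δ : ℤ) | q) = 1) :
    ∃ t : ℤ, (q : ℤ) ∣ δ + t ^ 2 := by
  have := Fact.mk hq
  obtain ⟨s, hs⟩ := ZMod.isSquare_of_jacobiSym_eq_one h
  obtain ⟨t, rfl⟩ := ZMod.intCast_surjective s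
  refine ⟨t, ?_⟩
  rw [← ZMod.intCast_zmod_eq_zero_iff_dvd]
  push_cast at hs ⊢
  rw [sq, ← hs]; ring

theorem jacobiSym_mul_sub (m e : ℤ) (δ : ℕ) : J(m * δ - e | δ) = J(-e | δ) :=
  jacobiSym.mod_left' (Int.emod_eq_emod_iff_emod_sub_eq_zero.2 (by ring_nf; simp))

namespace TernaryRep

theorem of_dvd {d n δ a r t : ℤ} (ha : 0 < a) (hδ : 0 < δ) (hd : 4 * n * δ - a * r ^ 2 = d)
    (h : a ∣ δ + t ^ 2) : ∃ b, TernaryRep d n a b n r 0 (2 * t) := by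
  obtain ⟨b, hb⟩ := h
  refine ⟨b, ha, ?_, ?_, 0, 0, 1, by ring⟩
  · nlinarith
  · rw [← hd]; linear_combination (-4 * n) * hb

end TernaryRep

theorem three_squares_of_two_mod_four {n : ℤ} (hn : 0 < n) (h : n % 4 = 2) :
    ∃ x y z : ℤ, n = x ^ 2 + y ^ 2 + z ^ 2 := by
  have hc : IsCoprime (n - 1) (4 * n) := by
    refine IsCoprime.mul_right ⟨1, -(n / 4), by omega⟩ ⟨-1, 1, by ring⟩
  obtain ⟨q, k, hq, -, e⟩ := exists_prime_linear (by omega) hc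
  have e' : (q : ℤ) = n * (4 * k + 1 : ℕ) - 1 := by push_cast; linarith
  obtain ⟨j, hj⟩ : ∃ j, n = 4 * j + 2 := ⟨n / 4, by omega⟩
  have hq4 : q % 4 = 1 := by
    have : (q : ℤ) = 4 * (j * (4 * k + 1) + 2 * k) + 1 := by rw [e', hj]; push_cast; ring
    omega
  have hδ4 : (4 * k + 1) % 4 = 1 := by omega
  have hJ : J(-((4 * k + 1 : ℕ) : ℤ) | q) = 1 := by
    rw [jacobiSym.neg _ (Nat.odd_iff.mpr (by omega)), χ₄_nat_one_mod_four hq4, one_mul,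
      jacobiSym.quadratic_reciprocity_one_mod_four hδ4 (Nat.odd_iff.mpr (by omega)), e',
      jacobiSym_mul_sub,
      jacobiSym.at_neg_one (Nat.odd_iff.mpr (by omega)), χ₄_nat_one_mod_four hδ4]
  obtain ⟨t, ht⟩ := exists_dvd_add_sq hq hJ
  obtain ⟨b, hb⟩ := TernaryRep.of_dvd (d := 4) (n := n) (r := 2) (by have := hq.pos; omega)
    (by omega) (by rw [e']; ring) ht
  exact hb.three_squares

theorem three_squares_of_odd {n δ₀ : ℤ} (hn : 0 < n) (hδ₀ : 0 ≤ δ₀) (h : n * δ₀ % 4 = 3)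
    (hJ : ∀ δ q : ℕ, (δ : ℤ) % 8 = δ₀ % 8 → 2 * (q : ℤ) = n * δ - 1 → J(-(δ : ℤ) | q) = 1) :
    ∃ x y z : ℤ, n = x ^ 2 + y ^ 2 + z ^ 2 := by
  obtain ⟨c, hc'⟩ : ∃ c, n * δ₀ = 2 * c + 1 := ⟨n * δ₀ / 2, by omega⟩
  have hc : IsCoprime c (4 * n) := by
    refine IsCoprime.mul_right ?_ ⟨-2, δ₀, by linarith⟩
    rcases (by omega : c % 4 = 1 ∨ c % 4 = 3) with h1 | h1
    · exact ⟨1, -(c / 4), by omega⟩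
    · exact ⟨-1, c / 4 + 1, by omega⟩
  obtain ⟨q, k, hq, hq2, e⟩ := exists_prime_linear (by omega) hc
  lift δ₀ to ℕ using hδ₀
  have e' : 2 * (q : ℤ) = n * (δ₀ + 8 * k : ℕ) - 1 := by push_cast; linarith
  obtain ⟨t, ht⟩ := exists_dvd_add_sq hq (hJ (δ₀ + 8 * k) q (by push_cast; omega) e')
  have hqo := hq.eq_two_or_odd
  have hδo : (δ₀ : ℤ) % 2 = 1 := by
    rcases Int.emod_two_eq_zero_or_one (δ₀ : ℤ) with h0 | h0
    · obtain ⟨m, hm⟩ : (2 : ℤ) ∣ δ₀ := ⟨δ₀ / 2, by omega⟩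
      rw [hm, show n * (2 * m) = 2 * (n * m) by ring] at h
      omega
    · exact h0
  obtain ⟨t, ht2, ht⟩ : ∃ t : ℤ, t % 2 = 1 ∧ (q : ℤ) ∣ (δ₀ + 8 * k : ℕ) + t ^ 2 := by
    rcases Int.emod_two_eq_zero_or_one t with h0 | h0
    · refine ⟨t + q, by omega, ?_⟩
      have := dvd_add ht (dvd_mul_right (q : ℤ) (2 * t + q))
      rwa [show (δ₀ + 8 * k : ℕ) + t ^ 2 + q * (2 * t + q) = (δ₀ + 8 * k : ℕ) + (t + q) ^ 2 by
        ring] at this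
    · exact ⟨t, h0, ht⟩
  have ht : 2 * (q : ℤ) ∣ (δ₀ + 8 * k : ℕ) + t ^ 2 := by
    refine IsCoprime.mul_dvd ⟨-((q : ℤ) / 2), 1, by omega⟩ ?_ ht
    obtain ⟨u, hu⟩ : ∃ u, t = 2 * u + 1 := ⟨t / 2, by omega⟩
    refine ⟨δ₀ / 2 + 4 * k + 2 * u ^ 2 + 2 * u + 1, ?_⟩
    have hδ2 : (δ₀ : ℤ) = 2 * ((δ₀ : ℤ) / 2) + 1 := by omega
    rw [hu]
    push_cast
    linear_combination hδ2
  obtain ⟨b, hb⟩ := TernaryRep.of_dvd (d := 4) (n := n) (r := 2) (by have := hq.pos; omega)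
    (by omega) (by rw [e']; ring) ht
  exact hb.three_squares

theorem three_squares_of_odd_mod_eight {n : ℤ} (hn : 0 < n)
    (h : n % 8 = 1 ∨ n % 8 = 3 ∨ n % 8 = 5) : ∃ x y z : ℤ, n = x ^ 2 + y ^ 2 + z ^ 2 := by
  have key : ∀ δ₀ : ℤ, 0 ≤ δ₀ → (n % 8 = 3 ∧ δ₀ = 1 ∨ (n % 8 = 1 ∨ n % 8 = 5) ∧ δ₀ = 3) →
      ∃ x y z : ℤ, n = x ^ 2 + y ^ 2 + z ^ 2 := by
    intro δ₀ hδ₀ h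
    refine three_squares_of_odd hn hδ₀ ?_ ?_
    · rcases h with ⟨h, rfl⟩ | ⟨h, rfl⟩ <;> omega
    intro δ q hδ e
    have hδo : Odd δ := by rw [Nat.odd_iff]; rcases h with ⟨h, rfl⟩ | ⟨h, rfl⟩ <;> omega
    have h2 : J(2 | δ) * J((q : ℤ) | δ) = J(-1 | δ) := by
      rw [← jacobiSym.mul_left, e, jacobiSym_mul_sub]
    obtain ⟨i, hi⟩ : ∃ i, n = 8 * i + n % 8 := ⟨n / 8, by omega⟩
    obtain ⟨j, hj⟩ : ∃ j, (δ : ℤ) = 8 * j + δ₀ % 8 := ⟨δ / 8, by omega⟩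
    have hexp : n * δ = 8 * (8 * i * j + i * (δ₀ % 8) + j * (n % 8)) + (n % 8) * (δ₀ % 8) := by
      rw [hj]; nth_rewrite 1 [hi]; ring
    rw [jacobiSym.at_two hδo, jacobiSym.at_neg_one hδo, χ₈_nat_eq_if_mod_eight,
      χ₄_nat_eq_if_mod_four] at h2
    rcases h with ⟨h, rfl⟩ | ⟨h | h, rfl⟩ <;> rw [h] at hexp
    · have hq4 : q % 4 = 1 := by omega
      have h8 : δ % 8 = 1 := by omega
      have h4 : δ % 4 = 1 := by omega
      have h22 : δ % 2 = 1 := by omega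
      rw [jacobiSym.neg _ (Nat.odd_iff.mpr (by omega)), χ₄_nat_one_mod_four hq4, one_mul,
        jacobiSym.quadratic_reciprocity_one_mod_four' hδo hq4]
      simpa [h8, h4, h22] using h2
    · have hq4 : q % 4 = 1 := by omega
      have h8 : δ % 8 = 3 := by omega
      have h4 : δ % 4 = 3 := by omega
      have h22 : δ % 2 = 1 := by omega
      rw [jacobiSym.neg _ (Nat.odd_iff.mpr (by omega)), χ₄_nat_one_mod_four hq4, one_mul,
        jacobiSym.quadratic_reciprocity_one_mod_four' hδo hq4]
      simpa [h8, h4, h22] using h2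
    · have hq4 : q % 4 = 3 := by omega
      have h8 : δ % 8 = 3 := by omega
      have h4 : δ % 4 = 3 := by omega
      have h22 : δ % 2 = 1 := by omega
      rw [jacobiSym.neg _ (Nat.odd_iff.mpr (by omega)), χ₄_nat_three_mod_four hq4,
        jacobiSym.quadratic_reciprocity_three_mod_four h4 hq4]
      simpa [h8, h4, h22] using h2
  rcases h with h | h | h
  · exact key 3 (by norm_num) (by omega)
  · exact key 1 (by norm_num) (by omega)
  · exact key 3 (by norm_num) (by omega)

/-- Legendre's three-square theorem for integers that are not divisible by `4`. -/
theorem three_squares {n : ℤ} (hn : 0 < n) (h : n % 4 = 1 ∨ n % 4 = 2 ∨ n % 8 = 3) :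
    ∃ x y z : ℤ, n = x ^ 2 + y ^ 2 + z ^ 2 := by
  by_cases h2 : n % 4 = 2
  · exact three_squares_of_two_mod_four hn h2
  · exact three_squares_of_odd_mod_eight hn (by omega)

/-- If `k a = 4 m δ - e` with `a` prime and `k e = p`, then `-δ` is a square modulo `a` as soon as
`δ` has the right residue symbol modulo `p`. -/
theorem exists_dvd_add_sq_of_symbol {p k e δ a : ℕ} {m : ℤ} (hp : p % 2 = 1) (hke : k * e = p)
    (hδ4 : δ % 4 = 1) (ha : a.Prime) (ha2 : 2 < a) (h : (k : ℤ) * a = 4 * m * δ - e)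
    (hJ : p % 4 = 3 ∧ J((δ : ℤ) | p) = 1 ∨ p % 4 = 1 ∧ J((δ : ℤ) | p) = -1) :
    ∃ t : ℤ, (a : ℤ) ∣ δ + t ^ 2 := by
  refine exists_dvd_add_sq ha ?_
  have hδo : Odd δ := Nat.odd_iff.mpr (by omega)
  have hao : Odd a := Nat.odd_iff.mpr (ha.eq_two_or_odd.resolve_left (by omega))
  have h1 : J((k : ℤ) | δ) * J((a : ℤ) | δ) = J((e : ℤ) | δ) := by
    rw [← jacobiSym.mul_left, h, jacobiSym_mul_sub, jacobiSym.neg _ hδo, χ₄_nat_one_mod_four hδ4,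
      one_mul]
  have h2 : J((k : ℤ) | δ) * J((e : ℤ) | δ) = J((δ : ℤ) | p) := by
    rw [← jacobiSym.mul_left, jacobiSym.quadratic_reciprocity_one_mod_four hδ4
      (Nat.odd_iff.mpr hp), ← hke]
    push_cast
    rfl
  have h3 : J((a : ℤ) | δ) = J((δ : ℤ) | p) := by
    rcases jacobiSym.trichotomy (k : ℤ) δ with hk | hk | hk <;> rw [hk] at h1 h2
    · rcases hJ with ⟨-, hJ⟩ | ⟨-, hJ⟩ <;> rw [hJ] at h2 <;> norm_num at h2
    · linarith
    · linarith
  have hmod : k * a % 4 = 3 * e % 4 := by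
    have : (k : ℤ) * a = 4 * (m * δ) - e := by rw [h]; ring
    have h' : ((k * a : ℕ) : ℤ) = 4 * (m * δ) - e := by push_cast; exact this
    omega
  have hmod' : k % 4 * (a % 4) % 4 = 3 * (e % 4) % 4 := by
    rw [← Nat.mul_mod, hmod]; omega
  have hp4 : k % 4 * (e % 4) % 4 = p % 4 := by rw [← Nat.mul_mod, hke]
  have ha4 : a % 2 = 1 := Nat.odd_iff.mp hao
  have hk4 := Nat.mod_lt k (show 0 < 4 by norm_num)
  have he4 := Nat.mod_lt e (show 0 < 4 by norm_num)
  rw [jacobiSym.neg _ hao, jacobiSym.quadratic_reciprocity_one_mod_four hδ4 hao, h3]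
  rcases hJ with ⟨hp', hJ⟩ | ⟨hp', hJ⟩ <;> rw [hJ]
  · have : a % 4 = 1 := by
      rw [hp'] at hp4
      interval_cases hk' : k % 4 <;> interval_cases he' : e % 4 <;> omega
    rw [χ₄_nat_one_mod_four this]; norm_num
  · have : a % 4 = 3 := by
      rw [hp'] at hp4
      interval_cases hk' : k % 4 <;> interval_cases he' : e % 4 <;> omega
    rw [χ₄_nat_three_mod_four this]; norm_num

theorem exists_ternaryRep_of_not_dvd {p δ₀ : ℕ} {n : ℤ} (hn : 0 < n) (hp : p.Prime) (hp2 : p ≠ 2)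
    (hpn : ¬ (p : ℤ) ∣ n) (hδ4 : δ₀ % 4 = 1)
    (hJ : p % 4 = 3 ∧ J((δ₀ : ℤ) | p) = 1 ∨ p % 4 = 1 ∧ J((δ₀ : ℤ) | p) = -1) :
    ∃ a b c r s t, TernaryRep p n a b c r s t := by
  have hpodd : p % 2 = 1 := hp.eq_two_or_odd.resolve_left hp2
  have hp4 : IsCoprime (p : ℤ) 4 := by
    have := (Nat.coprime_primes hp Nat.prime_two).2 hp2
    exact (Nat.isCoprime_iff_coprime.2 (this.pow_right 2))
  have hpn' : IsCoprime (p : ℤ) n := (Nat.prime_iff_prime_int.1 hp).coprime_iff_not_dvd.2 hpn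
  have hδp : IsCoprime (p : ℤ) δ₀ := by
    rw [(Nat.prime_iff_prime_int.1 hp).coprime_iff_not_dvd]
    intro hd
    have : J((δ₀ : ℤ) | p) = 0 := by
      have := NeZero.mk hp.ne_zero
      rw [jacobiSym.eq_zero_iff_not_coprime]
      intro h1
      have h2 := Int.dvd_coe_gcd hd (dvd_refl (p : ℤ))
      rw [h1] at h2
      exact hp.one_lt.ne' (Nat.dvd_one.1 (by exact_mod_cast h2))
    rcases hJ with ⟨-, hJ⟩ | ⟨-, hJ⟩ <;> omega
  have hc : IsCoprime (4 * n * δ₀ - p) (16 * n * p) := by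
    have h4 : IsCoprime (4 * n * δ₀ - p) 4 := by
      rw [show 4 * n * δ₀ - p = -(p : ℤ) + 4 * (n * δ₀) by ring]
      exact hp4.neg_left.add_mul_left_left (n * δ₀)
    have h16 : IsCoprime (4 * n * δ₀ - p) (4 * 4) := h4.mul_right h4
    refine IsCoprime.mul_right (IsCoprime.mul_right (by simpa using h16) ?_) ?_
    · rw [show 4 * n * δ₀ - p = -(p : ℤ) + n * (4 * δ₀) by ring]
      exact hpn'.neg_left.add_mul_left_left (4 * δ₀)
    · rw [show 4 * n * δ₀ - p = 4 * n * δ₀ + (-1) * (p : ℤ) by ring]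
      exact ((hp4.symm.mul_left hpn'.symm).mul_left hδp.symm).add_mul_right_left (-1)
  obtain ⟨a, j, ha, ha2, e⟩ := exists_prime_linear (by have := hp.pos; positivity) hc
  have e' : (a : ℤ) = 4 * n * (δ₀ + 4 * p * j : ℕ) - p := by rw [e]; push_cast; ring
  obtain ⟨t, ht⟩ := exists_dvd_add_sq_of_symbol (k := 1) (e := p) (m := n)
    (δ := δ₀ + 4 * p * j) hpodd (one_mul p) (by rw [mul_assoc]; omega) ha ha2
    (by rw [← e']; simp) (by
      have : J(((δ₀ + 4 * p * j : ℕ) : ℤ) | p) = J((δ₀ : ℤ) | p) :=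
        jacobiSym.mod_left' (Int.emod_eq_emod_iff_emod_sub_eq_zero.2 
          (Int.emod_eq_zero_of_dvd ⟨4 * j, by push_cast; ring⟩))
      rwa [this])
  obtain ⟨b, hb⟩ := TernaryRep.of_dvd (d := p) (n := n) (r := 1) (by have := ha.pos; omega)
    (by omega) (by rw [e']; ring) ht
  exact ⟨_, _, _, _, _, _, hb⟩

theorem exists_ternaryRep_of_dvd {p δ₀ : ℕ} {n : ℤ} (hn : 0 < n) (hp : p % 2 = 1) 
    (hδ4 : δ₀ % 4 = 1) (hdvd : (p : ℤ) ∣ 4 * n * δ₀ - 1)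
    (hJ : p % 4 = 3 ∧ J((δ₀ : ℤ) | p) = 1 ∨ p % 4 = 1 ∧ J((δ₀ : ℤ) | p) = -1) :
    ∃ a b c r s t, TernaryRep p (p * n) a b c r s t := by
  obtain ⟨a₀, ha₀⟩ := hdvd
  have hc : IsCoprime a₀ (16 * n) := by
    have h4 : IsCoprime a₀ 4 := ⟨-p, n * δ₀, by linarith⟩
    have h16 : IsCoprime a₀ (4 * 4) := h4.mul_right h4
    exact IsCoprime.mul_right (by simpa using h16) ⟨-p, 4 * δ₀, by linarith⟩
  obtain ⟨a, j, ha, ha2, e⟩ := exists_prime_linear (by positivity) hc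
  have e' : (p : ℤ) * a = 4 * n * (δ₀ + 4 * p * j : ℕ) - (1 : ℕ) := by
    rw [e]; push_cast; linear_combination -ha₀
  obtain ⟨t, ht⟩ := exists_dvd_add_sq_of_symbol (k := p) (e := 1) (m := n)
    (δ := δ₀ + 4 * p * j) hp (mul_one p) (by rw [mul_assoc]; omega) ha ha2 e' (by
      have : J(((δ₀ + 4 * p * j : ℕ) : ℤ) | p) = J((δ₀ : ℤ) | p) :=
        jacobiSym.mod_left' (Int.emod_eq_emod_iff_emod_sub_eq_zero.2 
          (Int.emod_eq_zero_of_dvd ⟨4 * j, by push_cast; ring⟩))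
      rwa [this])
  obtain ⟨b, hb⟩ := TernaryRep.of_dvd (d := p) (n := p * n) (r := p) (by have := ha.pos; omega)
    (by omega) (by push_cast at e' ⊢; linear_combination (-p : ℤ) * e') ht
  exact ⟨_, _, _, _, _, _, hb⟩

theorem exists_eisenstein {n : ℤ} (hn : 0 < n) (h : n % 3 ≠ 0 ∨ n % 9 = 3) :
    ∃ x y z : ℤ, n = x ^ 2 + (y ^ 2 + y * z + z ^ 2) := by
  rcases h with h | h
  · obtain ⟨_, _, _, _, _, _, h⟩ := exists_ternaryRep_of_not_dvd (p := 3) (δ₀ := 1) hn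
      Nat.prime_three (by norm_num) (by omega) rfl (by simp)
    exact h.eisenstein
  · obtain ⟨m, rfl⟩ : ∃ m, n = 3 * m := ⟨n / 3, by omega⟩
    obtain ⟨_, _, _, _, _, _, h⟩ := exists_ternaryRep_of_dvd (p := 3) (δ₀ := 1) (n := m)
      (by omega) rfl rfl (by push_cast; omega) (by simp)
    exact h.eisenstein

theorem exists_five {n : ℤ} (hn : 0 < n) (h : n % 5 ≠ 0 ∨ n % 25 = 10 ∨ n % 25 = 15) :
    ∃ x y z : ℤ, n = x ^ 2 + y ^ 2 + 2 * z ^ 2 + x * y + x * z := by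
  have h17 : J(((17 : ℕ) : ℤ) | 5) = -1 := by norm_num
  have h13 : J(((13 : ℕ) : ℤ) | 5) = -1 := by norm_num
  rcases h with h | h | h
  · obtain ⟨_, _, _, _, _, _, h⟩ := exists_ternaryRep_of_not_dvd (p := 5) (δ₀ := 17) hn
      Nat.prime_five (by norm_num) (by omega) rfl (.inr ⟨rfl, h17⟩)
    exact h.five
  · obtain ⟨m, rfl⟩ : ∃ m, n = 5 * m := ⟨n / 5, by omega⟩
    obtain ⟨_, _, _, _, _, _, h⟩ := exists_ternaryRep_of_dvd (p := 5) (δ₀ := 17) (n := m)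
      (by omega) rfl rfl (by push_cast; omega) (.inr ⟨rfl, h17⟩)
    exact h.five
  · obtain ⟨m, rfl⟩ : ∃ m, n = 5 * m := ⟨n / 5, by omega⟩
    obtain ⟨_, _, _, _, _, _, h⟩ := exists_ternaryRep_of_dvd (p := 5) (δ₀ := 13) (n := m)
      (by omega) rfl rfl (by push_cast; omega) (.inr ⟨rfl, h13⟩)
    exact h.five

theorem exists_seven {n : ℤ} (hn : 0 < n)
    (h : n % 7 ≠ 0 ∨ n % 49 = 7 ∨ n % 49 = 14 ∨ n % 49 = 28) :
    ∃ x y z : ℤ, n = x ^ 2 + (y ^ 2 + y * z + 2 * z ^ 2) := by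
  have h9 : J(((9 : ℕ) : ℤ) | 7) = 1 := by norm_num
  have h25 : J(((25 : ℕ) : ℤ) | 7) = 1 := by norm_num
  rcases h with h | h | h | h
  · obtain ⟨_, _, _, _, _, _, h⟩ := exists_ternaryRep_of_not_dvd (p := 7) (δ₀ := 1) hn
      Nat.prime_seven (by norm_num) (by omega) rfl (by simp)
    exact h.seven
  · obtain ⟨m, rfl⟩ : ∃ m, n = 7 * m := ⟨n / 7, by omega⟩
    obtain ⟨_, _, _, _, _, _, h⟩ := exists_ternaryRep_of_dvd (p := 7) (δ₀ := 9) (n := m)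
      (by omega) rfl rfl (by push_cast; omega) (.inl ⟨rfl, h9⟩)
    exact h.seven
  · obtain ⟨m, rfl⟩ : ∃ m, n = 7 * m := ⟨n / 7, by omega⟩
    obtain ⟨_, _, _, _, _, _, h⟩ := exists_ternaryRep_of_dvd (p := 7) (δ₀ := 1) (n := m)
      (by omega) rfl rfl (by push_cast; omega) (by simp)
    exact h.seven
  · obtain ⟨m, rfl⟩ : ∃ m, n = 7 * m := ⟨n / 7, by omega⟩
    obtain ⟨_, _, _, _, _, _, h⟩ := exists_ternaryRep_of_dvd (p := 7) (δ₀ := 25) (n := m)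
      (by omega) rfl rfl (by push_cast; omega) (.inl ⟨rfl, h25⟩)
    exact h.seven

end

/-- `n` is a sum of three integer squares. -/
def IsSumThreeSq (n : ℤ) : Prop := ∃ x y z : ℤ, n = x ^ 2 + y ^ 2 + z ^ 2

theorem sq_mod_two_power (x : ℤ) :
    x % 2 = 1 ∧ x ^ 2 % 8 = 1 ∨ x % 4 = 0 ∧ x ^ 2 % 16 = 0 ∨ x % 4 = 2 ∧ x ^ 2 % 32 = 4 := by
  have key : ∀ k : ℤ, ∃ j, k * (k + 1) = 2 * j := fun k ↦ by
    obtain ⟨j, hj⟩ := Int.even_mul_succ_self k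
    exact ⟨j, by omega⟩
  rcases (by omega : x % 2 = 1 ∨ x % 4 = 0 ∨ x % 4 = 2) with h | h | h
  · obtain ⟨k, rfl⟩ : ∃ k, x = 2 * k + 1 := ⟨x / 2, by omega⟩
    obtain ⟨j, hj⟩ := key k
    have : (2 * k + 1) ^ 2 = 8 * j + 1 := by linear_combination 4 * hj
    omega
  · obtain ⟨k, rfl⟩ : ∃ k, x = 4 * k := ⟨x / 4, by omega⟩
    have : (4 * k) ^ 2 = 16 * (k ^ 2) := by ring
    omega
  · obtain ⟨k, rfl⟩ : ∃ k, x = 4 * k + 2 := ⟨x / 4, by omega⟩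
    obtain ⟨j, hj⟩ := key k
    have : (4 * k + 2) ^ 2 = 32 * j + 4 := by linear_combination 16 * hj
    omega

theorem sq_mod_three_power (x : ℤ) :
    x % 3 = 0 ∧ x ^ 2 % 9 = 0 ∨ x % 3 = 1 ∧ x ^ 2 % 3 = 1 ∨ x % 3 = 2 ∧ x ^ 2 % 3 = 1 := by
  rcases (by omega : x % 3 = 0 ∨ x % 3 = 1 ∨ x % 3 = 2) with h | h | h
  · obtain ⟨k, rfl⟩ : ∃ k, x = 3 * k := ⟨x / 3, by omega⟩
    have : (3 * k) ^ 2 = 9 * (k ^ 2) := by ring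
    omega
  · obtain ⟨k, rfl⟩ : ∃ k, x = 3 * k + 1 := ⟨x / 3, by omega⟩
    have : (3 * k + 1) ^ 2 = 3 * (3 * k ^ 2 + 2 * k) + 1 := by ring
    omega
  · obtain ⟨k, rfl⟩ : ∃ k, x = 3 * k + 2 := ⟨x / 3, by omega⟩
    have : (3 * k + 2) ^ 2 = 3 * (3 * k ^ 2 + 4 * k + 1) + 1 := by ring
    omega

theorem sq_mod_five (x : ℤ) :
    x % 5 = 0 ∧ x ^ 2 % 25 = 0 ∨ (x % 5 = 1 ∨ x % 5 = 4) ∧ x ^ 2 % 5 = 1 ∨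
      (x % 5 = 2 ∨ x % 5 = 3) ∧ x ^ 2 % 5 = 4 := by
  obtain ⟨k, hk⟩ : ∃ k, x = 5 * k + x % 5 := ⟨x / 5, by omega⟩
  have h : x ^ 2 = 5 * (5 * k ^ 2 + 2 * k * (x % 5)) + (x % 5) ^ 2 := by nth_rewrite 1 [hk]; ring
  rcases (by omega : x % 5 = 0 ∨ x % 5 = 1 ∨ x % 5 = 2 ∨ x % 5 = 3 ∨ x % 5 = 4)
    with h' | h' | h' | h' | h' <;> rw [h'] at h hk
  · have : x ^ 2 = 25 * k ^ 2 := by rw [hk]; ring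
    omega
  all_goals omega

namespace IsSumThreeSq

variable {n : ℤ}

theorem four_mul (h : IsSumThreeSq n) : IsSumThreeSq (4 * n) := by
  obtain ⟨x, y, z, rfl⟩ := h
  exact ⟨2 * x, 2 * y, 2 * z, by ring⟩

theorem of_mod (hn : 0 ≤ n)
    (h : n % 4 = 1 ∨ n % 4 = 2 ∨ n % 8 = 3 ∨ n % 16 = 4 ∨ n % 16 = 8 ∨ n % 32 = 12) :
    IsSumThreeSq n := by
  rcases hn.eq_or_lt with rfl | hn
  · exact ⟨0, 0, 0, by norm_num⟩
  by_cases h4 : n % 4 = 0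
  · obtain ⟨m, rfl⟩ : ∃ m, n = 4 * m := ⟨n / 4, by omega⟩
    exact four_mul (three_squares (by omega) (by omega))
  · exact three_squares hn (by omega)

/-- Two of the three squares can be taken to be of roots of equal parity. -/
theorem exists_parity (h : IsSumThreeSq n) :
    ∃ p q r : ℤ, n = p ^ 2 + q ^ 2 + r ^ 2 ∧ (p - q) % 2 = 0 ∧ (n - r) % 2 = 0 := by
  obtain ⟨x, y, z, e⟩ := h
  have hx := sq_mod_two_power x
  have hy := sq_mod_two_power y
  have hz := sq_mod_two_power z
  rcases (by omega : (x - y) % 2 = 0 ∨ (x - z) % 2 = 0 ∨ (y - z) % 2 = 0) with h | h | h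
  · exact ⟨x, y, z, e, h, by omega⟩
  · exact ⟨x, z, y, by linarith, h, by omega⟩
  · exact ⟨y, z, x, by linarith, h, by omega⟩

theorem two_two_one (h : IsSumThreeSq n) : ∃ x y z : ℤ, n = 2 * x ^ 2 + 2 * y ^ 2 + z ^ 2 := by
  obtain ⟨p, q, r, e, hpq, -⟩ := h.exists_parity
  obtain ⟨k, rfl⟩ : ∃ k, p = q + 2 * k := ⟨(p - q) / 2, by omega⟩
  exact ⟨q + k, k, r, by rw [e]; ring⟩

theorem exists_mixed_parity (h : IsSumThreeSq n) (hn : n % 4 = 1 ∨ n % 4 = 2) :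
    ∃ x p q : ℤ, n = x ^ 2 + p ^ 2 + q ^ 2 ∧ (p - q) % 2 = 1 := by
  obtain ⟨x, y, z, e⟩ := h
  have hx := sq_mod_two_power x
  have hy := sq_mod_two_power y
  have hz := sq_mod_two_power z
  rcases (by omega : (x - y) % 2 = 1 ∨ (x - z) % 2 = 1 ∨ (y - z) % 2 = 1) with h | h | h
  · exact ⟨z, x, y, by linarith, h⟩
  · exact ⟨y, x, z, by linarith, h⟩
  · exact ⟨x, y, z, by linarith, h⟩

theorem exists_zero_sum_mod_three (h : IsSumThreeSq n) (h3 : n % 3 ≠ 1) :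
    ∃ p q r : ℤ, n = p ^ 2 + q ^ 2 + r ^ 2 ∧ (p - q) % 2 = 0 ∧ (n - r) % 2 = 0 ∧
      (p + q + r) % 3 = 0 := by
  obtain ⟨p, q, r, e, hpq, hr⟩ := h.exists_parity
  have hx := sq_mod_three_power p
  have hy := sq_mod_three_power q
  have hz := sq_mod_three_power r
  rcases (by omega : (p + q + r) % 3 = 0 ∨ (-p + q + r) % 3 = 0 ∨ (p + -q + r) % 3 = 0 ∨
    (p + q + -r) % 3 = 0) with h | h | h | h
  · exact ⟨p, q, r, e, hpq, hr, h⟩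
  · exact ⟨-p, q, r, by rw [e]; ring, by omega, hr, h⟩
  · exact ⟨p, -q, r, by rw [e]; ring, by omega, hr, h⟩
  · exact ⟨p, q, -r, by rw [e]; ring, hpq, by omega, h⟩

theorem six_three_two (h : IsSumThreeSq n) (h3 : n % 3 ≠ 1) :
    ∃ x y z : ℤ, n = 6 * x ^ 2 + 3 * y ^ 2 + 2 * z ^ 2 := by
  obtain ⟨p, q, r, e, hpq, -, hs⟩ := h.exists_zero_sum_mod_three h3
  obtain ⟨z, rfl⟩ : ∃ z, p = q + 2 * z := ⟨(p - q) / 2, by omega⟩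
  obtain ⟨y, hy⟩ : ∃ y, q + 2 * z + q + r = 3 * y := ⟨(q + 2 * z + q + r) / 3, by omega⟩
  obtain rfl : r = 3 * y - 2 * q - 2 * z := by linarith
  exact ⟨y - q - z, y, z, by rw [e]; ring⟩

theorem two_one_eight (h : IsSumThreeSq n)
    (hn : n % 4 = 2 ∨ n % 4 = 0 ∨ n % 8 = 1 ∨ n % 8 = 3) :
    ∃ x y z : ℤ, n = 2 * x ^ 2 + y ^ 2 + 8 * z ^ 2 := by
  have key : ∀ p q r : ℤ, n = p ^ 2 + q ^ 2 + r ^ 2 → (p - q) % 4 = 0 →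
      ∃ x y z : ℤ, n = 2 * x ^ 2 + y ^ 2 + 8 * z ^ 2 := by
    intro p q r e h
    obtain ⟨k, rfl⟩ : ∃ k, p = q + 4 * k := ⟨(p - q) / 4, by omega⟩
    exact ⟨q + 2 * k, r, k, by rw [e]; ring⟩
  have key2 : ∀ p q r : ℤ, n = p ^ 2 + q ^ 2 + r ^ 2 → (p - q) % 4 = 0 ∨ (p + q) % 4 = 0 →
      ∃ x y z : ℤ, n = 2 * x ^ 2 + y ^ 2 + 8 * z ^ 2 := by
    intro p q r e h
    rcases h with h | h
    · exact key p q r e h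
    · exact key p (-q) r (by rw [e]; ring) (by omega)
  obtain ⟨x, y, z, e, hxy, hz'⟩ := h.exists_parity
  by_cases h4 : n % 4 = 0
  · have hx2 : x % 2 = 0 := by
      have hx := sq_mod_two_power x
      have hz := sq_mod_two_power z
      rcases hx with hx | hx | hx
      · have hy := sq_mod_two_power y
        rcases hz with hz | hz | hz <;> omega
      · omega
      · omega
    have hz2 : z % 2 = 0 := by omega
    rcases (by omega : (x - y) % 4 = 0 ∨ (x - z) % 4 = 0 ∨ (y - z) % 4 = 0) with h | h | h
    · exact key x y z e h
    · exact key x z y (by rw [e]; ring) h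
    · exact key y z x (by rw [e]; ring) h
  · refine key2 x y z e ?_
    have hx := sq_mod_two_power x
    have hy := sq_mod_two_power y
    have hz := sq_mod_two_power z
    rcases hx with hx | hx | hx
    · omega
    · rcases hy with hy | hy | hy
      · omega
      · omega
      · rcases hz with hz | hz | hz <;> omega
    · rcases hy with hy | hy | hy
      · omega
      · rcases hz with hz | hz | hz <;> omega
      · omega

theorem two_one_two_odd (h : IsSumThreeSq n)
    (hn : n % 4 = 2 ∨ n % 16 = 4 ∨ n % 16 = 8 ∨ n % 8 = 3 ∨ n % 8 = 5) :
    ∃ x y z : ℤ, n = 2 * x ^ 2 + y ^ 2 + 2 * z ^ 2 ∧ z % 2 = 1 := by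
  have key : ∀ p q r : ℤ, n = p ^ 2 + q ^ 2 + r ^ 2 → (p - q) % 4 = 2 →
      ∃ x y z : ℤ, n = 2 * x ^ 2 + y ^ 2 + 2 * z ^ 2 ∧ z % 2 = 1 := by
    intro p q r e h
    obtain ⟨k, rfl⟩ : ∃ k, p = q + 2 * k := ⟨(p - q) / 2, by omega⟩
    exact ⟨q + k, r, k, by rw [e]; ring, by omega⟩
  have key2 : ∀ p q r : ℤ, n = p ^ 2 + q ^ 2 + r ^ 2 → (p - q) % 4 = 2 ∨ (p + q) % 4 = 2 →
      ∃ x y z : ℤ, n = 2 * x ^ 2 + y ^ 2 + 2 * z ^ 2 ∧ z % 2 = 1 := by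
    intro p q r e h
    rcases h with h | h
    · exact key p q r e h
    · exact key p (-q) r (by rw [e]; ring) (by omega)
  obtain ⟨x, y, z, e, hxy, hz'⟩ := h.exists_parity
  by_cases h4 : n % 4 = 0
  · have hx2 : x % 2 = 0 := by
      have hx := sq_mod_two_power x
      have hz := sq_mod_two_power z
      rcases hx with hx | hx | hx
      · have hy := sq_mod_two_power y
        rcases hz with hz | hz | hz <;> omega
      · omega
      · omega
    obtain ⟨u, rfl⟩ : ∃ u, x = 2 * u := ⟨x / 2, by omega⟩
    obtain ⟨v, rfl⟩ : ∃ u, y = 2 * u := ⟨y / 2, by omega⟩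
    obtain ⟨w, rfl⟩ : ∃ u, z = 2 * u := ⟨z / 2, by omega⟩
    have e' : n = 4 * (u ^ 2 + v ^ 2 + w ^ 2) := by rw [e]; ring
    obtain ⟨x, p, q, e, hpq⟩ := exists_mixed_parity ⟨u, v, w, rfl⟩ (by omega)
    exact key (2 * p) (2 * q) (2 * x) (by rw [e', e]; ring) (by omega)
  · refine key2 x y z e ?_
    have hx := sq_mod_two_power x
    have hy := sq_mod_two_power y
    have hz := sq_mod_two_power z
    rcases hx with hx | hx | hx
    · omega
    · rcases hy with hy | hy | hy
      · omega
      · rcases hz with hz | hz | hz <;> omega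
      · omega
    · rcases hy with hy | hy | hy
      · omega
      · omega
      · rcases hz with hz | hz | hz <;> omega

/-- Reflecting in the diagonal removes common factors of `3` from a sum of three squares. -/
theorem exists_not_three_dvd (h : IsSumThreeSq n) (hn : n ≠ 0) :
    ∃ x y z : ℤ, n = x ^ 2 + y ^ 2 + z ^ 2 ∧ ¬ (x % 3 = 0 ∧ y % 3 = 0 ∧ z % 3 = 0) := by
  obtain ⟨k, hk⟩ : ∃ k : ℕ, n.natAbs ≤ k := ⟨_, le_rfl⟩
  induction k generalizing n with
  | zero => omega
  | succ k ih =>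
    obtain ⟨x, y, z, e⟩ := h
    by_cases h3 : x % 3 = 0 ∧ y % 3 = 0 ∧ z % 3 = 0
    · obtain ⟨x, rfl⟩ : ∃ k, x = 3 * k := ⟨x / 3, by omega⟩
      obtain ⟨y, rfl⟩ : ∃ k, y = 3 * k := ⟨y / 3, by omega⟩
      obtain ⟨z, rfl⟩ : ∃ k, z = 3 * k := ⟨z / 3, by omega⟩
      have e' : n = 9 * (x ^ 2 + y ^ 2 + z ^ 2) := by rw [e]; ring
      obtain ⟨x, y, z, e1, h3⟩ := ih (n := x ^ 2 + y ^ 2 + z ^ 2) ⟨x, y, z, rfl⟩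
        (by omega) (by omega)
      rw [e1] at e'
      clear e1 e
      obtain ⟨x, y, z, e, h3⟩ : ∃ x y z : ℤ, n = 9 * (x ^ 2 + y ^ 2 + z ^ 2) ∧
          (x + y + z) % 3 ≠ 0 := by
        rcases (by omega : (x + y + z) % 3 ≠ 0 ∨ (-x + y + z) % 3 ≠ 0 ∨ (x + -y + z) % 3 ≠ 0 ∨
          (x + y + -z) % 3 ≠ 0) with h | h | h | h
        · exact ⟨x, y, z, e', h⟩
        · exact ⟨-x, y, z, by rw [e']; ring, h⟩
        · exact ⟨x, -y, z, by rw [e']; ring, h⟩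
        · exact ⟨x, y, -z, by rw [e']; ring, h⟩
      exact ⟨x - 2 * y - 2 * z, y - 2 * x - 2 * z, z - 2 * x - 2 * y, by rw [e]; ring, by omega⟩
    · exact ⟨x, y, z, e, h3⟩

end IsSumThreeSq

theorem exists_one_one_three {n : ℤ} (hn : 0 < n) (h : n % 3 ≠ 0 ∨ n % 9 = 3) :
    ∃ x y z : ℤ, n = x ^ 2 + y ^ 2 + 3 * z ^ 2 := by
  obtain ⟨x, y, z, e⟩ := exists_eisenstein hn h
  rcases (by omega : z % 2 = 0 ∨ y % 2 = 0 ∨ (y + z) % 2 = 0) with h | h | h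
  · obtain ⟨k, rfl⟩ : ∃ k, z = 2 * k := ⟨z / 2, by omega⟩
    exact ⟨x, y + k, k, by rw [e]; ring⟩
  · obtain ⟨k, rfl⟩ : ∃ k, y = 2 * k := ⟨y / 2, by omega⟩
    exact ⟨x, z + k, k, by rw [e]; ring⟩
  · obtain ⟨k, rfl⟩ : ∃ k, y = 2 * k - z := ⟨(y + z) / 2, by omega⟩
    exact ⟨x, z - k, k, by rw [e]; ring⟩

theorem exists_one_two_five {n : ℤ} (hn : 0 < n) (h : n % 5 ≠ 0 ∨ n % 25 = 5 ∨ n % 25 = 20) :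
    ∃ x y z : ℤ, n = x ^ 2 + 2 * y ^ 2 + 5 * z ^ 2 := by
  obtain ⟨k, hk⟩ : ∃ k : ℕ, n.toNat ≤ k := ⟨_, le_rfl⟩
  induction k generalizing n with
  | zero => omega
  | succ k ih =>
    rcases (by omega : n % 4 = 0 ∨ n % 4 = 2 ∨ n % 2 = 1) with h2 | h2 | h2
    · obtain ⟨m, rfl⟩ : ∃ m, n = 4 * m := ⟨n / 4, by omega⟩
      obtain ⟨x, y, z, e⟩ := ih (n := m) (by omega) (by omega) (by omega)
      exact ⟨2 * x, 2 * y, 2 * z, by rw [e]; ring⟩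
    · obtain ⟨m, rfl⟩ : ∃ m, n = 2 * m := ⟨n / 2, by omega⟩
      obtain ⟨x, y, z, e⟩ := exists_five (n := m) (by omega) (by omega)
      have key : ∀ X Y Z : ℤ, 2 * m = X ^ 2 + Y ^ 2 + Z ^ 2 + 3 * (X + Y + Z) ^ 2 →
          (Y - Z) % 2 = 0 → ∃ x y z : ℤ, 2 * m = x ^ 2 + 2 * y ^ 2 + 5 * z ^ 2 := by
        intro X Y Z e h
        obtain ⟨q, rfl⟩ : ∃ q, Y = Z + 2 * q := ⟨(Y - Z) / 2, by omega⟩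
        exact ⟨2 * X + 3 * (Z + q), q, Z + q, by rw [e]; ring⟩
      rcases (by omega : (y - (x + z)) % 2 = 0 ∨ (x + y - y) % 2 = 0 ∨ (x + y - (x + z)) % 2 = 0)
        with h | h | h
      · exact key (x + y) (-y) (-x - z) (by rw [e]; ring) (by omega)
      · exact key (-x - z) (x + y) (-y) (by rw [e]; ring) (by omega)
      · exact key (-y) (x + y) (-x - z) (by rw [e]; ring) (by omega)
    · obtain ⟨x, y, z, e⟩ := exists_five (n := 2 * n) (by omega) (by omega)
      have key : ∀ X Y Z : ℤ, 4 * n = X ^ 2 + Y ^ 2 + Z ^ 2 + 3 * (X + Y + Z) ^ 2 →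
          Y % 2 = 0 → Z % 2 = 0 → (Y - Z) % 4 = 0 →
          ∃ x y z : ℤ, n = x ^ 2 + 2 * y ^ 2 + 5 * z ^ 2 := by
        intro X Y Z e hY hZ h
        obtain ⟨q, rfl⟩ : ∃ q, Y = Z + 4 * q := ⟨(Y - Z) / 4, by omega⟩
        obtain ⟨t, rfl⟩ : ∃ q, Z = 2 * q := ⟨Z / 2, by omega⟩
        exact ⟨X + 3 * (t + q), q, t + q, by linarith⟩
      have e4 : ∃ X Y Z S : ℤ, S = X + Y + Z ∧ 4 * n = X ^ 2 + Y ^ 2 + Z ^ 2 + 3 * S ^ 2 :=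
        ⟨x + y, -y, -x - z, _, rfl, by linear_combination 2 * e⟩
      clear e
      obtain ⟨X, Y, Z, S, hS, e⟩ := e4
      have hX := sq_mod_two_power X
      have hY := sq_mod_two_power Y
      have hZ := sq_mod_two_power Z
      have hS' := sq_mod_two_power S
      rcases (by omega : Y % 2 = 0 ∧ Z % 2 = 0 ∧ (Y - Z) % 4 = 0 ∨
        X % 2 = 0 ∧ Z % 2 = 0 ∧ (X - Z) % 4 = 0 ∨ X % 2 = 0 ∧ Y % 2 = 0 ∧ (X - Y) % 4 = 0)
        with ⟨h, h', h''⟩ | ⟨h, h', h''⟩ | ⟨h, h', h''⟩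
      · exact key X Y Z (by rw [e, hS]) h h' h''
      · exact key Y X Z (by rw [e, hS]; ring) h h' h''
      · exact key Z X Y (by rw [e, hS]; ring) h h' h''

/-- The properties of the value set of a classical form that are used throughout: the values are
nonnegative, closed under multiplication by squares, and contain the nine critical numbers. -/
structure CriticalValues (R : ℤ → Prop) : Prop where
  nonneg : ∀ n, R n → 0 ≤ n
  sq_mul : ∀ k n, R n → R (k ^ 2 * n)
  critical : ∀ n, n = 1 ∨ n = 2 ∨ n = 3 ∨ n = 5 ∨ n = 6 ∨ n = 7 ∨ n = 10 ∨ n = 14 ∨ n = 15 → R n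

theorem CriticalValues.of_squarefree {R : ℤ → Prop} (hR : CriticalValues R)
    (h : ∀ n, 0 < n → n % 4 ≠ 0 → n % 9 ≠ 0 → n % 25 ≠ 0 → n % 49 ≠ 0 → R n) :
    ∀ n, 0 < n → R n := by
  intro n hn
  obtain ⟨k, hk⟩ : ∃ k : ℕ, n.toNat ≤ k := ⟨_, le_rfl⟩
  induction k generalizing n with
  | zero => omega
  | succ k ih =>
    have key : ∀ p : ℤ, 1 < p ^ 2 → n % p ^ 2 = 0 → R n := by
      intro p hp hd
      obtain ⟨m, rfl⟩ := Int.dvd_of_emod_eq_zero hd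
      have hm : 0 < m := pos_of_mul_pos_right hn (by positivity)
      have : m < p ^ 2 * m := by nlinarith
      exact hR.sq_mul p m (ih m hm (by omega))
    by_cases h4 : n % 4 = 0
    · exact key 2 (by norm_num) (by simpa using h4)
    by_cases h9 : n % 9 = 0
    · exact key 3 (by norm_num) (by simpa using h9)
    by_cases h25 : n % 25 = 0
    · exact key 5 (by norm_num) (by simpa using h25)
    by_cases h49 : n % 49 = 0
    · exact key 7 (by norm_num) (by simpa using h49)
    exact h n hn h4 h9 h25 h49

theorem exists_sq_add_self (y : ℤ) : ∃ j, y ^ 2 + y = 2 * j := by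
  obtain ⟨j, hj⟩ := Int.even_mul_succ_self y
  exact ⟨j, by linarith⟩

theorem self_le_sq_int (y : ℤ) : y ≤ y ^ 2 ∧ -y ≤ y ^ 2 :=
  ⟨Int.le_self_sq y, by simpa using Int.le_self_sq (-y)⟩

theorem not_isSumThreeSq_of_mod_eight {n : ℤ} (h : n % 8 = 7) : ¬ IsSumThreeSq n := by
  rintro ⟨x, y, z, e⟩
  have hx := sq_mod_two_power x
  have hy := sq_mod_two_power y
  have hz := sq_mod_two_power z
  rcases hx with hx | hx | hx <;> rcases hy with hy | hy | hy <;> omega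

section

variable {R : ℤ → Prop} (hR : CriticalValues R)

include hR

theorem universal_one_one_one {m : ℤ} (hm : 0 ≤ m)
    (hT : ∀ n x y z w, n = x ^ 2 + y ^ 2 + z ^ 2 + m * w ^ 2 → R n)
    (ht : ∃ x y z : ℤ, 7 = x ^ 2 + y ^ 2 + z ^ 2 + m) : ∀ n, 0 < n → R n := by
  refine hR.of_squarefree fun n hn h4 _ _ _ ↦ ?_
  have key : ∀ w N, N = n - m * w ^ 2 → 0 ≤ N → N % 4 = 1 ∨ N % 4 = 2 ∨ N % 8 = 3 → R n := by
    rintro w N rfl h0 h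
    obtain ⟨x, y, z, e⟩ := IsSumThreeSq.of_mod h0 (by omega)
    exact hT n x y z w (by linarith)
  by_cases h7 : n % 8 = 7
  · by_cases hs : n < 16
    · exact hR.critical n (by omega)
    obtain ⟨x, y, z, e⟩ := ht
    have hm7 : m ≤ 7 := by nlinarith [sq_nonneg x, sq_nonneg y, sq_nonneg z]
    interval_cases m
    · exact absurd ⟨x, y, z, by linarith⟩ (not_isSumThreeSq_of_mod_eight (n := 7) rfl)
    · exact key 1 _ rfl (by omega) (by omega)
    · exact key 1 _ rfl (by omega) (by omega)
    · exact key 2 _ rfl (by omega) (by omega)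
    · exact key 1 _ rfl (by omega) (by omega)
    · exact key 1 _ rfl (by omega) (by omega)
    · exact key 1 _ rfl (by omega) (by omega)
    · by_cases hs : n = 23
      · exact hT n 4 0 0 1 (by omega)
      · exact key 2 _ rfl (by omega) (by omega)
  · exact key 0 n (by ring) (by omega) (by omega)

theorem universal_one_one_two {c m : ℤ} (hc0 : 0 ≤ c) (hc1 : c ≤ 1) (hm : 0 ≤ m)
    (hT : ∀ n x y z w, n = x ^ 2 + y ^ 2 + 2 * z ^ 2 + 2 * c * z * w + m * w ^ 2 → R n)
    (ht : ∃ x y z : ℤ, 14 = x ^ 2 + y ^ 2 + 2 * z ^ 2 + 2 * c * z + m) : ∀ n, 0 < n → R n := by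
  refine hR.of_squarefree fun n hn h4 _ _ _ ↦ ?_
  have key : ∀ w N, N = 2 * n - (2 * m - c ^ 2) * w ^ 2 → 0 ≤ N → (N - c * w) % 2 = 0 →
      N % 4 = 1 ∨ N % 4 = 2 ∨ N % 8 = 3 ∨ N % 16 = 4 ∨ N % 16 = 8 ∨ N % 32 = 12 → R n := by
    intro w N hN h0 hp h
    obtain ⟨x, y, z, e⟩ := (IsSumThreeSq.of_mod h0 h).two_two_one
    have hz := sq_mod_two_power z
    obtain ⟨z, rfl⟩ : ∃ k, z = 2 * k + c * w := ⟨(z - c * w) / 2, by omega⟩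
    exact hT n x y z w (by linarith)
  by_cases h7 : n % 16 = 14
  · by_cases hs : n < 30
    · exact hR.critical n (by omega)
    obtain ⟨x, y, z, e⟩ := ht
    have hx := sq_mod_two_power x
    have hy := sq_mod_two_power y
    have hz := sq_mod_two_power z
    have hz' := self_le_sq_int z
    obtain ⟨j, hj⟩ := exists_sq_add_self z
    have hm7 : m ≤ 14 := by interval_cases c <;> nlinarith [sq_nonneg x, sq_nonneg y]
    by_cases h30 : m = 14 ∧ c = 0 ∧ n = 30
    · exact hT n 4 0 0 1 (by rw [h30.1, h30.2.1]; omega)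
    by_cases h46 : m = 14 ∧ c = 0 ∧ n = 46
    · exact hT n 4 4 0 1 (by rw [h46.1, h46.2.1]; omega)
    interval_cases c <;> interval_cases m <;> first
      | exact key 1 _ rfl (by omega) (by omega) (by omega)
      | exact key 2 _ rfl (by omega) (by omega) (by omega)
  · exact key 0 (2 * n) (by ring) (by omega) (by omega) (by omega)

end

section

variable {R : ℤ → Prop} (hR : CriticalValues R)

include hR

theorem universal_one_two_two {b c m : ℤ} (hb0 : 0 ≤ b) (hb1 : b ≤ 1) (hc0 : 0 ≤ c) (hc1 : c ≤ 1)
    (hm : 0 ≤ m)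
    (hT : ∀ n x y z w, n = x ^ 2 + 2 * y ^ 2 + 2 * z ^ 2 + 2 * b * y * w + 2 * c * z * w +
      m * w ^ 2 → R n)
    (ht : ∃ x y z : ℤ, 7 = x ^ 2 + 2 * y ^ 2 + 2 * z ^ 2 + 2 * b * y + 2 * c * z + m) :
    ∀ n, 0 < n → R n := by
  refine hR.of_squarefree fun n hn h4 _ _ _ ↦ ?_
  have even : ∀ v N, N = n - (4 * m - 2 * b ^ 2 - 2 * c ^ 2) * v ^ 2 → 0 ≤ N →
      N % 4 = 1 ∨ N % 4 = 2 ∨ N % 8 = 3 → R n := by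
    intro v N hN h0 h
    obtain ⟨y, z, x, e⟩ := (IsSumThreeSq.of_mod h0 (by omega)).two_two_one
    exact hT n x (y - b * v) (z - c * v) (2 * v) (by linarith)
  by_cases h7 : n % 8 = 7
  · by_cases hs : n < 16
    · exact hR.critical n (by omega)
    have plain : b = 0 → c = 0 → (n - m) % 4 = 1 ∨ (n - m) % 4 = 2 ∨ (n - m) % 8 = 3 →
        0 ≤ n - m → R n := by
      rintro rfl rfl h h0
      obtain ⟨y, z, x, e⟩ := (IsSumThreeSq.of_mod h0 (by omega)).two_two_one
      exact hT n x y z 1 (by linarith)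
    have single : b + c = 1 → 0 ≤ n - m → R n := by
      intro hbc h0
      obtain ⟨X, Y, Z, e, hZ⟩ := (IsSumThreeSq.of_mod (n := 4 * n - 4 * m + 2) (by omega)
        (by omega)).two_one_two_odd (by omega)
      have hX := sq_mod_two_power X
      have hY := sq_mod_two_power Y
      have hZ' := sq_mod_two_power Z
      obtain ⟨x, rfl⟩ : ∃ x, Y = 2 * x := ⟨Y / 2, by omega⟩
      obtain ⟨y, rfl⟩ : ∃ y, X = 2 * y := ⟨X / 2, by omega⟩
      obtain ⟨z, rfl⟩ : ∃ z, Z = 2 * z + 1 := ⟨Z / 2, by omega⟩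
      obtain ⟨rfl, rfl⟩ | ⟨rfl, rfl⟩ : b = 0 ∧ c = 1 ∨ b = 1 ∧ c = 0 := by omega
      · exact hT n x y z 1 (by linarith)
      · exact hT n x z y 1 (by linarith)
    have double : b = 1 → c = 1 → (n - m) % 4 = 0 ∨ (n - m) % 4 = 1 → 0 ≤ n - m → R n := by
      rintro rfl rfl h h0
      obtain ⟨x, p, q, e, hpq⟩ := (IsSumThreeSq.of_mod (n := n - m + 1) (by omega)
        (by omega)).exists_mixed_parity (by omega)
      obtain ⟨y, rfl⟩ : ∃ y, p = 2 * y + 1 + q := ⟨(p - q) / 2, by omega⟩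
      exact hT n x y (-(y + q + 1)) 1 (by linarith)
    obtain ⟨x, y, z, e⟩ := ht
    have hm7 : m ≤ 7 := by
      have hy := self_le_sq_int y
      have hz := self_le_sq_int z
      interval_cases b <;> interval_cases c <;> nlinarith [sq_nonneg x]
    obtain ⟨rfl, rfl⟩ | hbc | ⟨rfl, rfl⟩ : b = 0 ∧ c = 0 ∨ b + c = 1 ∨ b = 1 ∧ c = 1 := by omega
    · by_cases h0 : m = 0
      · exact absurd ⟨x, y + z, y - z, by linarith⟩ (not_isSumThreeSq_of_mod_eight (n := 7) rfl)
      by_cases h23 : m = 7 ∧ n = 23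
      · exact hT n 4 0 0 1 (by linarith)
      by_cases h37 : m = 3 ∨ m = 7
      · exact even 1 _ rfl (by omega) (by omega)
      · exact plain rfl rfl (by omega) (by omega)
    · exact single hbc (by omega)
    · have hx := sq_mod_two_power x
      obtain ⟨i, hi⟩ := exists_sq_add_self y
      obtain ⟨j, hj⟩ := exists_sq_add_self z
      have h1 : m % 4 ≠ 1 := by omega
      by_cases h0 : m = 0
      · exact absurd (hR.nonneg _ (hT _ 0 (-1) (-1) 2 rfl)) (by rw [h0]; norm_num)
      by_cases h4 : m = 4
      · exact even 1 _ rfl (by omega) (by omega)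
      · exact double rfl rfl (by omega) (by omega)
  · exact even 0 n (by ring) (by omega) (by omega)
end

section

variable {R : ℤ → Prop} (hR : CriticalValues R)

include hR

set_option maxHeartbeats 1000000 in
theorem universal_one_two_three {b c m : ℤ} (hb0 : 0 ≤ b) (hb1 : b ≤ 1) (hc0 : 0 ≤ c) (hc1 : c ≤ 1)
    (hm : 0 ≤ m)
    (hT : ∀ n x y z w, n = x ^ 2 + 2 * y ^ 2 + 3 * z ^ 2 + 2 * b * y * w + 2 * c * z * w +
      m * w ^ 2 → R n)
    (ht : ∃ x y z : ℤ, 10 = x ^ 2 + 2 * y ^ 2 + 3 * z ^ 2 + 2 * b * y + 2 * c * z + m) :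
    ∀ n, 0 < n → R n := by
  refine hR.of_squarefree fun n hn h4 _ _ _ ↦ ?_
  have key : ∀ w N, N = 6 * n - (6 * m - 3 * b ^ 2 - 2 * c ^ 2) * w ^ 2 → 0 ≤ N →
      N % 4 = 1 ∨ N % 4 = 2 ∨ N % 8 = 3 ∨ N % 16 = 4 ∨ N % 16 = 8 ∨ N % 32 = 12 → R n := by
    intro w N hN h0 h
    obtain ⟨A, hA⟩ : ∃ A, N = 3 * A + 2 * (c * w) ^ 2 :=
      ⟨2 * n - 2 * m * w ^ 2 + b ^ 2 * w ^ 2, by rw [hN]; ring⟩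
    obtain ⟨B, hB⟩ : ∃ B, N = 2 * B + 3 * (b * w) ^ 2 :=
      ⟨3 * n - 3 * m * w ^ 2 + c ^ 2 * w ^ 2, by rw [hN]; ring⟩
    have hc3 := sq_mod_three_power (c * w)
    have hb2 := sq_mod_two_power (b * w)
    obtain ⟨x, Y, Z, e⟩ := (IsSumThreeSq.of_mod h0 h).six_three_two (by omega)
    have hY := sq_mod_two_power Y
    have hZ := sq_mod_three_power Z
    obtain ⟨y, rfl⟩ : ∃ y, Y = 2 * y + b * w := ⟨(Y - b * w) / 2, by omega⟩
    obtain ⟨z, hz | hz⟩ : ∃ z, Z = 3 * z + c * w ∨ -Z = 3 * z + c * w := by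
      by_cases hs : (Z - c * w) % 3 = 0
      · exact ⟨(Z - c * w) / 3, by omega⟩
      · exact ⟨(-Z - c * w) / 3, by omega⟩
    · exact hT n x y z w (by rw [hz] at e; linarith)
    · exact hT n x y z w (by rw [← neg_sq Z, hz] at e; linarith)
  by_cases h7 : n % 16 = 10
  · by_cases hs : n < 26
    · exact hR.critical n (by omega)
    obtain ⟨x, y, z, e⟩ := ht
    have hx := sq_mod_two_power x
    have hy := self_le_sq_int y
    have hz := self_le_sq_int z
    have hz2 := sq_mod_two_power z
    have hm7 : m ≤ 10 := by
      interval_cases b <;> interval_cases c <;> nlinarith [sq_nonneg x]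
    by_cases h26 : b = 0 ∧ c = 0 ∧ m = 10 ∧ n = 26
    · obtain ⟨rfl, rfl, rfl, rfl⟩ := h26
      exact hT _ 4 0 0 1 (by norm_num)
    by_cases h0 : b = 0 ∧ c = 0 ∧ m = 0
    · obtain ⟨rfl, rfl, rfl⟩ := h0
      have hy2 := sq_mod_two_power y
      rcases hx with hx | hx | hx <;> rcases hz2 with hz | hz | hz <;> omega
    by_cases h8 : b = 1 ∧ c = 0 ∧ m = 8
    · obtain ⟨rfl, rfl, rfl⟩ := h8
      obtain ⟨i, hi⟩ := exists_sq_add_self y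
      omega
    have hw1 := key 1 _ rfl
    have hw2 := key 2 _ rfl
    clear hx hy hz hz2 e key
    interval_cases b <;> interval_cases c <;> interval_cases m <;> first
      | exact hw1 (by omega) (by omega)
      | exact hw2 (by omega) (by omega)
  · exact key 0 (6 * n) (by ring) (by omega) (by omega)
end

section

variable {R : ℤ → Prop} (hR : CriticalValues R)

include hR

set_option maxHeartbeats 1000000 in
theorem universal_one_two_four {b c m : ℤ} (hb0 : 0 ≤ b) (hb1 : b ≤ 1) (hc0 : 0 ≤ c) (hc2 : c ≤ 2)
    (hm : 0 ≤ m)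
    (hT : ∀ n x y z w, n = x ^ 2 + 2 * y ^ 2 + 4 * z ^ 2 + 2 * b * y * w + 2 * c * z * w +
      m * w ^ 2 → R n)
    (ht : ∃ x y z : ℤ, 14 = x ^ 2 + 2 * y ^ 2 + 4 * z ^ 2 + 2 * b * y + 2 * c * z + m) :
    ∀ n, 0 < n → R n := by
  refine hR.of_squarefree fun n hn h4 _ _ _ ↦ ?_
  have key_even : ∀ w s N, c * w = 4 * s → N = 2 * n - (2 * m - b ^ 2) * w ^ 2 + 8 * s ^ 2 →
      0 ≤ N → N % 4 = 2 ∨ N % 8 = 1 ∨ N % 8 = 3 ∨ N % 16 = 4 ∨ N % 16 = 8 ∨ N % 32 = 12 →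
      R n := by
    intro w s N hs hN h0 h
    obtain ⟨x, Y, z, e⟩ := (IsSumThreeSq.of_mod h0 (by omega)).two_one_eight (by omega)
    obtain ⟨B, hB⟩ : ∃ B, N = 2 * B + (b * w) ^ 2 := ⟨n - m * w ^ 2 + 4 * s ^ 2, by rw [hN]; ring⟩
    have hb2 := sq_mod_two_power (b * w)
    have hY := sq_mod_two_power Y
    obtain ⟨y, rfl⟩ : ∃ y, Y = 2 * y + b * w := ⟨(Y - b * w) / 2, by omega⟩
    exact hT n x y (z - s) w (by linarith [congrArg (fun t ↦ (z - s) * t) hs])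
  by_cases h7 : n % 16 = 14
  · by_cases hs : n < 30
    · exact hR.critical n (by omega)
    have key_odd : ∀ N, c = 2 → N = 2 * n - (2 * m - b ^ 2) + 2 → 0 ≤ N →
        N % 4 = 2 ∨ N % 8 = 3 ∨ N % 8 = 5 ∨ N % 16 = 4 ∨ N % 16 = 8 → R n := by
      rintro N rfl hN h0 h
      obtain ⟨x, Y, Z, e, hZ⟩ := (IsSumThreeSq.of_mod h0 (by omega)).two_one_two_odd (by omega)
      have hb2 := sq_mod_two_power b
      have hY := sq_mod_two_power Y
      obtain ⟨y, rfl⟩ : ∃ y, Y = 2 * y + b := ⟨(Y - b) / 2, by omega⟩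
      obtain ⟨z, rfl⟩ : ∃ z, Z = 2 * z + 1 := ⟨Z / 2, by omega⟩
      exact hT n x y z 1 (by linarith)
    have key_one : c = 1 → 0 ≤ 8 * n - 8 * m → R n := by
      rintro rfl h0
      obtain ⟨X, Y, Z, e, hZ⟩ := (IsSumThreeSq.of_mod (n := 8 * n - 8 * m + 4 * b ^ 2 + 2)
        (by positivity) (by omega)).two_one_two_odd (by omega)
      have hb2 := sq_mod_two_power b
      have hX := sq_mod_two_power X
      have hY := sq_mod_two_power Y
      have hZ' := sq_mod_two_power Z
      obtain ⟨x, rfl⟩ : ∃ x, X = 2 * x := ⟨X / 2, by omega⟩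
      obtain ⟨Y, rfl⟩ : ∃ y, Y = 2 * y := ⟨Y / 2, by omega⟩
      have hY' := sq_mod_two_power Y
      obtain ⟨y, rfl⟩ : ∃ y, Y = 2 * y + b := by
        refine ⟨(Y - b) / 2, ?_⟩
        rw [mul_pow, mul_pow] at e
        clear hX hY
        omega
      obtain ⟨z, hz | hz⟩ : ∃ z, Z = 4 * z + 1 ∨ -Z = 4 * z + 1 := by
        by_cases hs : Z % 4 = 1
        · exact ⟨Z / 4, by omega⟩
        · exact ⟨-Z / 4, by omega⟩
      · exact hT n x y z 1 (by rw [hz] at e; linarith)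
      · exact hT n x y z 1 (by rw [← neg_sq Z, hz] at e; linarith)
    obtain ⟨x, y, z, e⟩ := ht
    have hx := sq_mod_two_power x
    have hm7 : m ≤ 14 := by
      have hy := self_le_sq_int y
      have hz := self_le_sq_int z
      interval_cases b <;> interval_cases c <;> nlinarith [sq_nonneg x]
    obtain rfl | rfl : b = 0 ∨ b = 1 := by omega
    · obtain rfl | hc | rfl : c = 0 ∨ c = 1 ∨ c = 2 := by omega
      · by_cases h0 : m = 0
        · rw [h0] at e
          have hy2 := sq_mod_two_power y
          have hz2 := sq_mod_two_power z
          rcases hx with hx | hx | hx <;> rcases hy2 with hy | hy | hy <;> omega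
        by_cases h14 : m = 14 ∧ n < 56
        · obtain hn | hn : n = 30 ∨ n = 46 := by omega
          · exact hT n 4 0 0 1 (by linarith)
          · exact hT n 0 4 0 1 (by linarith)
        clear hx e
        by_cases h6 : m % 8 = 6
        · exact key_even 2 0 _ (by ring) rfl (by omega) (by omega)
        · exact key_even 1 0 _ (by ring) rfl (by omega) (by omega)
      · exact key_one hc (by omega)
      · have h1 : m % 8 ≠ 1 := by
          obtain ⟨i, hi⟩ := exists_sq_add_self z
          have hy := sq_mod_two_power y
          omega
        clear hx e
        by_cases h7 : m % 8 = 7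
        · exact key_even 2 1 _ (by ring) rfl (by omega) (by omega)
        · exact key_odd _ rfl rfl (by omega) (by omega)
    · by_cases hc : c = 1
      · exact key_one hc (by omega)
      obtain ⟨i, hi⟩ := exists_sq_add_self y
      have h1 : m % 4 = 1 ∨ m % 4 = 2 := by
        obtain rfl | rfl : c = 0 ∨ c = 2 := by omega
        · omega
        · omega
      clear hx e
      obtain rfl | rfl : c = 0 ∨ c = 2 := by omega
      · exact key_even 1 0 _ (by ring) rfl (by omega) (by omega)
      · exact key_odd _ rfl rfl (by omega) (by omega)
  · exact key_even 0 0 (2 * n) (by ring) (by ring) (by omega) (by omega)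
end

theorem IsSumThreeSq.one_two_three {n : ℤ} (h : IsSumThreeSq (6 * n)) :
    ∃ x y z : ℤ, n = x ^ 2 + 2 * y ^ 2 + 3 * z ^ 2 := by
  obtain ⟨x, Y, Z, e⟩ := h.six_three_two (by omega)
  have hY := sq_mod_two_power Y
  have hZ := sq_mod_three_power Z
  obtain ⟨y, rfl⟩ : ∃ y, Y = 2 * y := ⟨Y / 2, by omega⟩
  obtain ⟨z, rfl⟩ : ∃ z, Z = 3 * z := ⟨Z / 3, by omega⟩
  exact ⟨x, y, z, by linarith⟩

theorem exists_one_two_three_three {k : ℤ} (hk : 3 ≤ k) (h4 : k % 4 ≠ 0) :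
    ∃ z w x y : ℤ, k = z ^ 2 + 2 * w ^ 2 + 3 * x ^ 2 + 3 * y ^ 2 := by
  by_cases h : k % 16 = 10
  · obtain ⟨z, w, x, e⟩ :=
      (IsSumThreeSq.of_mod (n := 6 * (k - 3)) (by omega) (by omega)).one_two_three
    exact ⟨z, w, x, 1, by linarith⟩
  · obtain ⟨z, w, x, e⟩ :=
      (IsSumThreeSq.of_mod (n := 6 * k) (by omega) (by omega)).one_two_three
    exact ⟨z, w, x, 0, by linarith⟩

section

variable {R : ℤ → Prop} (hR : CriticalValues R)

include hR

theorem universal_one_one_three {c m : ℤ} (hc0 : 0 ≤ c) (hc1 : c ≤ 1) (hm : 0 ≤ m)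
    (hT : ∀ n x y z w, n = x ^ 2 + y ^ 2 + 3 * z ^ 2 + 2 * c * z * w + m * w ^ 2 → R n)
    (ht : ∃ x y z : ℤ, 6 = x ^ 2 + y ^ 2 + 3 * z ^ 2 + 2 * c * z + m) : ∀ n, 0 < n → R n := by
  refine hR.of_squarefree fun n hn h4 h9 _ _ ↦ ?_
  by_cases h6 : n % 9 = 6
  · by_cases hs : n < 24
    · exact hR.critical n (by omega)
    obtain ⟨x, y, z, e⟩ := ht
    have hm6 : m ≤ 6 := by
      have hz := self_le_sq_int z
      interval_cases c <;> nlinarith [sq_nonneg x, sq_nonneg y]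
    obtain rfl | rfl : c = 0 ∨ c = 1 := by omega
    · obtain rfl | rfl | hm5 : m = 0 ∨ m = 6 ∨ 1 ≤ m ∧ m ≤ 5 := by omega
      · have hx := sq_mod_three_power x
        have hy := sq_mod_three_power y
        have hz := sq_mod_three_power z
        omega
      · obtain ⟨k, rfl⟩ : ∃ k, n = 3 * k := ⟨n / 3, by omega⟩
        obtain ⟨z, w, x, y, e⟩ := exists_one_two_three_three (k := k) (by omega) (by omega)
        exact hT _ (3 * x) (3 * y) z w (by linarith)
      · obtain ⟨x, y, z, e⟩ := exists_one_one_three (n := n - m) (by omega) (by omega)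
        exact hT n x y z 1 (by linarith)
    · obtain ⟨X, Y, Z, e⟩ :=
        exists_one_one_three (n := 3 * (3 * n - 3 * m + 1)) (by omega) (by omega)
      have hX := sq_mod_three_power X
      have hY := sq_mod_three_power Y
      obtain ⟨x, rfl⟩ : ∃ x, X = 3 * x := ⟨X / 3, by omega⟩
      obtain ⟨y, rfl⟩ : ∃ y, Y = 3 * y := ⟨Y / 3, by omega⟩
      have hZ := sq_mod_three_power Z
      obtain ⟨z, hz | hz⟩ : ∃ z, Z = 3 * z + 1 ∨ -Z = 3 * z + 1 := by
        by_cases hs : Z % 3 = 1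
        · exact ⟨Z / 3, by omega⟩
        · exact ⟨-Z / 3, by omega⟩
      · exact hT n x y z 1 (by rw [hz] at e; linarith)
      · exact hT n x y z 1 (by rw [← neg_sq Z, hz] at e; linarith)
  · obtain ⟨x, y, z, e⟩ := exists_one_one_three hn (by omega)
    exact hT n x y z 0 (by linarith)
end

theorem exists_five_ten_one {N : ℤ} (hN : 0 < N) (h : N % 5 = 1 ∨ N % 5 = 4) :
    ∃ x y z : ℤ, N = 5 * x ^ 2 + 10 * y ^ 2 + z ^ 2 := by
  obtain ⟨X, Y, z, e⟩ := exists_one_two_five (n := 5 * N) (by omega) (by omega)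
  have hX := sq_mod_five X
  have hY := sq_mod_five Y
  obtain ⟨x, rfl⟩ : ∃ x, X = 5 * x := ⟨X / 5, by omega⟩
  obtain ⟨y, rfl⟩ : ∃ y, Y = 5 * y := ⟨Y / 5, by omega⟩
  exact ⟨x, y, z, by linarith⟩

theorem exists_five_ten_coset {N c : ℤ} (hN : 0 < N) (h : (N - c ^ 2) % 5 = 0) (hc : c % 5 ≠ 0) :
    ∃ x y z : ℤ, N = 5 * x ^ 2 + 10 * y ^ 2 + (5 * z + c) ^ 2 := by
  have hc' := sq_mod_five c
  obtain ⟨x, y, Z, e⟩ := exists_five_ten_one hN (by omega)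
  have hZ := sq_mod_five Z
  obtain ⟨z, hz | hz⟩ : ∃ z, Z = 5 * z + c ∨ -Z = 5 * z + c := by
    by_cases hs : (Z - c) % 5 = 0
    · exact ⟨(Z - c) / 5, by omega⟩
    · exact ⟨(-Z - c) / 5, by omega⟩
  · exact ⟨x, y, z, by rw [← hz, e]⟩
  · exact ⟨x, y, z, by rw [← hz, neg_sq, e]⟩

theorem emod_five_ne_of_ten_eq {x y z m : ℤ} (hm : 0 ≤ m)
    (e : 10 = x ^ 2 + 2 * y ^ 2 + 5 * z ^ 2 + 2 * y + m) : m % 5 ≠ 3 := by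
  intro h3
  have e' : 21 - 2 * m = 2 * x ^ 2 + (2 * y + 1) ^ 2 + 10 * z ^ 2 := by linarith
  have hY : (2 * y + 1) % 5 = 0 := by
    have hx := sq_mod_five x
    have hy := sq_mod_five (2 * y + 1)
    rcases hy with hy | hy | hy <;> omega
  obtain ⟨t, ht⟩ : ∃ t, 2 * y + 1 = 5 * (2 * t + 1) := ⟨(2 * y + 1) / 10, by omega⟩
  rw [ht] at e'
  nlinarith [sq_nonneg x, sq_nonneg z, Int.le_self_sq (-t), Int.le_self_sq t]

section

variable {R : ℤ → Prop} (hR : CriticalValues R)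

include hR

theorem universal_one_two_five {b c m : ℤ} (hb0 : 0 ≤ b) (hb1 : b ≤ 1) (hc0 : 0 ≤ c) (hc2 : c ≤ 2)
    (hm : 0 ≤ m)
    (hT : ∀ n x y z w, n = x ^ 2 + 2 * y ^ 2 + 5 * z ^ 2 + 2 * b * y * w + 2 * c * z * w +
      m * w ^ 2 → R n)
    (ht : ∃ x y z : ℤ, 10 = x ^ 2 + 2 * y ^ 2 + 5 * z ^ 2 + 2 * b * y + 2 * c * z + m) :
    ∀ n, 0 < n → R n := by
  refine hR.of_squarefree fun n hn _ _ h25 _ ↦ ?_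
  by_cases h6 : n % 25 = 10 ∨ n % 25 = 15
  · by_cases hs : n < 35
    · exact hR.critical n (by omega)
    obtain ⟨x, y, z, e⟩ := ht
    have hm6 : m ≤ 10 := by
      have hy := self_le_sq_int y
      have hz := self_le_sq_int z
      interval_cases b <;> interval_cases c <;> nlinarith [sq_nonneg x]
    by_cases h35 : m = 10 ∧ n = 35
    · obtain ⟨rfl, rfl⟩ := h35
      exact hT _ 5 0 0 1 (by norm_num)
    by_cases hc : c = 0
    · subst hc
      have hx := sq_mod_five x
      have hz := sq_mod_five z
      obtain rfl | rfl : b = 0 ∨ b = 1 := by omega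
      · have h0 : m ≠ 0 := by
          rintro rfl
          have hy := sq_mod_five y
          omega
        have key : ∀ w N, N = n - m * w ^ 2 → 0 < N →
            N % 5 ≠ 0 ∨ N % 25 = 5 ∨ N % 25 = 20 → R n := by
          intro w N hN h0 h
          obtain ⟨x, y, z, e⟩ := exists_one_two_five h0 h
          exact hT n x y z w (by linarith)
        clear e hx hz
        by_cases hw : m = 5 ∧ n % 25 = 15 ∨ m = 10 ∧ n % 25 = 10
        · exact key 2 _ rfl (by omega) (by omega)
        · exact key 1 _ rfl (by omega) (by omega)
      · have h3 := emod_five_ne_of_ten_eq hm (x := x) (y := y) (z := z) (m := m) (by linarith)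
        clear e hx hz
        obtain ⟨x, y, z, e⟩ := exists_one_two_five (n := n - 4 * m + 2) (by omega) (by omega)
        exact hT n x (y - 1) z 2 (by linarith)
    · obtain rfl | rfl : b = 0 ∨ b = 1 := by omega
      · obtain ⟨x, y, z, e⟩ := exists_five_ten_coset (N := 5 * n - 5 * m + c ^ 2) (c := c)
          (by have h := sq_nonneg c; omega) (by omega) (by omega)
        exact hT n x y z 1 (by linarith)
      · obtain ⟨x, y, z, e⟩ :=
          exists_five_ten_coset (N := 5 * n - 20 * m + 10 + (2 * c) ^ 2) (c := 2 * c)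
          (by have h := sq_nonneg (2 * c); omega) (by omega) (by omega)
        exact hT n x (y - 1) z 2 (by linarith)
  · obtain ⟨x, y, z, e⟩ := exists_one_two_five hn (by omega)
    exact hT n x y z 0 (by linarith)
end

theorem IsSumThreeSq.exists_congr_mod_three {n : ℤ} (h : IsSumThreeSq n) :
    ∃ x p q : ℤ, n = x ^ 2 + p ^ 2 + q ^ 2 ∧ (p - q) % 3 = 0 := by
  obtain ⟨x, y, z, e⟩ := h
  have key : ∀ x p q : ℤ, n = x ^ 2 + p ^ 2 + q ^ 2 → (p ^ 2 - q ^ 2) % 3 = 0 →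
      ∃ x p q : ℤ, n = x ^ 2 + p ^ 2 + q ^ 2 ∧ (p - q) % 3 = 0 := by
    intro x p q e h
    have hp := sq_mod_three_power p
    have hq := sq_mod_three_power q
    by_cases hs : (p - q) % 3 = 0
    · exact ⟨x, p, q, e, hs⟩
    · exact ⟨x, p, -q, by rw [e]; ring, by omega⟩
  have hx := sq_mod_three_power x
  have hy := sq_mod_three_power y
  have hz := sq_mod_three_power z
  obtain h | h | h : (y ^ 2 - z ^ 2) % 3 = 0 ∨ (x ^ 2 - z ^ 2) % 3 = 0 ∨
    (x ^ 2 - y ^ 2) % 3 = 0 := by omega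
  · exact key x y z e h
  · exact key y x z (by linarith) h
  · exact key z x y (by linarith) h

theorem IsSumThreeSq.exists_sub_one_mod_three {n : ℤ} (h : IsSumThreeSq n) (hn : n ≠ 0) :
    ∃ x p q : ℤ, n = x ^ 2 + p ^ 2 + q ^ 2 ∧ (p - q - 1) % 3 = 0 := by
  obtain ⟨x, y, z, e, h⟩ := h.exists_not_three_dvd hn
  have key : ∀ x p q : ℤ, n = x ^ 2 + p ^ 2 + q ^ 2 → p % 3 ≠ 0 →
      ∃ x p q : ℤ, n = x ^ 2 + p ^ 2 + q ^ 2 ∧ (p - q - 1) % 3 = 0 := by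
    intro x p q e h
    by_cases h1 : (p - q - 1) % 3 = 0
    · exact ⟨x, p, q, e, h1⟩
    by_cases h2 : (p + q - 1) % 3 = 0
    · exact ⟨x, p, -q, by rw [e]; ring, by omega⟩
    by_cases h3 : (-p + q - 1) % 3 = 0
    · exact ⟨x, -p, -q, by rw [e]; ring, by omega⟩
    · exact ⟨x, -p, q, by rw [e]; ring, by omega⟩
  obtain h | h | h : x % 3 ≠ 0 ∨ y % 3 ≠ 0 ∨ z % 3 ≠ 0 := by omega
  · exact key y x z (by linarith) h
  · exact key x y z e h
  · exact key x z y (by linarith) h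

theorem IsSumThreeSq.exists_three_mul {n : ℤ} (h : IsSumThreeSq n) (hn : n % 3 = 2) :
    ∃ x p q : ℤ, n = (3 * x) ^ 2 + p ^ 2 + q ^ 2 := by
  obtain ⟨x, y, z, e⟩ := h
  have hx := sq_mod_three_power x
  have hy := sq_mod_three_power y
  have hz := sq_mod_three_power z
  obtain h | h | h : x % 3 = 0 ∨ y % 3 = 0 ∨ z % 3 = 0 := by omega
  · exact ⟨x / 3, y, z, by rw [Int.mul_ediv_cancel' (by omega), e]⟩
  · exact ⟨y / 3, x, z, by rw [Int.mul_ediv_cancel' (by omega), e]; ring⟩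
  · exact ⟨z / 3, x, y, by rw [Int.mul_ediv_cancel' (by omega), e]; ring⟩

theorem exists_inner_one_coset {n b c m w N : ℤ}
    (hN : N = 9 * n - (9 * m - (2 * b - c) ^ 2 - (b + c) ^ 2) * w ^ 2) (hbc : (b + c) % 3 ≠ 0)
    (hw : w % 3 ≠ 0) (h : IsSumThreeSq N) :
    ∃ x y z : ℤ, n = x ^ 2 + 2 * y ^ 2 + 2 * y * z + 5 * z ^ 2 + 2 * b * y * w +
      2 * c * z * w + m * w ^ 2 := by
  obtain ⟨A, hA⟩ : ∃ A, N = 9 * A + ((2 * b - c) * w) ^ 2 + ((b + c) * w) ^ 2 :=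
    ⟨n - m * w ^ 2, by rw [hN]; ring⟩
  obtain ⟨r, hr, hr'⟩ : ∃ r, (b + c) * w = r ∧ ¬ r % 3 = 0 := by
    refine ⟨_, rfl, fun h ↦ ?_⟩
    rcases Int.prime_three.dvd_or_dvd (Int.dvd_of_emod_eq_zero h) with h | h <;> omega
  obtain ⟨p, hp⟩ : ∃ p, (2 * b - c) * w = p := ⟨_, rfl⟩
  have hpr : p = 3 * (b * w) - r := by rw [← hp, ← hr]; ring
  rw [hr, hp] at hA
  have hr2 := sq_mod_three_power r
  have hp2 := sq_mod_three_power p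
  obtain ⟨x, P, S, e⟩ := h.exists_three_mul (by omega)
  have key : ∀ P S, N = (3 * x) ^ 2 + P ^ 2 + S ^ 2 → (P - p) % 3 = 0 → (S - r) % 3 = 0 →
      ∃ x y z : ℤ, n = x ^ 2 + 2 * y ^ 2 + 2 * y * z + 5 * z ^ 2 + 2 * b * y * w +
        2 * c * z * w + m * w ^ 2 := by
    intro P S e h1 h2
    obtain ⟨u, rfl⟩ : ∃ u, P = 3 * u + p := ⟨(P - p) / 3, by omega⟩
    obtain ⟨v, rfl⟩ : ∃ v, S = 3 * v + r := ⟨(S - r) / 3, by omega⟩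
    have huv : (r * (v - u)) % 3 = 0 := by
      have : 9 * A = 9 * (x ^ 2 + u ^ 2 + v ^ 2) + 6 * (r * (v - u)) + 18 * (u * (b * w)) := by
        rw [hpr] at e hA; linarith
      omega
    obtain ⟨z, hz⟩ := (Int.prime_three.dvd_or_dvd (Int.dvd_of_emod_eq_zero huv)).resolve_left
      (by omega)
    obtain rfl : v = u + 3 * z := by linarith
    subst hp hr
    exact ⟨x, u + z, z, by linarith⟩
  have hP := sq_mod_three_power P
  have hS := sq_mod_three_power S
  have hx : (3 * x) ^ 2 = 9 * x ^ 2 := by ring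
  obtain ⟨P', hP', h1⟩ : ∃ P', P' ^ 2 = P ^ 2 ∧ (P' - p) % 3 = 0 := by
    by_cases hs : (P - p) % 3 = 0
    · exact ⟨P, rfl, hs⟩
    · exact ⟨-P, by ring, by omega⟩
  obtain ⟨S', hS', h2⟩ : ∃ S', S' ^ 2 = S ^ 2 ∧ (S' - r) % 3 = 0 := by
    by_cases hs : (S - r) % 3 = 0
    · exact ⟨S, rfl, hs⟩
    · exact ⟨-S, by ring, by omega⟩
  exact key P' S' (by rw [hP', hS', e]) h1 h2

section

variable {R : ℤ → Prop} (hR : CriticalValues R)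

include hR

theorem universal_one_two_five_of_inner_one {b c m : ℤ}
    (hbc : b = 0 ∧ c = 0 ∨ b = 0 ∧ c = 1 ∨ b = 0 ∧ c = 2 ∨ b = 1 ∧ c = -1 ∨ b = 1 ∧ c = 0)
    (hm : 0 ≤ m)
    (hT : ∀ n x y z w, n = x ^ 2 + 2 * y ^ 2 + 2 * y * z + 5 * z ^ 2 + 2 * b * y * w +
      2 * c * z * w + m * w ^ 2 → R n)
    (ht : ∃ x y z : ℤ, 7 = x ^ 2 + 2 * y ^ 2 + 2 * y * z + 5 * z ^ 2 + 2 * b * y + 2 * c * z + m) :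
    ∀ n, 0 < n → R n := by
  refine hR.of_squarefree fun n hn h4 _ _ _ ↦ ?_
  by_cases h7 : n % 8 = 7
  · by_cases hs : n < 16
    · exact hR.critical n (by omega)
    obtain ⟨x, y, z, e⟩ := ht
    have hm7 : m ≤ 7 := by
      have hx := sq_nonneg x
      have hy := self_le_sq_int (y + z)
      have hz := self_le_sq_int y
      have hz := self_le_sq_int z
      obtain ⟨rfl, rfl⟩ | ⟨rfl, rfl⟩ | ⟨rfl, rfl⟩ | ⟨rfl, rfl⟩ | ⟨rfl, rfl⟩ := hbc <;>
        nlinarith [sq_nonneg (y + z), sq_nonneg y, sq_nonneg (y + z + 1), sq_nonneg z]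
    by_cases h23 : m = 7 ∧ n = 23
    · exact hT n 4 0 0 1 (by linarith)
    by_cases hbc' : (b + c) % 3 = 0
    · obtain ⟨rfl, rfl⟩ | ⟨rfl, rfl⟩ : b = 0 ∧ c = 0 ∨ b = 1 ∧ c = -1 := by omega
      · have key : ∀ w N, N = n - m * w ^ 2 → 0 ≤ N →
            N % 4 = 1 ∨ N % 4 = 2 ∨ N % 8 = 3 ∨ N % 16 = 4 → R n := by
          intro w N hN h0 h
          obtain ⟨x, p, q, e, h⟩ := (IsSumThreeSq.of_mod h0 (by omega)).exists_congr_mod_three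
          obtain ⟨z, rfl⟩ : ∃ z, q = p + 3 * z := ⟨(q - p) / 3, by omega⟩
          exact hT n x (p + z) z w (by linarith)
        have h0 : m ≠ 0 := by
          rintro rfl
          exact not_isSumThreeSq_of_mod_eight (n := 7) rfl ⟨x, y - z, y + 2 * z, by linarith⟩
        by_cases h37 : m = 3 ∨ m = 7
        · exact key 2 _ rfl (by omega) (by omega)
        · exact key 1 _ rfl (by omega) (by omega)
      · have key : ∀ w N, w = 1 ∨ w = 2 → N = n - (m - 1) * w ^ 2 → 0 < N →
            N % 4 = 1 ∨ N % 4 = 2 ∨ N % 8 = 3 → R n := by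
          intro w N hw hN h0 h
          obtain ⟨x, p, q, e, h⟩ :=
            (IsSumThreeSq.of_mod h0.le (by omega)).exists_sub_one_mod_three h0.ne'
          obtain rfl | rfl := hw
          · obtain ⟨z, rfl⟩ : ∃ z, q = p - 1 + 3 * z := ⟨(q - p + 1) / 3, by omega⟩
            exact hT n x (p - 1 + z) z 1 (by linarith)
          · obtain ⟨z, rfl⟩ : ∃ z, p = q - 2 + 3 * z := ⟨(p - q + 2) / 3, by omega⟩
            exact hT n x (q - 2 + z) z 2 (by linarith)
        have h0 : m ≠ 1 := by
          rintro rfl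
          exact not_isSumThreeSq_of_mod_eight (n := 7) rfl
            ⟨x, y - z + 1, y + 2 * z, by linarith⟩
        clear e
        by_cases h37 : m = 4 ∨ m = 0
        · exact key 2 _ (by simp) rfl (by omega) (by omega)
        · exact key 1 _ (by simp) rfl (by omega) (by omega)
    · have key : ∀ w N, N = 9 * n - (9 * m - (2 * b - c) ^ 2 - (b + c) ^ 2) * w ^ 2 →
          w = 1 ∨ w = 2 → 0 ≤ N → N % 4 = 1 ∨ N % 4 = 2 ∨ N % 8 = 3 → R n := by
        intro w N hN hw h0 h
        obtain ⟨x, y, z, e⟩ := exists_inner_one_coset hN hbc' (by omega)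
          (IsSumThreeSq.of_mod h0 (by omega))
        exact hT n x y z w e
      obtain ⟨κ, hκ⟩ : ∃ κ, 9 * m - (2 * b - c) ^ 2 - (b + c) ^ 2 = κ := ⟨_, rfl⟩
      have h8 : κ % 8 ≠ 0 := by
        intro h8
        refine not_isSumThreeSq_of_mod_eight (n := 63 - κ) (by omega)
          ⟨3 * x, 3 * (y - z) + (2 * b - c), 3 * (y + 2 * z) + (b + c), ?_⟩
        rw [← hκ]
        linarith
      rw [hκ] at key
      have hκ' : κ ≤ 61 ∧ (m = 7 ∨ κ ≤ 52) := by
        obtain ⟨rfl, rfl⟩ | ⟨rfl, rfl⟩ | ⟨rfl, rfl⟩ : b = 0 ∧ c = 1 ∨ b = 0 ∧ c = 2 ∨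
          b = 1 ∧ c = 0 := by omega
        all_goals constructor <;> omega
      clear e hκ
      by_cases hw : κ % 2 = 1
      · exact key 2 _ rfl (by simp) (by omega) (by omega)
      · exact key 1 _ rfl (by simp) (by omega) (by omega)
  · obtain ⟨x, p, q, e, h⟩ := (IsSumThreeSq.of_mod hn.le (by omega)).exists_congr_mod_three
    obtain ⟨z, rfl⟩ : ∃ z, q = p + 3 * z := ⟨(q - p) / 3, by omega⟩
    exact hT n x (p + z) z 0 (by linarith)
end

theorem exists_eq_two_mul_of_even_norm {c d : ℤ} (h : (c ^ 2 + c * d + 2 * d ^ 2) % 2 = 0) :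
    ∃ y z : ℤ, c ^ 2 + c * d + 2 * d ^ 2 = 2 * (y ^ 2 + y * z + 2 * z ^ 2) := by
  obtain hc | hc := Int.emod_two_eq_zero_or_one c
  · obtain ⟨e, rfl⟩ : ∃ e, c = 2 * e := ⟨c / 2, by omega⟩
    exact ⟨d, e, by ring⟩
  · obtain hd | hd := Int.emod_two_eq_zero_or_one d
    · obtain ⟨e, rfl⟩ : ∃ e, c = 2 * e + 1 := ⟨c / 2, by omega⟩
      obtain ⟨f, rfl⟩ : ∃ f, d = 2 * f := ⟨d / 2, by omega⟩
      ring_nf at h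
      omega
    · obtain ⟨e, rfl⟩ : ∃ e, c = 2 * e - d := ⟨(c + d) / 2, by omega⟩
      exact ⟨-d, e, by ring⟩

theorem exists_eq_sq_add_seven_mul_sq_of_odd_norm {c d : ℤ}
    (h : (c ^ 2 + c * d + 2 * d ^ 2) % 2 = 1) :
    ∃ p q : ℤ, c ^ 2 + c * d + 2 * d ^ 2 = p ^ 2 + 7 * q ^ 2 := by
  obtain hd | hd := Int.emod_two_eq_zero_or_one d
  · obtain ⟨q, rfl⟩ : ∃ q, d = 2 * q := ⟨d / 2, by omega⟩
    exact ⟨c + q, q, by ring⟩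
  · obtain ⟨f, rfl⟩ : ∃ f, d = 2 * f + 1 := ⟨d / 2, by omega⟩
    obtain ⟨j, hj⟩ := exists_sq_add_self c
    have : c ^ 2 + c * (2 * f + 1) + 2 * (2 * f + 1) ^ 2 =
      2 * (j + c * f + (2 * f + 1) ^ 2) := by linarith
    omega

theorem exists_eq_two_mul_of_even_sq_add {p q : ℤ} (h : (p ^ 2 + 7 * q ^ 2) % 2 = 0) :
    ∃ y z : ℤ, p ^ 2 + 7 * q ^ 2 = 2 * (y ^ 2 + y * z + 2 * z ^ 2) := by
  have e : p ^ 2 + 7 * q ^ 2 = (p - q) ^ 2 + (p - q) * (2 * q) + 2 * (2 * q) ^ 2 := by ring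
  rw [e] at h ⊢
  exact exists_eq_two_mul_of_even_norm h

theorem sq_mod_seven (x : ℤ) :
    x % 7 = 0 ∧ x ^ 2 % 7 = 0 ∨ (x % 7 = 1 ∨ x % 7 = 6) ∧ x ^ 2 % 7 = 1 ∨
      (x % 7 = 2 ∨ x % 7 = 5) ∧ x ^ 2 % 7 = 4 ∨ (x % 7 = 3 ∨ x % 7 = 4) ∧ x ^ 2 % 7 = 2 := by
  obtain ⟨k, hk⟩ : ∃ k, x = 7 * k + x % 7 := ⟨x / 7, by omega⟩
  have h : x ^ 2 = 7 * (7 * k ^ 2 + 2 * k * (x % 7)) + (x % 7) ^ 2 := by nth_rewrite 1 [hk]; ring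
  rcases (by omega : x % 7 = 0 ∨ x % 7 = 1 ∨ x % 7 = 2 ∨ x % 7 = 3 ∨ x % 7 = 4 ∨ x % 7 = 5 ∨
    x % 7 = 6) with h' | h' | h' | h' | h' | h' | h' <;> rw [h'] at h <;> omega

/-- If `√-7` divides the norm of an integer of `ℚ(√-7)`, it divides the integer itself. -/
theorem exists_norm_div_seven {c d t : ℤ} (h : c + 4 * d = 7 * t) :
    c ^ 2 + c * d + 2 * d ^ 2 = 7 * (t ^ 2 + t * (d - 2 * t) + 2 * (d - 2 * t) ^ 2) := by
  obtain rfl : c = 7 * t - 4 * d := by linarith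
  ring

theorem norm_emod_seven (c d : ℤ) : ∃ k, c ^ 2 + c * d + 2 * d ^ 2 = (c + 4 * d) ^ 2 - 7 * k :=
  ⟨c * d + 2 * d ^ 2, by ring⟩

theorem exists_two_one_four {n : ℤ} (hn : 0 < n) (h4 : n % 4 = 0 ∨ n % 4 = 1)
    (h : n % 7 ≠ 0 ∨ n % 49 = 7 ∨ n % 49 = 14 ∨ n % 49 = 28) :
    ∃ x y z : ℤ, n = x ^ 2 + 2 * (y ^ 2 + y * z + 2 * z ^ 2) := by
  obtain ⟨X, c, d, e⟩ := exists_seven hn h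
  clear h
  obtain h | h := Int.emod_two_eq_zero_or_one (c ^ 2 + c * d + 2 * d ^ 2)
  · obtain ⟨y, z, h⟩ := exists_eq_two_mul_of_even_norm h
    exact ⟨X, y, z, by rw [e, ← h]⟩
  · obtain ⟨p, q, hpq⟩ := exists_eq_sq_add_seven_mul_sq_of_odd_norm h
    rw [hpq] at e h
    obtain ⟨y, z, h⟩ := exists_eq_two_mul_of_even_sq_add (p := X) (q := q) (by
      have hX := sq_mod_two_power X
      have hp := sq_mod_two_power p
      have hq := sq_mod_two_power q
      clear hpq
      rcases hX with hX | hX | hX <;> rcases hp with hp | hp | hp <;>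
        rcases hq with hq | hq | hq <;> omega)
    exact ⟨p, y, z, by linarith⟩

theorem exists_seven_two_one_four {N t : ℤ} (h0 : 0 < N) (h4 : N % 4 = 0 ∨ N % 4 = 3)
    (ht : t % 7 ≠ 0) (h : (N - 2 * t ^ 2) % 7 = 0) :
    ∃ x y z : ℤ, N = 7 * x ^ 2 + 2 * (y ^ 2 + y * z + 2 * z ^ 2) ∧ (y + 4 * z - t) % 7 = 0 := by
  have ht' := sq_mod_seven t
  obtain ⟨X, c, d, e⟩ := exists_two_one_four (n := 7 * N) (by omega) (by omega) (by omega)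
  obtain ⟨k, hk⟩ := norm_emod_seven c d
  have hXc : X % 7 = 0 ∧ (c + 4 * d) % 7 = 0 := by
    have hX := sq_mod_seven X
    have hc := sq_mod_seven (c + 4 * d)
    rw [hk] at e
    clear ht' h
    rcases hX with hX | hX | hX | hX <;> rcases hc with hc | hc | hc | hc <;> omega
  obtain ⟨x, rfl⟩ : ∃ x, X = 7 * x := ⟨X / 7, by omega⟩
  obtain ⟨y, hy⟩ : ∃ y, c + 4 * d = 7 * y := ⟨(c + 4 * d) / 7, by omega⟩
  have e' := exists_norm_div_seven hy
  obtain ⟨z, hz⟩ : ∃ z, d - 2 * y = z := ⟨_, rfl⟩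
  rw [hz] at e'
  have e'' : N = 7 * x ^ 2 + 2 * (y ^ 2 + y * z + 2 * z ^ 2) := by linarith
  have hs : (y + 4 * z - t) % 7 = 0 ∨ (-y + 4 * (-z) - t) % 7 = 0 := by
    obtain ⟨k, hk⟩ := norm_emod_seven y z
    have hy := sq_mod_seven (y + 4 * z)
    rw [hk] at e''
    clear e e' hXc
    rcases ht' with ht' | ht' | ht' | ht' <;> rcases hy with hy | hy | hy | hy <;> omega
  obtain hs | hs := hs
  · exact ⟨x, y, z, e'', hs⟩
  · exact ⟨x, -y, -z, by rw [e'']; ring, hs⟩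

theorem exists_two_one_four_coset {n b c m w N : ℤ}
    (hN : N = 7 * n - (7 * m - 2 * (c ^ 2 - b * c + 2 * b ^ 2)) * w ^ 2) (h0 : 0 < N)
    (h4 : N % 4 = 0 ∨ N % 4 = 3) (ht : ((4 * b - c) * w) % 7 ≠ 0) :
    ∃ x y z, n = x ^ 2 + 2 * y ^ 2 + 2 * y * z + 4 * z ^ 2 + 2 * b * y * w + 2 * c * z * w +
      m * w ^ 2 := by
  obtain ⟨x, Y, Z, e, h⟩ := exists_seven_two_one_four h0 h4 ht (by
    have : N - 2 * ((4 * b - c) * w) ^ 2 =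
      7 * (n - m * w ^ 2 + 2 * b * c * w ^ 2 - 4 * b ^ 2 * w ^ 2) := by rw [hN]; ring
    omega)
  obtain ⟨y, hy⟩ : ∃ y, Y + 4 * Z - (4 * b - c) * w = 7 * y :=
    ⟨(Y + 4 * Z - (4 * b - c) * w) / 7, by omega⟩
  obtain ⟨z, rfl⟩ : ∃ z, Z = 2 * y + z + b * w := ⟨Z - 2 * y - b * w, by ring⟩
  obtain rfl : Y = -y - 4 * z - c * w := by linarith
  refine ⟨x, y, z, ?_⟩
  linarith

theorem IsSumThreeSq.one_two_six {n : ℤ} (h : IsSumThreeSq (3 * n)) :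
    ∃ x y z : ℤ, n = x ^ 2 + 2 * y ^ 2 + 6 * z ^ 2 := by
  obtain ⟨a, b, c, e, hp, hs⟩ : ∃ a b c : ℤ, 3 * n = a ^ 2 + b ^ 2 + c ^ 2 ∧
      (a - c) % 6 = 0 ∧ (a - b) % 3 = 0 := by
    obtain ⟨a, c, b, e, hp, -, h⟩ := h.exists_zero_sum_mod_three (by omega)
    have ha := sq_mod_three_power a
    have hb := sq_mod_three_power b
    have hc := sq_mod_three_power c
    exact ⟨a, b, c, by linarith, by omega, by omega⟩
  obtain ⟨w, hw⟩ : ∃ w, a - c = 6 * w := ⟨(a - c) / 6, by omega⟩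
  obtain ⟨x, hx⟩ : ∃ x, a + b + c = 3 * x := ⟨(a + b + c) / 3, by omega⟩
  obtain ⟨y, hy⟩ : ∃ y, a + c - 2 * b = 6 * y := ⟨(a + c - 2 * b) / 6, by omega⟩
  obtain rfl : a = x + y + 3 * w := by linarith
  obtain rfl : b = x - 2 * y := by linarith
  obtain rfl : c = x + y - 3 * w := by linarith
  exact ⟨x, y, w, by linarith⟩

section FourCoset

variable {n : ℤ} (hn : 0 < n) (h4 : n % 4 ≠ 0)

include hn h4

theorem exists_two_one_four_orthogonal_seven (h7 : n % 7 ≠ 0) (h3 : n ≠ 3) :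
    ∃ x y z w : ℤ, n = x ^ 2 + 2 * y ^ 2 + 2 * y * z + 4 * z ^ 2 + 7 * w ^ 2 := by
  rcases (by omega : n % 4 = 1 ∨ n % 4 = 2 ∨ n % 4 = 3) with h | h | h
  · obtain ⟨x, y, z, e⟩ := exists_two_one_four hn (.inr h) (.inl h7)
    exact ⟨x, y, z, 0, by linarith⟩
  · obtain ⟨N, rfl⟩ : ∃ N, n = 2 * N := ⟨n / 2, by omega⟩
    obtain ⟨X, c, d, e⟩ := exists_seven (n := N) (by omega) (.inl (by omega))
    obtain hX | hX := Int.emod_two_eq_zero_or_one X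
    · obtain ⟨x, rfl⟩ : ∃ x, X = 2 * x := ⟨X / 2, by omega⟩
      exact ⟨x, c, d, x, by linarith⟩
    · obtain ⟨y, z, h⟩ := exists_eq_two_mul_of_even_norm (c := c) (d := d) (by
        have := sq_mod_two_power X
        omega)
      exact ⟨2 * y + z, X, 0, z, by linarith⟩
  · obtain ⟨x, y, z, e⟩ :=
      exists_two_one_four (n := n - 7) (by omega) (.inl (by omega)) (.inl (by omega))
    exact ⟨x, y, z, 1, by linarith⟩

end FourCoset

theorem IsSumThreeSq.exists_odd_even_even {n : ℤ} (h : n % 4 = 1) {x y z : ℤ}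
    (e : n = x ^ 2 + y ^ 2 + z ^ 2) :
    x % 2 = 1 ∧ y % 2 = 0 ∧ z % 2 = 0 ∨ y % 2 = 1 ∧ x % 2 = 0 ∧ z % 2 = 0 ∨
      z % 2 = 1 ∧ x % 2 = 0 ∧ y % 2 = 0 := by
  have hx := sq_mod_two_power x
  have hy := sq_mod_two_power y
  have hz := sq_mod_two_power z
  omega

theorem exists_sq_eq_of_not_three_dvd {x : ℤ} (h : x % 3 ≠ 0) :
    ∃ y, x ^ 2 = y ^ 2 ∧ y % 3 = 1 ∧ (x - y) % 2 = 0 := by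
  obtain h | h : x % 3 = 1 ∨ x % 3 = 2 := by omega
  · exact ⟨x, rfl, h, by simp⟩
  · exact ⟨-x, by ring, by omega, by omega⟩

theorem exists_two_one_four_inner_one_seven {n : ℤ} (h : n % 4 = 3) (h9 : n % 9 ≠ 0)
    (hn : 11 ≤ n) (h15 : n ≠ 15) :
    ∃ x y z w : ℤ, n = x ^ 2 + 2 * y ^ 2 + 2 * y * z + 4 * z ^ 2 + 2 * z * w + 7 * w ^ 2 := by
  by_cases h3 : n % 3 = 0
  · obtain ⟨C, D, E, e, hC, hD, hE⟩ : ∃ C D E : ℤ, 32 * n - 423 = C ^ 2 + 4 * D ^ 2 + 4 * E ^ 2 ∧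
        C % 2 = 1 ∧ D % 2 = 1 ∧ E % 2 = 1 := by
      obtain ⟨C, D, E, e, hC, hD, hE, h3C, h3D, h3E⟩ : ∃ C D E : ℤ,
          32 * n - 423 = C ^ 2 + D ^ 2 + E ^ 2 ∧ C % 2 = 1 ∧ D % 2 = 0 ∧ E % 2 = 0 ∧
          C % 3 ≠ 0 ∧ D % 3 ≠ 0 ∧ E % 3 ≠ 0 := by
        obtain ⟨x, y, z, e⟩ :=
          IsSumThreeSq.of_mod (n := 32 * n - 423) (by omega) (.inl (by omega))
        have h3 : x % 3 ≠ 0 ∧ y % 3 ≠ 0 ∧ z % 3 ≠ 0 := by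
          have hx := sq_mod_three_power x
          have hy := sq_mod_three_power y
          have hz := sq_mod_three_power z
          omega
        obtain ⟨h1, h2, h⟩ | ⟨h1, h2, h⟩ | ⟨h1, h2, h⟩ :=
          IsSumThreeSq.exists_odd_even_even (by omega) e
        · exact ⟨x, y, z, e, h1, h2, h, h3⟩
        · exact ⟨y, x, z, by linarith, h1, h2, h, h3.2.1, h3.1, h3.2.2⟩
        · exact ⟨z, x, y, by linarith, h1, h2, h, h3.2.2, h3.1, h3.2.1⟩
      obtain ⟨C, hC', h3C, _⟩ := exists_sq_eq_of_not_three_dvd h3C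
      obtain ⟨D, hD', h3D, _⟩ := exists_sq_eq_of_not_three_dvd h3D
      obtain ⟨E, hE', h3E, _⟩ := exists_sq_eq_of_not_three_dvd h3E
      rw [hC', hD', hE'] at e
      obtain ⟨D, rfl⟩ : ∃ d, D = 2 * d := ⟨D / 2, by omega⟩
      obtain ⟨E, rfl⟩ : ∃ d, E = 2 * d := ⟨E / 2, by omega⟩
      have hDE : D % 2 = E % 2 := by
        have hC := sq_mod_two_power C
        have hD := sq_mod_two_power D
        have hE := sq_mod_two_power E
        rw [mul_pow, mul_pow] at e
        clear hC' hD' hE' h9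
        omega
      obtain hD2 | hD2 := Int.emod_two_eq_zero_or_one D
      · obtain ⟨k, hk⟩ : ∃ k, C + 2 * D + 2 * E = 3 * k := ⟨(C + 2 * D + 2 * E) / 3, by omega⟩
        refine ⟨C - 2 * k, D - k, E - k, ?_, by omega, by omega, by omega⟩
        obtain rfl : C = 3 * k - 2 * D - 2 * E := by linarith
        linarith
      · exact ⟨C, D, E, by linarith, by omega, hD2, by omega⟩
    obtain ⟨x, B, e, hB⟩ : ∃ x B : ℤ, 32 * n - 423 = C ^ 2 + 32 * x ^ 2 + 8 * B ^ 2 ∧ B % 2 = 1 := by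
      obtain ⟨p, rfl⟩ : ∃ p, D = 2 * p - E := ⟨(D + E) / 2, by omega⟩
      obtain h | h : p % 2 = 0 ∨ (p - E) % 2 = 0 := by omega
      · obtain ⟨x, rfl⟩ : ∃ x, p = 2 * x := ⟨p / 2, by omega⟩
        exact ⟨x, 2 * x - E, by linarith, by omega⟩
      · obtain ⟨x, rfl⟩ : ∃ x, p = 2 * x + E := ⟨(p - E) / 2, by omega⟩
        exact ⟨x, 2 * x + E, by linarith, by omega⟩
    obtain ⟨u, hu⟩ : ∃ u, C ^ 2 = (16 * u + 9) ^ 2 := by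
      have hC' : C % 16 = 7 ∨ C % 16 = 9 := by
        obtain ⟨c, hc⟩ : ∃ c, C = 16 * c + C % 16 := ⟨C / 16, by omega⟩
        have hB := sq_mod_two_power B
        have h2 : C ^ 2 = 32 * (8 * c ^ 2 + c * (C % 16)) + (C % 16) ^ 2 := by
          nth_rewrite 1 [hc]; ring
        rw [h2] at e
        clear hD hE h9 h3 hn
        rcases (by omega : C % 16 = 1 ∨ C % 16 = 3 ∨ C % 16 = 5 ∨ C % 16 = 7 ∨ C % 16 = 9 ∨
          C % 16 = 11 ∨ C % 16 = 13 ∨ C % 16 = 15) with hc | hc | hc | hc | hc | hc | hc | hc <;>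
          rw [hc] at e <;> omega
      obtain hC' | hC' := hC'
      · exact ⟨(-C - 9) / 16, by rw [show 16 * ((-C - 9) / 16) + 9 = -C by omega]; ring⟩
      · exact ⟨(C - 9) / 16, by rw [show 16 * ((C - 9) / 16) + 9 = C by omega]⟩
    obtain ⟨z, hz⟩ : ∃ z, B ^ 2 = (4 * z + 2 * u + 3) ^ 2 := by
      obtain h | h : (B - 2 * u - 3) % 4 = 0 ∨ (-B - 2 * u - 3) % 4 = 0 := by omega
      · exact ⟨(B - 2 * u - 3) / 4, by
          rw [show 4 * ((B - 2 * u - 3) / 4) + 2 * u + 3 = B by omega]⟩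
      · exact ⟨(-B - 2 * u - 3) / 4, by
          rw [show 4 * ((-B - 2 * u - 3) / 4) + 2 * u + 3 = -B by omega]; ring⟩
    rw [hu, hz] at e
    exact ⟨x, u + 3, z, u, by linarith⟩
  · by_cases h11 : n = 11
    · exact ⟨2, 0, 0, 1, by rw [h11]; norm_num⟩
    obtain ⟨x, C, E, e, hC, hE⟩ : ∃ x C E : ℤ, 4 * n - 47 = 4 * x ^ 2 + C ^ 2 + 4 * E ^ 2 ∧
        C % 2 = 1 ∧ E % 3 ≠ 0 := by
      have key : ∀ C D E : ℤ, 4 * n - 47 = C ^ 2 + D ^ 2 + E ^ 2 → C % 2 = 1 → D % 2 = 0 →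
          E % 2 = 0 → D % 3 ≠ 0 ∨ E % 3 ≠ 0 → ∃ x C E : ℤ, 4 * n - 47 =
          4 * x ^ 2 + C ^ 2 + 4 * E ^ 2 ∧ C % 2 = 1 ∧ E % 3 ≠ 0 := by
        intro C D E e hC hD hE h
        obtain ⟨D, rfl⟩ : ∃ d, D = 2 * d := ⟨D / 2, by omega⟩
        obtain ⟨E, rfl⟩ : ∃ d, E = 2 * d := ⟨E / 2, by omega⟩
        obtain h | h := h
        · exact ⟨E, C, D, by linarith, hC, by omega⟩
        · exact ⟨D, C, E, by linarith, hC, by omega⟩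
      obtain ⟨x, y, z, e, h3'⟩ := (IsSumThreeSq.of_mod (n := 4 * n - 47) (by omega)
        (.inl (by omega))).exists_not_three_dvd (by omega)
      have h3 : (x % 3 ≠ 0 ∨ y % 3 ≠ 0) ∧ (x % 3 ≠ 0 ∨ z % 3 ≠ 0) ∧ (y % 3 ≠ 0 ∨ z % 3 ≠ 0) := by
        have hx := sq_mod_three_power x
        have hy := sq_mod_three_power y
        have hz := sq_mod_three_power z
        omega
      obtain ⟨h1, h2, h⟩ | ⟨h1, h2, h⟩ | ⟨h1, h2, h⟩ :=
        IsSumThreeSq.exists_odd_even_even (by omega) e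
      · exact key x y z e h1 h2 h h3.2.2
      · exact key y x z (by linarith) h1 h2 h h3.2.1
      · exact key z x y (by linarith) h1 h2 h h3.1
    obtain ⟨z, hz⟩ : ∃ z, C ^ 2 = (4 * z + 3) ^ 2 := by
      obtain h | h : C % 4 = 3 ∨ C % 4 = 1 := by omega
      · exact ⟨(C - 3) / 4, by rw [show 4 * ((C - 3) / 4) + 3 = C by omega]⟩
      · exact ⟨(-C - 3) / 4, by rw [show 4 * ((-C - 3) / 4) + 3 = -C by omega]; ring⟩
    obtain ⟨w, hw⟩ : ∃ w, E ^ 2 = (3 * w - 2) ^ 2 := by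
      obtain h | h : E % 3 = 1 ∨ E % 3 = 2 := by omega
      · exact ⟨(E + 2) / 3, by rw [show 3 * ((E + 2) / 3) - 2 = E by omega]⟩
      · exact ⟨(-E + 2) / 3, by rw [show 3 * ((-E + 2) / 3) - 2 = -E by omega]; ring⟩
    rw [hz, hw] at e
    exact ⟨x, 3 - w, z, w, by linarith⟩

theorem exists_two_one_four_inner_two_seven {n : ℤ} (h : n % 4 = 2) (h9 : n % 9 ≠ 0)
    (hn : 14 ≤ n) :
    ∃ x y z w : ℤ, n = x ^ 2 + 2 * y ^ 2 + 2 * y * z + 4 * z ^ 2 + 4 * z * w + 7 * w ^ 2 := by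
  by_cases hs : n = 26 ∨ n = 34 ∨ n = 42
  · obtain rfl | rfl | rfl := hs
    · exact ⟨1, -3, 0, 1, by norm_num⟩
    · exact ⟨2, -1, 0, 2, by norm_num⟩
    · exact ⟨4, 1, -2, 2, by norm_num⟩
  obtain ⟨k, rfl⟩ : ∃ k, n = 2 * k := ⟨n / 2, by omega⟩
  obtain ⟨s, N, hN, hs7, h0, h4⟩ : ∃ s N : ℤ, N = 7 * k - 41 * s ^ 2 ∧ s % 7 ≠ 0 ∧ 0 < N ∧
      (N % 4 = 0 ∨ N % 4 = 3) := by
    obtain h | h : k % 4 = 3 ∨ k % 4 = 1 := by omega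
    · exact ⟨1, _, rfl, by omega, by omega, by omega⟩
    · exact ⟨2, _, rfl, by omega, by omega, by omega⟩
  have hs' := sq_mod_seven s
  obtain ⟨X, y, z, e⟩ : ∃ x y z, N = 7 * x ^ 2 + (y ^ 2 + y * z + 2 * z ^ 2) := by
    obtain ⟨X, c, d, e⟩ := exists_seven (n := 7 * N) (by omega) (by omega)
    obtain ⟨j, hj⟩ := norm_emod_seven c d
    have hXc : X % 7 = 0 ∧ (c + 4 * d) % 7 = 0 := by
      have hX := sq_mod_seven X
      have hc := sq_mod_seven (c + 4 * d)
      rw [hj] at e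
      clear hs' hN hs h h9
      rcases hX with hX | hX | hX | hX <;> rcases hc with hc | hc | hc | hc <;> omega
    obtain ⟨x, rfl⟩ : ∃ x, X = 7 * x := ⟨X / 7, by omega⟩
    obtain ⟨y, hy⟩ : ∃ y, c + 4 * d = 7 * y := ⟨(c + 4 * d) / 7, by omega⟩
    exact ⟨x, y, d - 2 * y, by linarith [exists_norm_div_seven hy]⟩
  obtain ⟨W, x, y, e⟩ : ∃ W x y, 2 * N = 14 * y ^ 2 + 7 * x ^ 2 + W ^ 2 := by
    obtain h2 | h2 := Int.emod_two_eq_zero_or_one (y ^ 2 + y * z + 2 * z ^ 2)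
    · obtain ⟨c, d, h2⟩ := exists_eq_two_mul_of_even_norm h2
      exact ⟨2 * c + d, d, X, by linarith⟩
    · obtain ⟨p, q, hpq⟩ := exists_eq_sq_add_seven_mul_sq_of_odd_norm h2
      rw [hpq] at e h2
      obtain ⟨c, d, h2⟩ := exists_eq_two_mul_of_even_sq_add (p := p) (q := X) (by
        have hX := sq_mod_two_power X
        have hp := sq_mod_two_power p
        have hq := sq_mod_two_power q
        clear hpq hs' hN hs h h9
        rcases hX with hX | hX | hX <;> rcases hp with hp | hp | hp <;>
          rcases hq with hq | hq | hq <;> omega)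
      exact ⟨2 * c + d, d, q, by linarith⟩
  obtain ⟨w, hw⟩ : ∃ w, W ^ 2 = (7 * w + 4 * s) ^ 2 := by
    have hW := sq_mod_seven W
    obtain h | h : (W - 4 * s) % 7 = 0 ∨ (-W - 4 * s) % 7 = 0 := by
      clear hs h9 h h4
      rcases hW with hW | hW | hW | hW <;> rcases hs' with hs | hs | hs | hs <;> omega
    · exact ⟨(W - 4 * s) / 7, by rw [show 7 * ((W - 4 * s) / 7) + 4 * s = W by omega]⟩
    · exact ⟨(-W - 4 * s) / 7, by rw [show 7 * ((-W - 4 * s) / 7) + 4 * s = -W by omega]; ring⟩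
  rw [hw] at e
  exact ⟨x, y - s, 2 * s, w, by linarith⟩

theorem exists_two_one_four_inner_one_zero_seven {n : ℤ} (h : n % 4 = 2) :
    0 < n → ∃ x y z w : ℤ, n = x ^ 2 + 2 * y ^ 2 + 2 * y * z + 4 * z ^ 2 + 2 * y * w + 7 * w ^ 2 := by
  intro hn
  by_cases h16 : n % 16 = 14
  · obtain ⟨k, rfl⟩ : ∃ k, n = 2 * k + 10 := ⟨(n - 10) / 2, by omega⟩
    obtain ⟨A, p, q, e, h⟩ := (IsSumThreeSq.of_mod (n := k) (by omega)
      (by omega)).exists_sub_one_mod_three (by omega)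
    obtain ⟨w, rfl⟩ : ∃ w, p = q - 3 * w - 2 := ⟨(q - p - 2) / 3, by omega⟩
    exact ⟨2 * q - 3 * w - 2, A - w - 1, w + 2, w, by linarith⟩
  · obtain ⟨k, rfl⟩ : ∃ k, n = 2 * k := ⟨n / 2, by omega⟩
    obtain ⟨A, p, q, e, h⟩ := (IsSumThreeSq.of_mod (n := k) (by omega)
      (by omega)).exists_congr_mod_three
    obtain ⟨u, rfl⟩ : ∃ u, p = q + 3 * u := ⟨(p - q) / 3, by omega⟩
    exact ⟨2 * q + 3 * u, A - u, u, u, by linarith⟩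

theorem exists_two_one_four_of_mod_four_eq_one {n b c m : ℤ} (hn : 0 < n) (h1 : n % 4 = 1)
    (h7 : n % 7 = 0 → 27 ≤ n) (hbc : (4 * b - c) % 7 ≠ 0)
    (hκ : 7 * m - 2 * (c ^ 2 - b * c + 2 * b ^ 2) ≤ 47) :
    ∃ x y z w, n = x ^ 2 + 2 * y ^ 2 + 2 * y * z + 4 * z ^ 2 + 2 * b * y * w + 2 * c * z * w +
      m * w ^ 2 := by
  by_cases h : n % 7 = 0
  · obtain ⟨x, y, z, e⟩ := exists_two_one_four_coset (n := n) (b := b) (c := c) (m := m) (w := 2) rfl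
      (by have := h7 h; omega) (.inr (by omega)) (by omega)
    exact ⟨x, y, z, 2, e⟩
  · obtain ⟨x, y, z, e⟩ := exists_two_one_four hn (.inr h1) (.inl h)
    exact ⟨x, y, z, 0, by linarith⟩

section

variable {R : ℤ → Prop} (hR : CriticalValues R)

include hR

theorem universal_two_one_four_orthogonal {m : ℤ}
    (hT : ∀ n x y z w, n = x ^ 2 + 2 * y ^ 2 + 2 * y * z + 4 * z ^ 2 + m * w ^ 2 → R n)
    (hm : m = 6 ∨ m = 7) : ∀ n, 0 < n → R n := by
  refine hR.of_squarefree fun n hn h4 h9 h25 h49 ↦ ?_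
  by_cases hs : n < 9
  · exact hR.critical n (by omega)
  obtain rfl | rfl := hm
  · by_cases h21 : n = 21
    · exact hT n 1 (-1) 2 1 (by rw [h21]; norm_num)
    have key : ∀ w N, N = n - 6 * w ^ 2 → 0 < N → N % 4 = 0 ∨ N % 4 = 1 →
        N % 7 ≠ 0 ∨ N % 49 = 7 ∨ N % 49 = 14 ∨ N % 49 = 28 → R n := by
      intro w N hN h0 h4 h7
      obtain ⟨x, y, z, e⟩ := exists_two_one_four h0 h4 h7
      exact hT n x y z w (by linarith)
    by_cases h1 : n % 4 = 1
    · by_cases h7 : n % 7 = 0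
      · exact key 2 _ rfl (by omega) (by omega) (by omega)
      · exact key 0 _ rfl (by omega) (by omega) (by omega)
    · by_cases h7 : n % 7 = 6
      · obtain ⟨k, rfl⟩ : ∃ k, n = 7 * k + 6 := ⟨n / 7, by omega⟩
        by_cases hk : k < 7
        · have hk0 : 0 < k := by omega
          obtain rfl : k = 4 := by interval_cases k <;> omega
          exact key 1 _ rfl (by omega) (by omega) (by omega)
        · have h4' : k % 4 = 0 ∨ k % 4 = 3 := by
            rcases (by omega : k % 4 = 0 ∨ k % 4 = 1 ∨ k % 4 = 2 ∨ k % 4 = 3) with h | h | h | h <;>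
              omega
          exact key 3 _ rfl (by omega) (by omega) (by omega)
      · exact key 1 _ rfl (by omega) (by omega) (by omega)
  · by_cases h7 : n % 7 = 0
    · obtain ⟨k, rfl⟩ : ∃ k, n = 7 * k := ⟨n / 7, by omega⟩
      by_cases h3 : k = 3
      · exact hT _ 0 (-1) 2 1 (by rw [h3]; norm_num)
      obtain ⟨x, y, z, w, e⟩ :=
        exists_two_one_four_orthogonal_seven (n := k) (by omega) (by omega) (by omega) h3
      exact hT _ (7 * w) (-y - 4 * z) (2 * y + z) x (by rw [e]; ring)
    · obtain ⟨x, y, z, w, e⟩ := exists_two_one_four_orthogonal_seven hn h4 h7 (by omega)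
      exact hT _ x y z w e

theorem universal_two_one_four_coset {b c m : ℤ} (hbc : (4 * b - c) % 7 ≠ 0)
    (hκ : 7 * m - 2 * (c ^ 2 - b * c + 2 * b ^ 2) ≤ 47)
    (hT : ∀ n x y z w, n = x ^ 2 + 2 * y ^ 2 + 2 * y * z + 4 * z ^ 2 + 2 * b * y * w +
      2 * c * z * w + m * w ^ 2 → R n)
    (h21 : R 21)
    (h : ∀ n, 11 ≤ n → n ≠ 15 → n % 9 ≠ 0 → n % 4 = 2 ∨ n % 4 = 3 →
      (let N := 7 * n - (7 * m - 2 * (c ^ 2 - b * c + 2 * b ^ 2)); N % 4 = 0 ∨ N % 4 = 3) ∨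
      (IsSumThreeSq (3 * n) → R n)) : ∀ n, 0 < n → R n := by
  refine hR.of_squarefree fun n hn h4 h9 h25 h49 ↦ ?_
  by_cases hs : n < 9 ∨ n = 10 ∨ n = 15
  · exact hR.critical n (by omega)
  by_cases hn21 : n = 21
  · exact hn21 ▸ h21
  by_cases h1 : n % 4 = 1
  · obtain ⟨x, y, z, w, e⟩ := exists_two_one_four_of_mod_four_eq_one hn h1 (by omega) hbc hκ
    exact hT n x y z w e
  obtain h | h := h n (by omega) (by omega) h9 (by omega)
  · obtain ⟨x, y, z, e⟩ := exists_two_one_four_coset (n := n) (b := b) (c := c) (m := m) (w := 1)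
      rfl (by omega) (by simpa using h) (by simpa using hbc)
    exact hT n x y z 1 e
  · have h3 : (3 * n) % 4 = 1 ∨ (3 * n) % 4 = 2 := by
      clear hs h9 h25 h49 hbc hκ
      omega
    exact h (IsSumThreeSq.of_mod (by omega) (by tauto))

theorem universal_two_one_four_inner_zero_one {m : ℤ}
    (hT : ∀ n x y z w, n = x ^ 2 + 2 * y ^ 2 + 2 * y * z + 4 * z ^ 2 + 2 * z * w + m * w ^ 2 → R n)
    (hm : m = 6 ∨ m = 7) : ∀ n, 0 < n → R n := by
  obtain rfl | rfl := hm
  · refine universal_two_one_four_coset hR (b := 0) (c := 1) (m := 6) (by norm_num) (by norm_num)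
      (fun n x y z w e ↦ hT n x y z w (by linarith)) (hT _ 3 0 1 1 (by norm_num))
      fun n _ _ _ _ ↦ .inr fun h ↦ ?_
    obtain ⟨x, y, w, e⟩ := h.one_two_six
    exact hT n x y 0 w (by linarith)
  · refine universal_two_one_four_coset hR (b := 0) (c := 1) (m := 7) (by norm_num) (by norm_num)
      (fun n x y z w e ↦ hT n x y z w (by linarith)) (hT _ 0 (-2) (-1) 1 (by norm_num))
      fun n hn h15 h9 h ↦ ?_
    obtain h | h := h
    · exact .inl (by omega)
    · obtain ⟨x, y, z, w, e⟩ := exists_two_one_four_inner_one_seven h h9 hn h15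
      exact .inr fun _ ↦ hT n x y z w e

theorem universal_two_one_four_inner_zero_two {m : ℤ}
    (hT : ∀ n x y z w, n = x ^ 2 + 2 * y ^ 2 + 2 * y * z + 4 * z ^ 2 + 4 * z * w + m * w ^ 2 → R n)
    (hm : m = 6 ∨ m = 7) : ∀ n, 0 < n → R n := by
  obtain rfl | rfl := hm
  · exact universal_two_one_four_coset hR (b := 0) (c := 2) (m := 6) (by norm_num) (by norm_num)
      (fun n x y z w e ↦ hT n x y z w (by linarith)) (hT _ 1 0 (-1) 2 (by norm_num))
      fun n _ _ _ _ ↦ .inl (by omega)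
  · refine universal_two_one_four_coset hR (b := 0) (c := 2) (m := 7) (by norm_num) (by norm_num)
      (fun n x y z w e ↦ hT n x y z w (by linarith)) (hT _ 0 (-1) (-2) 1 (by norm_num))
      fun n hn h15 h9 h ↦ ?_
    obtain h | h := h
    · obtain ⟨x, y, z, w, e⟩ := exists_two_one_four_inner_two_seven h h9 (by omega)
      exact .inr fun _ ↦ hT n x y z w e
    · exact .inl (by omega)

theorem universal_two_one_four_inner_one_zero {m : ℤ}
    (hT : ∀ n x y z w, n = x ^ 2 + 2 * y ^ 2 + 2 * y * z + 4 * z ^ 2 + 2 * y * w + m * w ^ 2 → R n)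
    (hm : m = 4 ∨ m = 6 ∨ m = 7) : ∀ n, 0 < n → R n := by
  obtain rfl | rfl | rfl := hm
  · refine universal_two_one_four_coset hR (b := 1) (c := 0) (m := 4) (by norm_num) (by norm_num)
      (fun n x y z w e ↦ hT n x y z w (by linarith)) (hT _ 1 0 (-2) 1 (by norm_num))
      fun n _ _ _ _ ↦ .inr fun h ↦ ?_
    obtain ⟨x, y, w, e⟩ := h.one_two_six
    exact hT n x (y - w) w w (by linarith)
  · exact universal_two_one_four_coset hR (b := 1) (c := 0) (m := 6) (by norm_num) (by norm_num)
      (fun n x y z w e ↦ hT n x y z w (by linarith)) (hT _ 3 (-1) (-1) 1 (by norm_num))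
      fun n _ _ _ _ ↦ .inl (by omega)
  · refine universal_two_one_four_coset hR (b := 1) (c := 0) (m := 7) (by norm_num) (by norm_num)
      (fun n x y z w e ↦ hT n x y z w (by linarith)) (hT _ 2 1 1 1 (by norm_num))
      fun n hn h15 h9 h ↦ ?_
    obtain h | h := h
    · obtain ⟨x, y, z, w, e⟩ := exists_two_one_four_inner_one_zero_seven h (by omega)
      exact .inr fun _ ↦ hT n x y z w e
    · exact .inl (by omega)

/-- The hypothesis `hno` deals with the forms that contain a shorter vector, for which an earlier
step of the escalation applies. -/
theorem universal_one_two_four_of_inner_one {b c m : ℤ}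
    (hbc : b = 0 ∧ c = 0 ∨ b = 0 ∧ c = 1 ∨ b = 0 ∧ c = 2 ∨ b = 1 ∧ c = 0)
    (hm : 0 ≤ m)
    (hT : ∀ n x y z w, n = x ^ 2 + 2 * y ^ 2 + 2 * y * z + 4 * z ^ 2 + 2 * b * y * w +
      2 * c * z * w + m * w ^ 2 → R n)
    (hno : ∀ n y z w, n = 2 * y ^ 2 + 2 * y * z + 4 * z ^ 2 + 2 * b * y * w +
      2 * c * z * w + m * w ^ 2 → 2 * y + z + b * w = 0 ∧ 1 ≤ n ∧ n ≤ 5 ∨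
      2 * y + z + b * w = 1 ∧ n = 5 → ∀ k, 0 < k → R k)
    (ht : ∃ x y z : ℤ, 7 = x ^ 2 + 2 * y ^ 2 + 2 * y * z + 4 * z ^ 2 + 2 * b * y + 2 * c * z + m) :
    ∀ n, 0 < n → R n := by
  have hm7 : m ≤ 7 := by
    obtain ⟨x, y, z, e⟩ := ht
    have hx := sq_nonneg x
    have hyz := self_le_sq_int (y + z)
    have hy := self_le_sq_int y
    have hz := self_le_sq_int z
    obtain ⟨rfl, rfl⟩ | ⟨rfl, rfl⟩ | ⟨rfl, rfl⟩ | ⟨rfl, rfl⟩ := hbc <;>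
      nlinarith [sq_nonneg (y + z), sq_nonneg y, sq_nonneg (y + z + 1), sq_nonneg z]
  by_cases hb : b = 0 ∧ 1 ≤ m ∧ m ≤ 5
  · obtain ⟨rfl, h1, h5⟩ := hb
    exact hno m 0 0 1 (by ring) (by simp [h1, h5])
  by_cases hb' : b = 1 ∧ 1 ≤ m ∧ m ≤ 3
  · obtain ⟨rfl, rfl⟩ : b = 1 ∧ c = 0 := by omega
    exact hno (m + 2) (-1) 1 1 (by ring) (.inl (by omega))
  by_cases hb5 : b = 1 ∧ m = 5
  · obtain ⟨rfl, rfl⟩ := hb5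
    exact hno 5 0 0 1 (by ring) (by simp)
  by_cases h0 : m = 0
  · subst h0
    obtain ⟨rfl, rfl⟩ | ⟨rfl, rfl⟩ | ⟨rfl, rfl⟩ | ⟨rfl, rfl⟩ := hbc
    · exfalso
      clear hno hT hb hb' hb5 hm hm7
      obtain ⟨x, y, z, e⟩ := ht
      have e' : 7 = x ^ 2 + y ^ 2 + (y + z) ^ 2 + 3 * z ^ 2 := by linarith
      have hx : x ^ 2 ≤ 7 := by nlinarith [sq_nonneg y, sq_nonneg (y + z), sq_nonneg z]
      have hy : y ^ 2 ≤ 7 := by nlinarith [sq_nonneg x, sq_nonneg (y + z), sq_nonneg z]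
      have hz : z ^ 2 ≤ 3 := by nlinarith [sq_nonneg y, sq_nonneg (y + z), sq_nonneg x]
      obtain ⟨hx1, hx2⟩ : -2 ≤ x ∧ x ≤ 2 := by constructor <;> nlinarith
      obtain ⟨hy1, hy2⟩ : -2 ≤ y ∧ y ≤ 2 := by constructor <;> nlinarith
      obtain ⟨hz1, hz2⟩ : -1 ≤ z ∧ z ≤ 1 := by constructor <;> nlinarith
      clear e hx hy hz
      interval_cases x <;> interval_cases y <;> interval_cases z <;> omega
    · have := hR.nonneg (-4) (hT (-4) 0 0 1 (-4) (by norm_num))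
      omega
    · have := hR.nonneg (-4) (hT (-4) 0 0 1 (-2) (by norm_num))
      omega
    · have := hR.nonneg (-2) (hT (-2) 0 1 0 (-2) (by norm_num))
      omega
  obtain ⟨rfl, rfl⟩ | ⟨rfl, rfl⟩ | ⟨rfl, rfl⟩ | ⟨rfl, rfl⟩ := hbc
  · exact universal_two_one_four_orthogonal hR (fun n x y z w e ↦ hT n x y z w (by linarith))
      (by omega)
  · exact universal_two_one_four_inner_zero_one hR (fun n x y z w e ↦ hT n x y z w (by linarith))
      (by omega)
  · exact universal_two_one_four_inner_zero_two hR (fun n x y z w e ↦ hT n x y z w (by linarith))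
      (by omega)
  · exact universal_two_one_four_inner_one_zero hR (fun n x y z w e ↦ hT n x y z w (by linarith))
      (by omega)
end

/-- Reduction of `a` modulo `p` up to sign. -/
theorem exists_sign_mul_sub_le_half (a : ℤ) {p : ℤ} (hp : 0 < p) :
    ∃ s k : ℤ, (s = 1 ∨ s = -1) ∧ 0 ≤ s * (a - k * p) ∧ 2 * (s * (a - k * p)) ≤ p := by
  have h := Int.mul_ediv_add_emod a p
  have h0 := Int.emod_nonneg a hp.ne'
  have h1 := Int.emod_lt_of_pos a hp
  by_cases hr : 2 * (a % p) ≤ p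
  · have e : a - a / p * p = a % p := by linarith
    exact ⟨1, a / p, .inl rfl, by rw [e]; omega, by rw [e]; omega⟩
  · have e : a - (a / p + 1) * p = a % p - p := by linarith
    exact ⟨-1, a / p + 1, .inr rfl, by rw [e]; omega, by rw [e]; omega⟩

section

variable {V : Type*} [AddCommGroup V] {B : LinearMap.BilinForm ℤ V}
  (hB : ∀ u v, B u v = B v u)

include hB

theorem apply_combination_self (e₁ e₂ e₃ v : V) (x y z w : ℤ) :
    B (x • e₁ + y • e₂ + z • e₃ + w • v) (x • e₁ + y • e₂ + z • e₃ + w • v) =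
      B e₁ e₁ * x ^ 2 + B e₂ e₂ * y ^ 2 + B e₃ e₃ * z ^ 2 + B v v * w ^ 2 +
      2 * B e₁ e₂ * x * y + 2 * B e₁ e₃ * x * z + 2 * B e₁ v * x * w +
      2 * B e₂ e₃ * y * z + 2 * B e₂ v * y * w + 2 * B e₃ v * z * w := by
  simp only [map_add, map_smul, LinearMap.add_apply, LinearMap.smul_apply, smul_eq_mul]
  rw [hB e₂ e₁, hB e₃ e₁, hB e₃ e₂, hB v e₁, hB v e₂, hB v e₃]
  ring

theorem exists_reduced_of_diagonal {e₁ e₂ e₃ v : V} {p q : ℤ} (hp : 0 < p) (hq : 0 < q)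
    (h₁₁ : B e₁ e₁ = 1) (h₁₂ : B e₁ e₂ = 0) (h₁₃ : B e₁ e₃ = 0) (h₂₂ : B e₂ e₂ = p)
    (h₂₃ : B e₂ e₃ = 0) (h₃₃ : B e₃ e₃ = q) :
    ∃ b c m : ℤ, (0 ≤ b ∧ 2 * b ≤ p) ∧ (0 ≤ c ∧ 2 * c ≤ q) ∧ (∃ u, B u u = m) ∧
      (∀ n x y z w, n = x ^ 2 + p * y ^ 2 + q * z ^ 2 + 2 * b * y * w + 2 * c * z * w + m * w ^ 2 →
        ∃ u, B u u = n) ∧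
      ∃ x y z : ℤ, B v v = x ^ 2 + p * y ^ 2 + q * z ^ 2 + 2 * b * y + 2 * c * z + m := by
  obtain ⟨s, k, hs, hb0, hb1⟩ := exists_sign_mul_sub_le_half (B e₂ v) hp
  obtain ⟨t, l, ht, hc0, hc1⟩ := exists_sign_mul_sub_le_half (B e₃ v) hq
  obtain ⟨α, hα⟩ : ∃ α, B e₁ v = α := ⟨_, rfl⟩
  obtain ⟨u, rfl⟩ : ∃ u, v = α • e₁ + k • e₂ + l • e₃ + (1 : ℤ) • u :=
    ⟨v - (α • e₁ + k • e₂ + l • e₃), by simp⟩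
  have h := apply_combination_self hB e₁ e₂ e₃ u
  simp only [map_add, map_smul, smul_eq_mul, hB e₂ e₁, hB e₃ e₁, hB e₃ e₂, h₁₁, h₁₂, h₁₃, h₂₂, h₂₃,
    h₃₃] at hα hb0 hb1 hc0 hc1
  have hu : B e₁ u = 0 := by linarith
  refine ⟨s * B e₂ u, t * B e₃ u, B u u, ⟨?_, ?_⟩, ⟨?_, ?_⟩, ⟨u, rfl⟩, fun n x y z w hn ↦
    ⟨x • e₁ + (s * y) • e₂ + (t * z) • e₃ + w • u, ?_⟩, α, s * k, t * l, ?_⟩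
  · linarith
  · linarith
  · linarith
  · linarith
  · rw [h, hn, h₁₁, h₁₂, h₁₃, h₂₂, h₂₃, h₃₃, hu]
    obtain rfl | rfl := hs <;> obtain rfl | rfl := ht <;> ring
  · rw [h, h₁₁, h₁₂, h₁₃, h₂₂, h₂₃, h₃₃, hu]
    obtain rfl | rfl := hs <;> obtain rfl | rfl := ht <;> ring

theorem exists_reduced_of_inner_one {e₁ e₂ e₃ v : V} {q s b c z : ℤ} (hs : s = 1 ∨ s = -1)
    (h₁₁ : B e₁ e₁ = 1) (h₁₂ : B e₁ e₂ = 0) (h₁₃ : B e₁ e₃ = 0) (h₂₂ : B e₂ e₂ = 2)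
    (h₂₃ : B e₂ e₃ = 1) (h₃₃ : B e₃ e₃ = q)
    (hz : B e₂ v - 2 * B e₃ v - s * (b - 2 * c) = -(2 * q - 1) * z) :
    ∃ u, B e₁ u = 0 ∧ B e₂ u = b ∧ B e₃ u = c ∧
      (∃ x y z : ℤ, B v v = x ^ 2 + 2 * y ^ 2 + 2 * y * z + q * z ^ 2 + 2 * b * y + 2 * c * z +
        B u u) := by
  obtain ⟨α, hα⟩ : ∃ α, B e₁ v = α := ⟨_, rfl⟩
  obtain ⟨y, hy⟩ : ∃ y, B e₃ v = y + q * z + s * c := ⟨B e₃ v - q * z - s * c, by ring⟩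
  obtain ⟨u, rfl⟩ : ∃ u, v = α • e₁ + y • e₂ + z • e₃ + s • u :=
    ⟨s • (v - (α • e₁ + y • e₂ + z • e₃)), by obtain rfl | rfl := hs <;> simp⟩
  have h := apply_combination_self hB e₁ e₂ e₃ u
  simp only [map_add, map_smul, smul_eq_mul, hB e₂ e₁, hB e₃ e₁, hB e₃ e₂, h₁₁, h₁₂, h₁₃, h₂₂, h₂₃,
    h₃₃] at hα hy hz
  have hu₁ : B e₁ u = 0 := by obtain rfl | rfl := hs <;> linarith
  have hu₃ : B e₃ u = c := by obtain rfl | rfl := hs <;> linarith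
  have hu₂ : B e₂ u = b := by obtain rfl | rfl := hs <;> linarith
  refine ⟨u, hu₁, hu₂, hu₃, s * α, s * y, s * z, ?_⟩
  rw [h, h₁₁, h₁₂, h₁₃, h₂₂, h₂₃, h₃₃, hu₁, hu₂, hu₃]
  obtain rfl | rfl := hs <;> ring

variable (hR : CriticalValues fun n ↦ ∃ v, B v v = n)

include hR

theorem universal_of_gram_one_one {e₁ e₂ : V} (h₁₁ : B e₁ e₁ = 1) (h₁₂ : B e₁ e₂ = 0)
    (h₂₂ : B e₂ e₂ = 1) : ∀ n, 0 < n → ∃ v, B v v = n := by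
  obtain ⟨v, hv⟩ := hR.critical 3 (by norm_num)
  obtain ⟨α, hα⟩ : ∃ α, B e₁ v = α := ⟨_, rfl⟩
  obtain ⟨β, hβ⟩ : ∃ β, B e₂ v = β := ⟨_, rfl⟩
  obtain ⟨e₃, rfl⟩ : ∃ u, v = α • e₁ + β • e₂ + (0 : ℤ) • e₁ + (1 : ℤ) • u :=
    ⟨v - (α • e₁ + β • e₂), by simp⟩
  have h := apply_combination_self hB e₁ e₂ e₁ e₃ α β 0 1
  simp only [map_add, map_smul, smul_eq_mul, hB e₂ e₁, h₁₁, h₁₂, h₂₂] at hα hβ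
  have h₁₃ : B e₁ e₃ = 0 := by linarith
  have h₂₃ : B e₂ e₃ = 0 := by linarith
  rw [hv, h₁₁, h₁₂, h₁₃, h₂₂, h₂₃] at h
  obtain ⟨c, hc⟩ : ∃ c, B e₃ e₃ = c := ⟨_, rfl⟩
  rw [hc] at h
  have hc0 := hR.nonneg c ⟨_, hc⟩
  have hc' : c = 1 ∨ c = 2 ∨ c = 3 := by
    have hα := sq_mod_two_power α
    have hβ := sq_mod_two_power β
    have := sq_nonneg α
    have := sq_nonneg β
    omega
  obtain rfl | rfl | rfl := hc'
  · obtain ⟨v, hv⟩ := hR.critical 7 (by norm_num)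
    obtain ⟨b, c, m, hb, hc, hm, hT, x, y, z, ht⟩ := exists_reduced_of_diagonal hB (v := v)
      (by norm_num) (by norm_num) h₁₁ h₁₂ h₁₃ h₂₂ h₂₃ hc
    obtain rfl : b = 0 := by omega
    obtain rfl : c = 0 := by omega
    exact universal_one_one_one hR (hR.nonneg m hm)
      (fun n x y z w e ↦ hT n x y z w (by linarith)) ⟨x, y, z, by linarith⟩
  · obtain ⟨v, hv⟩ := hR.critical 14 (by norm_num)
    obtain ⟨b, c, m, hb, hc, hm, hT, x, y, z, ht⟩ := exists_reduced_of_diagonal hB (v := v)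
      (by norm_num) (by norm_num) h₁₁ h₁₂ h₁₃ h₂₂ h₂₃ hc
    obtain rfl : b = 0 := by omega
    exact universal_one_one_two hR hc.1 (by omega) (hR.nonneg m hm)
      (fun n x y z w e ↦ hT n x y z w (by linarith)) ⟨x, y, z, by linarith⟩
  · obtain ⟨v, hv⟩ := hR.critical 6 (by norm_num)
    obtain ⟨b, c, m, hb, hc, hm, hT, x, y, z, ht⟩ := exists_reduced_of_diagonal hB (v := v)
      (by norm_num) (by norm_num) h₁₁ h₁₂ h₁₃ h₂₂ h₂₃ hc
    obtain rfl : b = 0 := by omega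
    exact universal_one_one_three hR hc.1 (by omega) (hR.nonneg m hm)
      (fun n x y z w e ↦ hT n x y z w (by linarith)) ⟨x, y, z, by linarith⟩

theorem universal_of_gram_one_two_diagonal {e₁ e₂ e₃ : V} {q : ℤ} (hq : 1 ≤ q ∧ q ≤ 5)
    (h₁₁ : B e₁ e₁ = 1) (h₁₂ : B e₁ e₂ = 0) (h₁₃ : B e₁ e₃ = 0) (h₂₂ : B e₂ e₂ = 2)
    (h₂₃ : B e₂ e₃ = 0) (h₃₃ : B e₃ e₃ = q) : ∀ n, 0 < n → ∃ v, B v v = n := by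
  have key (v : V) := exists_reduced_of_diagonal hB (v := v) (by norm_num) (by omega)
    h₁₁ h₁₂ h₁₃ h₂₂ h₂₃ h₃₃
  obtain rfl | rfl | rfl | rfl | rfl : q = 1 ∨ q = 2 ∨ q = 3 ∨ q = 4 ∨ q = 5 := by omega
  · exact universal_of_gram_one_one hB hR h₁₁ h₁₃ h₃₃
  · obtain ⟨v, hv⟩ := hR.critical 7 (by norm_num)
    obtain ⟨b, c, m, hb, hc, hm, hT, x, y, z, ht⟩ := key v
    exact universal_one_two_two hR hb.1 (by omega) hc.1 (by omega) (hR.nonneg m hm) hT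
      ⟨x, y, z, by linarith⟩
  · obtain ⟨v, hv⟩ := hR.critical 10 (by norm_num)
    obtain ⟨b, c, m, hb, hc, hm, hT, x, y, z, ht⟩ := key v
    exact universal_one_two_three hR hb.1 (by omega) hc.1 (by omega) (hR.nonneg m hm) hT
      ⟨x, y, z, by linarith⟩
  · obtain ⟨v, hv⟩ := hR.critical 14 (by norm_num)
    obtain ⟨b, c, m, hb, hc, hm, hT, x, y, z, ht⟩ := key v
    exact universal_one_two_four hR hb.1 (by omega) hc.1 (by omega) (hR.nonneg m hm) hT
      ⟨x, y, z, by linarith⟩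
  · obtain ⟨v, hv⟩ := hR.critical 10 (by norm_num)
    obtain ⟨b, c, m, hb, hc, hm, hT, x, y, z, ht⟩ := key v
    exact universal_one_two_five hR hb.1 (by omega) hc.1 (by omega) (hR.nonneg m hm) hT
      ⟨x, y, z, by linarith⟩

theorem universal_of_gram_two_one_five {e₁ e₂ e₃ : V} (h₁₁ : B e₁ e₁ = 1) (h₁₂ : B e₁ e₂ = 0)
    (h₁₃ : B e₁ e₃ = 0) (h₂₂ : B e₂ e₂ = 2) (h₂₃ : B e₂ e₃ = 1) (h₃₃ : B e₃ e₃ = 5) :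
    ∀ n, 0 < n → ∃ v, B v v = n := by
  obtain ⟨v, hv⟩ := hR.critical 7 (by norm_num)
  obtain ⟨s, b, c, z, hs, hbc, hz⟩ : ∃ s b c z : ℤ, (s = 1 ∨ s = -1) ∧
      (b = 0 ∧ c = 0 ∨ b = 0 ∧ c = 1 ∨ b = 0 ∧ c = 2 ∨ b = 1 ∧ c = -1 ∨ b = 1 ∧ c = 0) ∧
      B e₂ v - 2 * B e₃ v - s * (b - 2 * c) = -(2 * 5 - 1) * z := by
    obtain ⟨t, ht⟩ : ∃ t, B e₂ v - 2 * B e₃ v = t := ⟨_, rfl⟩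
    rw [ht]
    have key : ∀ s b c : ℤ, (s = 1 ∨ s = -1) →
        (b = 0 ∧ c = 0 ∨ b = 0 ∧ c = 1 ∨ b = 0 ∧ c = 2 ∨ b = 1 ∧ c = -1 ∨ b = 1 ∧ c = 0) →
        (t - s * (b - 2 * c)) % 9 = 0 → ∃ s b c z : ℤ, (s = 1 ∨ s = -1) ∧
      (b = 0 ∧ c = 0 ∨ b = 0 ∧ c = 1 ∨ b = 0 ∧ c = 2 ∨ b = 1 ∧ c = -1 ∨ b = 1 ∧ c = 0) ∧
      t - s * (b - 2 * c) = -(2 * 5 - 1) * z :=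
      fun s b c hs hbc h ↦ ⟨s, b, c, -((t - s * (b - 2 * c)) / 9), hs, hbc, by omega⟩
    rcases (by omega : t % 9 = 0 ∨ t % 9 = 1 ∨ t % 9 = 2 ∨ t % 9 = 3 ∨ t % 9 = 4 ∨ t % 9 = 5 ∨
      t % 9 = 6 ∨ t % 9 = 7 ∨ t % 9 = 8) with h | h | h | h | h | h | h | h | h
    · exact key 1 0 0 (by simp) (by simp) (by omega)
    · exact key 1 1 0 (by simp) (by simp) (by omega)
    · exact key (-1) 0 1 (by simp) (by simp) (by omega)
    · exact key 1 1 (-1) (by simp) (by simp) (by omega)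
    · exact key (-1) 0 2 (by simp) (by simp) (by omega)
    · exact key 1 0 2 (by simp) (by simp) (by omega)
    · exact key (-1) 1 (-1) (by simp) (by simp) (by omega)
    · exact key 1 0 1 (by simp) (by simp) (by omega)
    · exact key (-1) 1 0 (by simp) (by simp) (by omega)
  obtain ⟨u, hu₁, hu₂, hu₃, x, y, z, ht⟩ :=
    exists_reduced_of_inner_one hB hs h₁₁ h₁₂ h₁₃ h₂₂ h₂₃ h₃₃ hz
  refine universal_one_two_five_of_inner_one hR hbc (hR.nonneg (B u u) ⟨u, rfl⟩)
    (fun n x y z w e ↦ ⟨x • e₁ + y • e₂ + z • e₃ + w • u, ?_⟩) ⟨x, y, z, by linarith⟩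
  rw [apply_combination_self hB, h₁₁, h₁₂, h₁₃, h₂₂, h₂₃, h₃₃, hu₁, hu₂, hu₃]
  linarith

theorem universal_of_gram_two_one_four {e₁ e₂ e₃ : V} (h₁₁ : B e₁ e₁ = 1) (h₁₂ : B e₁ e₂ = 0)
    (h₁₃ : B e₁ e₃ = 0) (h₂₂ : B e₂ e₂ = 2) (h₂₃ : B e₂ e₃ = 1) (h₃₃ : B e₃ e₃ = 4) :
    ∀ n, 0 < n → ∃ v, B v v = n := by
  obtain ⟨v, hv⟩ := hR.critical 7 (by norm_num)
  obtain ⟨s, b, c, z, hs, hbc, hz⟩ : ∃ s b c z : ℤ, (s = 1 ∨ s = -1) ∧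
      (b = 0 ∧ c = 0 ∨ b = 0 ∧ c = 1 ∨ b = 0 ∧ c = 2 ∨ b = 1 ∧ c = 0) ∧
      B e₂ v - 2 * B e₃ v - s * (b - 2 * c) = -(2 * 4 - 1) * z := by
    obtain ⟨t, ht⟩ : ∃ t, B e₂ v - 2 * B e₃ v = t := ⟨_, rfl⟩
    rw [ht]
    have key : ∀ s b c : ℤ, (s = 1 ∨ s = -1) →
        (b = 0 ∧ c = 0 ∨ b = 0 ∧ c = 1 ∨ b = 0 ∧ c = 2 ∨ b = 1 ∧ c = 0) →
        (t - s * (b - 2 * c)) % 7 = 0 → ∃ s b c z : ℤ, (s = 1 ∨ s = -1) ∧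
      (b = 0 ∧ c = 0 ∨ b = 0 ∧ c = 1 ∨ b = 0 ∧ c = 2 ∨ b = 1 ∧ c = 0) ∧
      t - s * (b - 2 * c) = -(2 * 4 - 1) * z :=
      fun s b c hs hbc h ↦ ⟨s, b, c, -((t - s * (b - 2 * c)) / 7), hs, hbc, by omega⟩
    rcases (by omega : t % 7 = 0 ∨ t % 7 = 1 ∨ t % 7 = 2 ∨ t % 7 = 3 ∨ t % 7 = 4 ∨ t % 7 = 5 ∨
      t % 7 = 6) with h | h | h | h | h | h | h
    · exact key 1 0 0 (by simp) (by simp) (by omega)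
    · exact key 1 1 0 (by simp) (by simp) (by omega)
    · exact key (-1) 0 1 (by simp) (by simp) (by omega)
    · exact key 1 0 2 (by simp) (by simp) (by omega)
    · exact key (-1) 0 2 (by simp) (by simp) (by omega)
    · exact key 1 0 1 (by simp) (by simp) (by omega)
    · exact key (-1) 1 0 (by simp) (by simp) (by omega)
  obtain ⟨u, hu₁, hu₂, hu₃, x, y, z, ht⟩ :=
    exists_reduced_of_inner_one hB hs h₁₁ h₁₂ h₁₃ h₂₂ h₂₃ h₃₃ hz
  have hf : ∀ n x y z w, n = x ^ 2 + 2 * y ^ 2 + 2 * y * z + 4 * z ^ 2 + 2 * b * y * w +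
      2 * c * z * w + B u u * w ^ 2 →
      B (x • e₁ + y • e₂ + z • e₃ + w • u) (x • e₁ + y • e₂ + z • e₃ + w • u) = n := by
    intro n x y z w e
    rw [apply_combination_self hB, h₁₁, h₁₂, h₁₃, h₂₂, h₂₃, h₃₃, hu₁, hu₂, hu₃]
    linarith
  refine universal_one_two_four_of_inner_one hR hbc (hR.nonneg (B u u) ⟨u, rfl⟩)
    (fun n x y z w e ↦ ⟨_, hf n x y z w e⟩) (fun n y z w e h ↦ ?_) ⟨x, y, z, by linarith⟩
  have hf' := hf n 0 y z w (by rw [e]; ring)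
  have hf₁ : B e₁ ((0 : ℤ) • e₁ + y • e₂ + z • e₃ + w • u) = 0 := by
    simp [h₁₂, h₁₃, hu₁]
  have hf₂ : B e₂ ((0 : ℤ) • e₁ + y • e₂ + z • e₃ + w • u) = 2 * y + z + b * w := by
    simp only [map_add, map_smul, smul_eq_mul, hB e₂ e₁, h₁₂, h₂₂, h₂₃, hu₂]
    ring
  obtain ⟨h, hn⟩ | ⟨h, rfl⟩ := h
  · exact universal_of_gram_one_two_diagonal hB hR hn h₁₁ h₁₂ hf₁ h₂₂ (hf₂.trans h) hf'
  · exact universal_of_gram_two_one_five hB hR h₁₁ h₁₂ hf₁ h₂₂ (hf₂.trans h) hf'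

theorem universal_of_gram_one_two {e₁ e₂ : V} (h₁₁ : B e₁ e₁ = 1) (h₁₂ : B e₁ e₂ = 0)
    (h₂₂ : B e₂ e₂ = 2) : ∀ n, 0 < n → ∃ v, B v v = n := by
  obtain ⟨v, hv⟩ := hR.critical 5 (by norm_num)
  obtain ⟨α, hα⟩ : ∃ α, B e₁ v = α := ⟨_, rfl⟩
  obtain ⟨s, k, hs, hb0, hb1⟩ := exists_sign_mul_sub_le_half (B e₂ v) (p := 2) (by norm_num)
  obtain ⟨u, rfl⟩ : ∃ u, v = α • e₁ + k • e₂ + (0 : ℤ) • e₁ + s • u :=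
    ⟨s • (v - (α • e₁ + k • e₂)), by obtain rfl | rfl := hs <;> simp⟩
  have h := apply_combination_self hB e₁ e₂ e₁ u α k 0 s
  simp only [map_add, map_smul, smul_eq_mul, hB e₂ e₁, h₁₁, h₁₂, h₂₂] at hα hb0 hb1
  have h₁₃ : B e₁ u = 0 := by obtain rfl | rfl := hs <;> linarith
  obtain ⟨b, hb⟩ : ∃ b, B e₂ u = b := ⟨_, rfl⟩
  obtain ⟨m, hm⟩ : ∃ m, B u u = m := ⟨_, rfl⟩
  have hm0 := hR.nonneg m ⟨u, hm⟩
  rw [hv, h₁₁, h₁₂, h₁₃, h₂₂, hb, hm] at h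
  obtain ⟨β, h⟩ : ∃ β, 5 = α ^ 2 + 2 * β ^ 2 + 2 * b * β + m :=
    ⟨s * k, by obtain rfl | rfl := hs <;> linarith⟩
  have hb01 : b = 0 ∨ b = 1 := by
    rw [hb] at hb0 hb1
    obtain rfl | rfl := hs <;> omega
  have hα' := sq_mod_two_power α
  have hα0 := sq_nonneg α
  obtain rfl | rfl := hb01
  · refine universal_of_gram_one_two_diagonal hB hR ?_ h₁₁ h₁₂ h₁₃ h₂₂ hb hm
    have hβ' := sq_mod_two_power β
    have hβ0 := sq_nonneg β
    have hm' : m ≠ 0 := by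
      rintro rfl
      omega
    omega
  · obtain ⟨j, hj⟩ := exists_sq_add_self β
    have hβ := self_le_sq_int β
    obtain rfl | rfl | rfl | rfl : m = 0 ∨ m = 1 ∨ m = 4 ∨ m = 5 := by omega
    · have h := hR.nonneg _ ⟨_, apply_combination_self hB e₁ e₂ e₁ u 0 1 0 (-2)⟩
      rw [h₁₁, h₂₂, hb, hm] at h
      norm_num at h
    · exact universal_of_gram_one_one hB hR h₁₁ h₁₃ hm
    · exact universal_of_gram_two_one_four hB hR h₁₁ h₁₂ h₁₃ h₂₂ hb hm
    · exact universal_of_gram_two_one_five hB hR h₁₁ h₁₂ h₁₃ h₂₂ hb hm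

theorem universal_of_criticalValues : ∀ n, 0 < n → ∃ v, B v v = n := by
  obtain ⟨e₁, h₁₁⟩ := hR.critical 1 (by norm_num)
  obtain ⟨v, hv⟩ := hR.critical 2 (by norm_num)
  obtain ⟨α, hα⟩ : ∃ α, B e₁ v = α := ⟨_, rfl⟩
  obtain ⟨u, rfl⟩ : ∃ u, v = α • e₁ + (0 : ℤ) • e₁ + (0 : ℤ) • e₁ + (1 : ℤ) • u :=
    ⟨v - α • e₁, by simp⟩
  have h := apply_combination_self hB e₁ e₁ e₁ u α 0 0 1
  simp only [map_add, map_smul, smul_eq_mul, h₁₁] at hα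
  have h₁₂ : B e₁ u = 0 := by linarith
  rw [hv, h₁₁, h₁₂] at h
  obtain ⟨m, hm⟩ : ∃ m, B u u = m := ⟨_, rfl⟩
  rw [hm] at h
  have hm0 := hR.nonneg m ⟨_, hm⟩
  have hα' := sq_mod_two_power α
  have hα0 := sq_nonneg α
  obtain rfl | rfl : m = 1 ∨ m = 2 := by omega
  · exact universal_of_gram_one_one hB hR h₁₁ h₁₂ hm
  · exact universal_of_gram_one_two hB hR h₁₁ h₁₂ hm
end

/-- The symmetric bilinear form polarizing `∑_{i ≤ j} a i j * x i * x j` when the off-diagonal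
coefficients are even. -/
def classicalBilinForm {r : ℕ} (a : Fin r → Fin r → ℤ) : LinearMap.BilinForm ℤ (Fin r → ℤ) :=
  LinearMap.mk₂ ℤ
    (fun x y ↦ ∑ i, ∑ j, if i = j then a i i * x i * y i else
      if i ≤ j then a i j / 2 * (x i * y j + x j * y i) else 0)
    (fun x x' y ↦ by
      simp only [← Finset.sum_add_distrib, Pi.add_apply]
      refine Finset.sum_congr rfl fun i _ ↦ Finset.sum_congr rfl fun j _ ↦ ?_
      split_ifs <;> ring)
    (fun c x y ↦ by
      simp only [Pi.smul_apply, smul_eq_mul, Finset.mul_sum]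
      refine Finset.sum_congr rfl fun i _ ↦ Finset.sum_congr rfl fun j _ ↦ ?_
      split_ifs <;> ring)
    (fun x y y' ↦ by
      simp only [← Finset.sum_add_distrib, Pi.add_apply]
      refine Finset.sum_congr rfl fun i _ ↦ Finset.sum_congr rfl fun j _ ↦ ?_
      split_ifs <;> ring)
    (fun c x y ↦ by
      simp only [Pi.smul_apply, smul_eq_mul, Finset.mul_sum]
      refine Finset.sum_congr rfl fun i _ ↦ Finset.sum_congr rfl fun j _ ↦ ?_
      split_ifs <;> ring)

theorem classicalBilinForm_comm {r : ℕ} (a : Fin r → Fin r → ℤ) (x y : Fin r → ℤ) :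
    classicalBilinForm a x y = classicalBilinForm a y x := by
  simp only [classicalBilinForm, LinearMap.mk₂_apply]
  refine Finset.sum_congr rfl fun i _ ↦ Finset.sum_congr rfl fun j _ ↦ ?_
  split_ifs <;> ring

theorem classicalBilinForm_self {r : ℕ} {a : Fin r → Fin r → ℤ} (ha : ∀ i j, i ≠ j → 2 ∣ a i j)
    (x : Fin r → ℤ) :
    classicalBilinForm a x x = ∑ i, ∑ j, if i ≤ j then a i j * x i * x j else 0 := by
  simp only [classicalBilinForm, LinearMap.mk₂_apply]
  refine Finset.sum_congr rfl fun i _ ↦ Finset.sum_congr rfl fun j _ ↦ ?_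
  by_cases h : i = j
  · subst h
    simp
  · obtain ⟨k, hk⟩ := ha i j h
    rw [if_neg h, hk, Int.mul_ediv_cancel_left _ two_ne_zero]
    split_ifs <;> ring

/-- **The 15-Theorem** (Conway–Schneeberger).
`Q` is a quadratic form in `r` variables with integer coefficients `a i j` (for `i ≤ j`),
assumed positive definite and classical (off-diagonal coefficients even).
If `Q` represents 1, 2, 3, 5, 6, 7, 10, 14 and 15, then `Q` represents every
positive integer. -/
theorem fifteen_theorem (r : ℕ) (a : Fin r → Fin r → ℤ)
    (Q : (Fin r → ℤ) → ℤ)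
    (hQ : ∀ x, Q x = ∑ i, ∑ j, if i ≤ j then a i j * x i * x j else 0)
    (hpos : ∀ x, x ≠ 0 → 0 < Q x)
    (hclassical : ∀ i j, i ≠ j → 2 ∣ a i j)
    (hrep : ∀ n ∈ ({1, 2, 3, 5, 6, 7, 10, 14, 15} : Finset ℤ), ∃ x, Q x = n) :
    ∀ n : ℤ, 0 < n → ∃ x, Q x = n := by
  have hBQ : ∀ x, classicalBilinForm a x x = Q x := fun x ↦ by
    rw [classicalBilinForm_self hclassical, hQ]
  have hR : CriticalValues fun n ↦ ∃ v, classicalBilinForm a v v = n := by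
    refine ⟨?_, ?_, fun n hn ↦ ?_⟩
    · rintro n ⟨v, rfl⟩
      obtain rfl | hv := eq_or_ne v 0
      · simp
      · exact (hBQ v ▸ hpos v hv).le
    · rintro k n ⟨v, rfl⟩
      exact ⟨k • v, by simp only [map_smul, LinearMap.smul_apply, smul_eq_mul]; ring⟩
    · simpa only [hBQ] using hrep n (by simpa using hn)
  simpa only [hBQ] using universal_of_criticalValues (classicalBilinForm_comm a) hR
end

section
/- Let K be a totally real number field of degree d over ℚ. Every totally positive α ∈ O_K^+ with norm N_{K/ℚ}(α) < 2^d is indecomposable. In particular, every totally positive unit of O_K is indecomposable. -/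
open NumberField

/-- The norm of an integer of a totally real field is the product of its real conjugates. -/
theorem norm_eq_prod_real_embeddings (K : Type*) [Field K] [NumberField K]
    (htr : ∀ φ : K →+* ℂ, NumberField.ComplexEmbedding.IsReal φ) (x : 𝓞 K) :
    ((Algebra.norm ℤ x : ℤ) : ℝ) =
      ∏ φ : K →ₐ[ℚ] ℂ, (htr φ.toRingHom).embedding (x : K) := by
  apply Complex.ofReal_injective
  have h := Algebra.norm_eq_prod_embeddings ℚ ℂ (x : K)
  rw [← Algebra.coe_norm_int] at h
  simpa [ComplexEmbedding.IsReal.coe_embedding_apply] using h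

/-- A totally positive integer of a totally real field has norm at least one. -/
theorem one_le_norm_of_totally_positive (K : Type*) [Field K] [NumberField K]
    (htr : ∀ φ : K →+* ℂ, NumberField.ComplexEmbedding.IsReal φ) (x : 𝓞 K)
    (hx : ∀ σ : K →+* ℝ, 0 < σ (x : K)) : 1 ≤ Algebra.norm ℤ x := by
  have h : (0 : ℝ) < ((Algebra.norm ℤ x : ℤ) : ℝ) := by
    rw [norm_eq_prod_real_embeddings K htr]
    exact Finset.prod_pos fun φ _ => hx _
  exact_mod_cast h

/-- A sum of two totally positive integers of a totally real field of degree `d` has norm at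
least `2 ^ d`. -/
theorem two_pow_le_norm_add (K : Type*) [Field K] [NumberField K]
    (htr : ∀ φ : K →+* ℂ, NumberField.ComplexEmbedding.IsReal φ) (β γ : 𝓞 K)
    (hβ : ∀ σ : K →+* ℝ, 0 < σ (β : K)) (hγ : ∀ σ : K →+* ℝ, 0 < σ (γ : K)) :
    2 ^ Module.finrank ℚ K ≤ Algebra.norm ℤ (β + γ) := by
  have hβγ : ∀ σ : K →+* ℝ, 0 < σ ((β + γ : 𝓞 K) : K) := fun σ => by
    simpa using add_pos (hβ σ) (hγ σ)
  have h1 := one_le_norm_of_totally_positive K htr β hβ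
  have h2 := one_le_norm_of_totally_positive K htr γ hγ
  have h3 := one_le_norm_of_totally_positive K htr (β + γ) hβγ
  have key : 4 ^ Module.finrank ℚ K * (Algebra.norm ℤ β * Algebra.norm ℤ γ) ≤
      Algebra.norm ℤ (β + γ) ^ 2 := by
    have hR : (4 : ℝ) ^ Module.finrank ℚ K *
        (((Algebra.norm ℤ β : ℤ) : ℝ) * ((Algebra.norm ℤ γ : ℤ) : ℝ)) ≤
        ((Algebra.norm ℤ (β + γ) : ℤ) : ℝ) ^ 2 := by
      simp only [norm_eq_prod_real_embeddings K htr]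
      rw [← AlgHom.card ℚ K ℂ, ← Finset.card_univ, ← Finset.prod_const,
        ← Finset.prod_mul_distrib, ← Finset.prod_mul_distrib, ← Finset.prod_pow]
      refine Finset.prod_le_prod (fun φ _ => ?_) fun φ _ => ?_
      · exact mul_nonneg (by norm_num) (mul_nonneg (hβ _).le (hγ _).le)
      · rw [RingOfIntegers.coe_eq_algebraMap (β + γ), map_add, map_add, ← mul_assoc]
        exact four_mul_le_sq_add _ _
    exact_mod_cast hR
  refine (pow_le_pow_iff_left₀ (by positivity) (by lia) two_ne_zero).mp ?_
  calc ((2 : ℤ) ^ Module.finrank ℚ K) ^ 2 = 4 ^ Module.finrank ℚ K := by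
        rw [← pow_mul, mul_comm, pow_mul]; norm_num
    _ ≤ 4 ^ Module.finrank ℚ K * (Algebra.norm ℤ β * Algebra.norm ℤ γ) :=
        le_mul_of_one_le_right (by positivity) (one_le_mul_of_one_le_of_one_le h1 h2)
    _ ≤ _ := key

/-- Let `K` be a totally real number field of degree `d` over `ℚ`.  Every totally
positive `α ∈ 𝓞 K` whose norm satisfies `N(α) < 2 ^ d` is indecomposable
(it is not a sum of two totally positive integers).  In particular every totally
positive unit of `𝓞 K` is indecomposable. -/
theorem indecomposable_of_norm_lt_two_pow
    (K : Type) [Field K] [NumberField K]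
    (htr : ∀ φ : K →+* ℂ, NumberField.ComplexEmbedding.IsReal φ) :
    (∀ α : 𝓞 K, (∀ σ : K →+* ℝ, 0 < σ (α : K)) →
      Algebra.norm ℤ α < 2 ^ (Module.finrank ℚ K) →
      ¬ ∃ β γ : 𝓞 K, (∀ σ : K →+* ℝ, 0 < σ (β : K)) ∧
        (∀ σ : K →+* ℝ, 0 < σ (γ : K)) ∧ α = β + γ) ∧
    (∀ ε : (𝓞 K)ˣ, (∀ σ : K →+* ℝ, 0 < σ ((ε : 𝓞 K) : K)) →
      ¬ ∃ β γ : 𝓞 K, (∀ σ : K →+* ℝ, 0 < σ (β : K)) ∧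
        (∀ σ : K →+* ℝ, 0 < σ (γ : K)) ∧ (ε : 𝓞 K) = β + γ) := by
  refine ⟨?_, ?_⟩
  · rintro α - hα ⟨β, γ, hβ, hγ, rfl⟩
    exact hα.not_ge (two_pow_le_norm_add K htr β γ hβ hγ)
  · rintro ε - ⟨β, γ, hβ, hγ, h⟩
    have hN := two_pow_le_norm_add K htr β γ hβ hγ
    rw [← h] at hN
    have hpow : (1 : ℤ) < 2 ^ Module.finrank ℚ K :=
      one_lt_pow₀ one_lt_two Module.finrank_pos.ne'
    rcases Int.isUnit_iff.mp (ε.isUnit.map (Algebra.norm ℤ)) with h1 | h1 <;> lia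
end

section
/- Let D > 1 be a squarefree integer with D ≡ 2 or 3 (mod 4), let K = ℚ(√D), let ε be a generator of the group of totally positive units of O_K, and let S ⊂ O_K^+ be a finite complete set of representatives of the indecomposable elements of O_K^+ up to multiplication by totally positive units. Then for every α ∈ O_K^+ there exist elements x_{σ,i}, y_{σ,i} ∈ O_K (σ ∈ S, 1 ≤ i ≤ 4) such that α = Σ_{σ∈S} [ σ·(x_{σ,1}² + x_{σ,2}² + x_{σ,3}² + x_{σ,4}²) + ε·σ·(y_{σ,1}² + y_{σ,2}² + y_{σ,3}² + y_{σ,4}²) ]; that is, the diagonal quadratic form ⊥_{σ∈S} ⟨σ, σ, σ, σ, εσ, εσ, εσ, εσ⟩ of rank 8·#S is universal over K. -/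
open NumberField

/-- `x ∈ 𝓞 K` is totally positive. -/
def TotPos (K : Type) [Field K] [NumberField K] (x : 𝓞 K) : Prop :=
  ∀ σ : K →+* ℝ, 0 < σ (x : K)

/-- `x ∈ 𝓞 K` is a totally positive indecomposable element. -/
def Indec (K : Type) [Field K] [NumberField K] (x : 𝓞 K) : Prop :=
  TotPos K x ∧ ¬ ∃ β γ : 𝓞 K, TotPos K β ∧ TotPos K γ ∧ x = β + γ

open Polynomial in
/-- The Chebyshev sequence `S n` evaluated at `t ≥ 2` is nonnegative and increasing for `n ≥ -1`. -/
lemma chebyshev_S_eval_nonneg_and_le {t : ℤ} (ht : 2 ≤ t) (n : ℕ) :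
    0 ≤ (Chebyshev.S ℤ ((n : ℤ) - 1)).eval t ∧
      (Chebyshev.S ℤ ((n : ℤ) - 1)).eval t ≤ (Chebyshev.S ℤ n).eval t := by
  induction n with
  | zero => simp
  | succ n ih =>
    obtain ⟨h0, h1⟩ := ih
    have h := congrArg (eval t) (Chebyshev.S_add_one ℤ n)
    simp only [eval_sub, eval_mul, eval_X] at h
    push_cast
    rw [add_sub_cancel_right, h]
    constructor
    · linarith
    · nlinarith

open Polynomial in
lemma chebyshev_S_eval_monotone {t : ℤ} (ht : 2 ≤ t) :
    Monotone fun n : ℤ => (Chebyshev.S ℤ n).eval t := by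
  refine monotone_int_of_le_succ fun n => ?_
  rcases le_or_gt (-1) n with hn | hn
  · obtain ⟨m, hm⟩ := Int.eq_ofNat_of_zero_le (a := n + 1) (by lia)
    obtain rfl : n = (m : ℤ) - 1 := by lia
    simpa using (chebyshev_S_eval_nonneg_and_le ht m).2
  · obtain ⟨m, hm⟩ := Int.eq_ofNat_of_zero_le (a := -n - 2) (by lia)
    obtain rfl : n = -(m : ℤ) - 2 := by lia
    have h1 : -(m : ℤ) - 2 + 1 = -((m : ℤ) - 1) - 2 := by ring
    simpa only [h1, Chebyshev.S_neg_sub_two, eval_neg, neg_le_neg_iff] using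
      (chebyshev_S_eval_nonneg_and_le ht m).2

section UnitPowers

variable {R : Type*} [CommRing R] {ε : Rˣ} {t : ℤ}

open Polynomial in
lemma chebyshev_S_eval_mul_zpow_sub (hε : (ε : R) ^ 2 - t * ε + 1 = 0) (n : ℤ) :
    (((Chebyshev.S ℤ n).eval t : ℤ) : R) * ((ε ^ n : Rˣ) : R) -
      (((Chebyshev.S ℤ (n - 1)).eval t : ℤ) : R) * ((ε ^ (n + 1) : Rˣ) : R) = 1 := by
  have step (n : ℤ) :
      (((Chebyshev.S ℤ (n + 1)).eval t : ℤ) : R) * ((ε ^ (n + 1) : Rˣ) : R) -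
        (((Chebyshev.S ℤ n).eval t : ℤ) : R) * ((ε ^ (n + 1 + 1) : Rˣ) : R) =
      (((Chebyshev.S ℤ n).eval t : ℤ) : R) * ((ε ^ n : Rˣ) : R) -
        (((Chebyshev.S ℤ (n - 1)).eval t : ℤ) : R) * ((ε ^ (n + 1) : Rˣ) : R) := by
    rw [Chebyshev.S_add_one]
    simp only [eval_sub, eval_mul, eval_X, zpow_add_one, Units.val_mul]
    push_cast
    linear_combination -(((Chebyshev.S ℤ n).eval t : ℤ) : R) * ((ε ^ n : Rˣ) : R) * hε
  induction n using Int.induction_on with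
  | zero => simp
  | succ n ih => rw [add_sub_cancel_right, step, ih]
  | pred n ih =>
    rw [← ih]
    simpa using (step (-(n : ℤ) - 1)).symm

/-- A sum of powers of a unit `ε` with `ε + ε⁻¹ = t ≥ 2` is a nonnegative combination of two
consecutive powers of `ε`. -/
lemma exists_eq_add_consecutive_zpow (ht : 2 ≤ t) (hε : (ε : R) ^ 2 - t * ε + 1 = 0) {x : R}
    (hx : x ∈ AddSubmonoid.closure (Set.range fun n : ℤ => ((ε ^ n : Rˣ) : R))) :
    ∃ (k : ℤ) (a b : ℕ), x = a * ((ε ^ k : Rˣ) : R) + b * ((ε ^ (k + 1) : Rˣ) : R) := by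
  obtain ⟨p, hmono, hp, ⟨k₀, hk₀⟩, ⟨k₁, hk₁⟩⟩ : ∃ p : ℤ → ℤ, Monotone p ∧
      (∀ k, x = p k * ((ε ^ k : Rˣ) : R) - p (k - 1) * ((ε ^ (k + 1) : Rˣ) : R)) ∧
      (∃ k, 0 ≤ p k) ∧ ∃ k, p k ≤ 0 := by
    induction hx using AddSubmonoid.closure_induction with
    | mem x hx =>
      obtain ⟨j, rfl⟩ := hx
      refine ⟨fun k => (Polynomial.Chebyshev.S ℤ (k - j)).eval t,
        fun a b hab => chebyshev_S_eval_monotone ht (by lia), fun k => ?_,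
        ⟨j, by simp⟩, ⟨j - 1, by simp⟩⟩
      have h := chebyshev_S_eval_mul_zpow_sub hε (k - j)
      have h1 : ((ε ^ k : Rˣ) : R) = ((ε ^ (k - j) : Rˣ) : R) * ((ε ^ j : Rˣ) : R) := by
        rw [← Units.val_mul, ← zpow_add, sub_add_cancel]
      have h2 : ((ε ^ (k + 1) : Rˣ) : R) =
          ((ε ^ (k - j + 1) : Rˣ) : R) * ((ε ^ j : Rˣ) : R) := by
        rw [← Units.val_mul, ← zpow_add]
        congr 2
        ring
      have h3 : k - 1 - j = k - j - 1 := by ring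
      simp only [h1, h2, h3]
      linear_combination -((ε ^ j : Rˣ) : R) * h
    | zero => exact ⟨0, monotone_const, by simp, ⟨0, le_rfl⟩, ⟨0, le_rfl⟩⟩
    | add x y _ _ ihx ihy =>
      obtain ⟨p, hp, hx, ⟨a, ha⟩, ⟨b, hb⟩⟩ := ihx
      obtain ⟨q, hq, hy, ⟨c, hc⟩, ⟨d, hd⟩⟩ := ihy
      refine ⟨p + q, hp.add hq, fun k => ?_, ⟨max a c, ?_⟩, ⟨min b d, ?_⟩⟩
      · nth_rw 1 [hx k, hy k]
        simp only [Pi.add_apply]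
        push_cast
        ring
      · exact add_nonneg (ha.trans (hp (le_max_left a c))) (hc.trans (hq (le_max_right a c)))
      · exact add_nonpos ((hp (min_le_left b d)).trans hb) ((hq (min_le_right b d)).trans hd)
  obtain ⟨k, hk, hk'⟩ : ∃ k, 0 ≤ p k ∧ p (k - 1) ≤ 0 := by
    by_cases hall : ∀ k, 0 ≤ p k
    · exact ⟨k₁, hall k₁, (hmono (by lia)).trans hk₁⟩
    · push Not at hall
      obtain ⟨l, hl⟩ := hall
      obtain ⟨m, hm, hmin⟩ := Int.exists_least_of_bdd (P := fun k => 0 ≤ p k)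
        ⟨l, fun z hz => by
          by_contra! h
          exact absurd (hmono h.le) (by lia)⟩ ⟨k₀, hk₀⟩
      refine ⟨m, hm, ?_⟩
      by_contra! h
      have := hmin (m - 1) h.le
      lia
  obtain ⟨a, ha⟩ := Int.eq_ofNat_of_zero_le hk
  obtain ⟨b, hb⟩ := Int.eq_ofNat_of_zero_le (neg_nonneg.2 hk')
  refine ⟨k, a, b, ?_⟩
  have hb' : p (k - 1) = -(b : ℤ) := by lia
  rw [hp k, ha, hb']
  push_cast
  ring

/-- A natural number times the square of `c` is a sum of four squares. -/
lemma exists_natCast_mul_sq_eq_sum_four_squares (n : ℕ) (c : R) :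
    ∃ x : Fin 4 → R, n * c ^ 2 = ∑ i, x i ^ 2 := by
  obtain ⟨p, q, r, s, rfl⟩ := Nat.sum_four_squares n
  refine ⟨![p * c, q * c, r * c, s * c], ?_⟩
  simp [Fin.sum_univ_four]
  ring

lemma exists_eq_sum_four_squares_add_mul (ht : 2 ≤ t) (hε : (ε : R) ^ 2 - t * ε + 1 = 0) {x : R}
    (hx : x ∈ AddSubmonoid.closure (Set.range fun n : ℤ => ((ε ^ n : Rˣ) : R))) :
    ∃ y z : Fin 4 → R, x = ∑ i, y i ^ 2 + ε * ∑ i, z i ^ 2 := by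
  obtain ⟨k, a, b, rfl⟩ := exists_eq_add_consecutive_zpow ht hε hx
  obtain ⟨m, rfl | rfl⟩ := Int.even_or_odd' k
  · obtain ⟨y, hy⟩ := exists_natCast_mul_sq_eq_sum_four_squares a ((ε ^ m : Rˣ) : R)
    obtain ⟨z, hz⟩ := exists_natCast_mul_sq_eq_sum_four_squares b ((ε ^ m : Rˣ) : R)
    refine ⟨y, z, ?_⟩
    rw [← hy, ← hz, zpow_add_one, mul_comm 2 m, zpow_mul, zpow_ofNat]
    push_cast
    ring
  · obtain ⟨y, hy⟩ := exists_natCast_mul_sq_eq_sum_four_squares b ((ε ^ (m + 1) : Rˣ) : R)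
    obtain ⟨z, hz⟩ := exists_natCast_mul_sq_eq_sum_four_squares a ((ε ^ m : Rˣ) : R)
    refine ⟨y, z, ?_⟩
    rw [← hy, ← hz, zpow_add_one ε (2 * m + 1), zpow_add_one ε (2 * m), zpow_add_one ε m,
      mul_comm 2 m, zpow_mul, zpow_ofNat]
    push_cast
    ring

end UnitPowers

/-- A quadratic field containing a square root of a squarefree `D > 1` has a real embedding. -/
lemma nonempty_ringHom_real_of_sq_eq {D : ℤ} (hD : 1 < D) (hsf : Squarefree D)
    {K : Type*} [Field K] [NumberField K] {sd : K} (hsd : sd ^ 2 = (D : K))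
    (hdeg : Module.finrank ℚ K = 2) : Nonempty (K →+* ℝ) := by
  have : IsSimpleOrder (Subalgebra ℚ K) := Subalgebra.isSimpleOrder_of_finrank hdeg
  have hmem : sd ∉ (⊥ : Subalgebra ℚ K) := by
    rintro ⟨q, hq⟩
    have hq' : q ^ 2 = (D : ℚ) := by
      apply (algebraMap ℚ K).injective
      rw [map_pow, map_intCast, ← hsd]
      exact congrArg (· ^ 2) hq
    obtain ⟨r, hr⟩ := Rat.isSquare_intCast_iff.1 ⟨q, hq'.symm.trans (sq q)⟩
    rcases Int.isUnit_iff.1 (hsf r ⟨1, by rw [hr, mul_one]⟩) with rfl | rfl <;> lia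
  have htop : Algebra.adjoin ℚ {sd} = ⊤ :=
    (eq_bot_or_eq_top _).resolve_left fun h =>
      hmem (h ▸ Algebra.subset_adjoin (Set.mem_singleton sd))
  obtain ⟨φ⟩ : Nonempty (K →+* ℂ) := inferInstance
  have hφ : φ sd ^ 2 = ((√(D : ℝ) : ℝ) : ℂ) ^ 2 := by
    rw [← map_pow, hsd, map_intCast, ← Complex.ofReal_pow, Real.sq_sqrt (by positivity)]
    simp
  have hreal : ComplexEmbedding.IsReal φ := by
    rw [ComplexEmbedding.isReal_iff]
    have h : (ComplexEmbedding.conjugate φ).toRatAlgHom = φ.toRatAlgHom := by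
      refine AlgHom.ext_of_adjoin_eq_top htop fun x hx => ?_
      obtain rfl : x = sd := hx
      rcases sq_eq_sq_iff_eq_or_eq_neg.1 hφ with h | h <;>
        simp [ComplexEmbedding.conjugate_coe_eq, h]
    ext x
    exact DFunLike.congr_fun h x
  exact ⟨hreal.embedding⟩

section TotPos

variable {K : Type} [Field K] [NumberField K]

lemma TotPos.trace_pos [IsGalois ℚ K] (φ : K →+* ℝ) {x : 𝓞 K} (hx : TotPos K x) :
    0 < Algebra.trace ℤ (𝓞 K) x := by
  have h := congrArg φ (trace_eq_sum_automorphisms (K := ℚ) (x : K))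
  rw [← Algebra.coe_trace_int, map_sum] at h
  have hpos : 0 < ∑ g : Gal(K/ℚ), φ (g x) :=
    Finset.sum_pos (fun g _ => hx (φ.comp (g : K →+* K))) Finset.univ_nonempty
  rw [← h] at hpos
  simpa using hpos

lemma TotPos.norm_pos [IsGalois ℚ K] (φ : K →+* ℝ) {x : 𝓞 K} (hx : TotPos K x) :
    0 < Algebra.norm ℤ x := by
  have h := congrArg φ (Algebra.norm_eq_prod_automorphisms ℚ (x : K))
  rw [← Algebra.coe_norm_int, map_prod] at h
  have hpos : 0 < ∏ g : Gal(K/ℚ), φ (g x) :=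
    Finset.prod_pos fun g _ => hx (φ.comp (g : K →+* K))
  rw [← h] at hpos
  simpa using hpos

lemma sq_sub_trace_mul_add_norm_eq_zero (hdeg : Module.finrank ℚ K = 2) (x : 𝓞 K) :
    x ^ 2 - (Algebra.trace ℤ (𝓞 K) x : 𝓞 K) * x + (Algebra.norm ℤ x : 𝓞 K) = 0 := by
  let b : Module.Basis (Fin 2) ℤ (𝓞 K) :=
    Module.finBasisOfFinrankEq ℤ (𝓞 K) ((RingOfIntegers.rank K).trans hdeg)
  apply Algebra.leftMulMatrix_injective b
  have h := Matrix.aeval_self_charpoly (Algebra.leftMulMatrix b x)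
  rw [Matrix.charpoly_fin_two] at h
  rw [Algebra.trace_eq_matrix_trace b, Algebra.norm_eq_matrix_det b]
  simpa [Algebra.algebraMap_eq_smul_one] using h

/-- A totally positive unit of a real quadratic field is a root of `X ^ 2 - t * X + 1` for some
integer `t ≥ 2`. -/
lemma TotPos.exists_sq_sub_mul_add_one_eq_zero (φ : K →+* ℝ) (hdeg : Module.finrank ℚ K = 2)
    {ε : (𝓞 K)ˣ} (hε : TotPos K (ε : 𝓞 K)) :
    ∃ t : ℤ, 2 ≤ t ∧ (ε : 𝓞 K) ^ 2 - t * ε + 1 = 0 := by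
  have : Algebra.IsQuadraticExtension ℚ K := ⟨hdeg⟩
  have hnorm : Algebra.norm ℤ (ε : 𝓞 K) = 1 :=
    (Int.isUnit_iff.1 (ε.isUnit.map (Algebra.norm ℤ))).resolve_right
      fun h => by linarith [hε.norm_pos φ]
  have h := sq_sub_trace_mul_add_norm_eq_zero hdeg (ε : 𝓞 K)
  rw [hnorm, Int.cast_one] at h
  refine ⟨_, ?_, h⟩
  have h' := congrArg (fun y : 𝓞 K => φ (y : K)) h
  simp at h'
  have hpos := hε φ
  have : (2 : ℝ) ≤ (Algebra.trace ℤ (𝓞 K) (ε : 𝓞 K) : ℤ) := by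
    by_contra! hlt
    nlinarith [sq_nonneg (φ ((ε : 𝓞 K) : K) - 1)]
  exact_mod_cast this

/-- Every totally positive integer is a sum of indecomposables. -/
lemma TotPos.mem_closure_indec [IsGalois ℚ K] (φ : K →+* ℝ) {x : 𝓞 K} (hx : TotPos K x) :
    x ∈ AddSubmonoid.closure {y : 𝓞 K | Indec K y} := by
  induction hn : (Algebra.trace ℤ (𝓞 K) x).toNat using Nat.strong_induction_on generalizing x with
  | _ n ih =>
    by_cases hind : Indec K x
    · exact AddSubmonoid.subset_closure hind
    · obtain ⟨β, γ, hβ, hγ, rfl⟩ := not_not.1 fun h => hind ⟨hx, h⟩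
      have hβ' := hβ.trace_pos φ
      have hγ' := hγ.trace_pos φ
      rw [map_add] at hn
      exact add_mem (ih _ (by lia) hβ rfl) (ih _ (by lia) hγ rfl)

end TotPos

/-- Let `D > 1` be squarefree, `D ≡ 2, 3 (mod 4)`, `K = ℚ(√D)`, let `ε` generate the
group of totally positive units of `𝓞 K`, and let `S` be a finite complete set of
representatives of the indecomposables of `𝓞 K` up to multiplication by totally
positive units.  Then the diagonal quadratic form
`⊥_{τ ∈ S} ⟨τ, τ, τ, τ, ετ, ετ, ετ, ετ⟩` of rank `8 · #S` is universal over `K`: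
every totally positive `α ∈ 𝓞 K` can be written as
`α = Σ_{τ ∈ S} (τ·(x_{τ,1}² + ⋯ + x_{τ,4}²) + ε·τ·(y_{τ,1}² + ⋯ + y_{τ,4}²))`. -/
theorem universal_octonary_form
    (D : ℤ) (hD : 1 < D) (hsf : Squarefree D) (hD4 : D % 4 = 2 ∨ D % 4 = 3)
    (K : Type) [Field K] [NumberField K]
    (sd : K) (hsd : sd ^ 2 = (D : K)) (hdeg : Module.finrank ℚ K = 2)
    (ε : (𝓞 K)ˣ) (hεpos : TotPos K (ε : 𝓞 K))
    (hεgen : ∀ u : (𝓞 K)ˣ, TotPos K (u : 𝓞 K) → ∃ n : ℤ, u = ε ^ n)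
    (S : Finset (𝓞 K))
    (hSind : ∀ τ ∈ S, Indec K τ)
    (hScomplete : ∀ α : 𝓞 K, Indec K α →
      ∃ τ ∈ S, ∃ u : (𝓞 K)ˣ, TotPos K (u : 𝓞 K) ∧ α = (u : 𝓞 K) * τ)
    (hSirredundant : ∀ τ₁ ∈ S, ∀ τ₂ ∈ S,
      (∃ u : (𝓞 K)ˣ, TotPos K (u : 𝓞 K) ∧ τ₁ = (u : 𝓞 K) * τ₂) → τ₁ = τ₂) :
    ∀ α : 𝓞 K, TotPos K α →
      ∃ x y : 𝓞 K → Fin 4 → 𝓞 K,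
        α = ∑ τ ∈ S, (τ * ∑ i, (x τ i) ^ 2 + (ε : 𝓞 K) * τ * ∑ i, (y τ i) ^ 2) := by
  classical
  intro α hα
  obtain ⟨φ⟩ := nonempty_ringHom_real_of_sq_eq hD hsf hsd hdeg
  have : Algebra.IsQuadraticExtension ℚ K := ⟨hdeg⟩
  obtain ⟨t, ht, hεt⟩ := hεpos.exists_sq_sub_mul_add_one_eq_zero φ hdeg
  obtain ⟨s, hs, hαs⟩ : ∃ s : 𝓞 K → 𝓞 K,
      (∀ τ, s τ ∈ AddSubmonoid.closure (Set.range fun n : ℤ => ((ε ^ n : (𝓞 K)ˣ) : 𝓞 K))) ∧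
      α = ∑ τ ∈ S, τ * s τ := by
    have hα' := hα.mem_closure_indec φ
    clear hα
    induction hα' using AddSubmonoid.closure_induction with
    | mem β hβ =>
      obtain ⟨τ, hτ, u, hu, rfl⟩ := hScomplete β hβ
      obtain ⟨n, rfl⟩ := hεgen u hu
      refine ⟨Pi.single τ ((ε ^ n : (𝓞 K)ˣ) : 𝓞 K), fun ρ => ?_, ?_⟩
      · by_cases h : ρ = τ
        · subst h
          rw [Pi.single_eq_same]
          exact AddSubmonoid.subset_closure ⟨n, rfl⟩
        · rw [Pi.single_eq_of_ne h]
          exact zero_mem _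
      · rw [Finset.sum_eq_single_of_mem τ hτ fun ρ _ h => by rw [Pi.single_eq_of_ne h, mul_zero],
          Pi.single_eq_same, mul_comm]
    | zero => exact ⟨0, fun _ => zero_mem _, by simp⟩
    | add β γ _ _ ihβ ihγ =>
      obtain ⟨s, hs, rfl⟩ := ihβ
      obtain ⟨r, hr, rfl⟩ := ihγ
      exact ⟨s + r, fun τ => add_mem (hs τ) (hr τ), by simp [mul_add, Finset.sum_add_distrib]⟩
  choose x y hxy using fun τ => exists_eq_sum_four_squares_add_mul ht hεt (hs τ)
  refine ⟨x, y, hαs.trans (Finset.sum_congr rfl fun τ _ => ?_)⟩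
  rw [hxy τ]
  ring
end
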